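/- arXiv:1711.11060 — 7 statements merged into one kernel-verified Lean document; each statement's English description precedes it below -/
import Mathlib

section
/- Let A, B ⊆ ℤ be finite sets with |A| = |B| = n. Let η, δ > 0 satisfy 11η^{1/2} + δ < (√5 − 1)/2 and n > 2η^{-1/2}. Assume that #{x ∈ A + B : r_{A+B}(x) ≥ ηn²/|A+B|} ≤ (2 + δ)n. Then there exist arithmetic progressions P, Q with the same common difference and each of size at most (1 + δ + 5η^{1/2})n, such that |A ∩ P| ≥ (1 − η^{1/2})n and |B ∩ Q| ≥ (1 − η^{1/2})n. -/
open Finset Pointwise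

lemma fiber_sum_bound {G : Type*} [AddCommGroup G] [Fintype G] [DecidableEq G]
    (H1 H2 : AddSubgroup G) (X Y : Finset G) (hX : ∀ x ∈ X, x ∈ H1) (hY : ∀ y ∈ Y, y ∈ H2) :
    X.card * Y.card ≤ Nat.card (H1 ⊓ H2 : AddSubgroup G) * (X + Y).card := by
  classical
  rw [← card_product]
  have hJ : Nat.card (H1 ⊓ H2 : AddSubgroup G)
      = (univ.filter (fun x => x ∈ (H1 ⊓ H2 : AddSubgroup G))).card := by
    rw [Nat.card_eq_fintype_card, Fintype.card_subtype]
  have := Finset.card_le_mul_card_image_of_maps_to (s := X ×ˢ Y) (t := X + Y)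
    (f := fun p => p.1 + p.2) (fun p hp => by
      rw [mem_product] at hp
      exact add_mem_add hp.1 hp.2) (Nat.card (H1 ⊓ H2 : AddSubgroup G)) ?_
  · exact this
  intro z hz
  obtain ⟨x0, hx0, y0, hy0, rfl⟩ := mem_add.1 hz
  rw [hJ]
  apply card_le_card_of_injOn (fun p => p.1 - x0)
  · rintro ⟨x, y⟩ hp
    simp only [coe_filter, mem_product, Set.mem_ofPred_eq] at hp
    simp only [coe_filter, mem_univ, true_and, Set.mem_ofPred_eq, AddSubgroup.mem_inf]
    refine ⟨H1.sub_mem (hX _ hp.1.1) (hX _ hx0), ?_⟩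
    have : x - x0 = y0 - y := by
      rw [sub_eq_sub_iff_add_eq_add, hp.2, add_comm]
    rw [this]
    exact H2.sub_mem (hY _ hy0) (hY _ hp.1.2)
  · rintro ⟨x, y⟩ hp ⟨x', y'⟩ hp' h
    simp only [coe_filter, mem_product, Set.mem_ofPred_eq] at hp hp'
    have h1 : x = x' := by simpa using h
    subst h1
    have : y = y' := by
      have := hp.2.trans hp'.2.symm
      simpa using this
    rw [this]

/-- arithmetic in the union lemma -/
lemma union_arith (x y h1 h2 j c1 c2 : ℕ) (hj : 0 < j)
    (hx : j ≤ x) (hx1 : x ≤ h1) (hy1 : y + j ≤ h2) 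
    (hc2 : x * (h2 - y) ≤ j * c2) (hc1 : (h1 - x) * y ≤ j * c1)
    (hxx : x = h1 ∨ x + j ≤ h1) (hyy : y = 0 ∨ j ≤ y) :
    h1 ≤ c2 + j ∨ h2 ≤ c1 + j ∨ h2 ≤ c2 := by
  obtain ⟨y', rfl⟩ := Nat.exists_eq_add_of_le hy1
  obtain ⟨x', rfl⟩ := Nat.exists_eq_add_of_le hx1
  have e1 : y + j + y' - y = j + y' := by omega
  have e2 : x + x' - x = x' := by omega
  rw [e1] at hc2
  rw [e2] at hc1
  rcases hxx with hxx | hxx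
  · have : x' = 0 := by omega
    subst this
    left
    have : x * j ≤ j * c2 := le_trans (Nat.mul_le_mul_left _ (by omega)) hc2
    have : x ≤ c2 := by
      rw [mul_comm] at this
      exact Nat.le_of_mul_le_mul_left this hj
    omega
  rcases hyy with hyy | hyy
  · subst hyy
    right; right
    have : j * (j + y') ≤ j * c2 := le_trans (Nat.mul_le_mul_right _ hx) hc2
    have := Nat.le_of_mul_le_mul_left this hj
    omega
  by_contra hcon
  push Not at hcon
  obtain ⟨h1, h2, -⟩ := hcon
  obtain ⟨x, rfl⟩ := Nat.exists_eq_add_of_le hx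
  obtain ⟨y, rfl⟩ := Nat.exists_eq_add_of_le hyy
  obtain ⟨z, rfl⟩ : ∃ z, x' = j + z := Nat.exists_eq_add_of_le (by omega)
  have a1 : c2 + 1 ≤ x + j + z := by omega
  have a2 : c1 + 1 ≤ y + j + y' := by omega
  have b1 : (j + x) * (j + y') + j ≤ j * (x + j + z) := by
    calc _ ≤ j * c2 + j := by omega
      _ = j * (c2 + 1) := by ring
      _ ≤ _ := Nat.mul_le_mul_left _ a1
  have b2 : (j + z) * (j + y) + j ≤ j * (y + j + y') := by
    calc _ ≤ j * c1 + j := by omega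
      _ = j * (c1 + 1) := by ring
      _ ≤ _ := Nat.mul_le_mul_left _ a2
  nlinarith [Nat.zero_le (x * y'), Nat.zero_le (z*y)]

lemma union_aux {G : Type*} [AddCommGroup G] [Fintype G] [DecidableEq G]
    (C1 C2 : Finset G) (H1 H2 : AddSubgroup G)
    (hH1 : ∀ x ∈ H1, ∀ c, x + c ∈ C1 ↔ c ∈ C1) (hH2 : ∀ x ∈ H2, ∀ c, x + c ∈ C2 ↔ c ∈ C2)
    (c : G) (hc2 : c ∈ C2) (hc1 : c ∉ C1) :
    Nat.card H1 ≤ (C2 \ C1).card + Nat.card (H1 ⊓ H2 : AddSubgroup G) ∨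
    Nat.card H2 ≤ (C1 \ C2).card + Nat.card (H1 ⊓ H2 : AddSubgroup G) ∨
    Nat.card H2 ≤ (C2 \ C1).card := by
  classical
  set J : AddSubgroup G := H1 ⊓ H2 with hJdef
  have hJ : Nat.card J = (univ.filter (fun x => x ∈ J)).card := by
    rw [Nat.card_eq_fintype_card, Fintype.card_subtype]
  have hh1 : Nat.card H1 = (univ.filter (fun x => x ∈ H1)).card := by
    rw [Nat.card_eq_fintype_card, Fintype.card_subtype]
  have hh2 : Nat.card H2 = (univ.filter (fun x => x ∈ H2)).card := by
    rw [Nat.card_eq_fintype_card, Fintype.card_subtype]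
  set X := univ.filter (fun x => x ∈ H1 ∧ x + c ∈ C2) with hX
  set X' := univ.filter (fun x => x ∈ H1 ∧ x + c ∉ C2) with hX'
  set Y := univ.filter (fun x => x ∈ H2 ∧ x + c ∈ C1) with hY
  set Y' := univ.filter (fun x => x ∈ H2 ∧ x + c ∉ C1) with hY'
  have hXX : X.card + X'.card = Nat.card H1 := by
    rw [hh1, hX, hX', ← filter_filter, ← filter_filter]
    exact card_filter_add_card_filter_not _
  have hYY : Y.card + Y'.card = Nat.card H2 := by
    rw [hh2, hY, hY', ← filter_filter, ← filter_filter]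
    exact card_filter_add_card_filter_not _
  have mJ : ∀ (Z : Finset G), (∃ z ∈ Z, ∀ x ∈ J, x + z ∈ Z) → Nat.card J ≤ Z.card := by
    rintro Z ⟨z, -, h⟩
    rw [hJ]
    apply card_le_card_of_injOn (fun x => x + z)
    · intro x hx
      simp at hx
      exact h x hx
    · intro x _ y _ h
      simpa using h
  have inf1 : ∀ x ∈ J, x ∈ H1 := fun x hx => (AddSubgroup.mem_inf.1 hx).1
  have inf2 : ∀ x ∈ J, x ∈ H2 := fun x hx => (AddSubgroup.mem_inf.1 hx).2
  have hXJ : Nat.card J ≤ X.card := by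
    apply mJ
    refine ⟨0, by simp [hX, hc2, H1.zero_mem], fun x hx => ?_⟩
    simp [hX, inf1 x hx, (hH2 x (inf2 x hx) c), hc2]
  have hYJ : Nat.card J ≤ Y'.card := by
    apply mJ
    refine ⟨0, by simp [hY', hc1, H2.zero_mem], fun x hx => ?_⟩
    simp [hY', inf2 x hx, (hH1 x (inf1 x hx) c), hc1]
  have hXJ' : X'.card = 0 ∨ Nat.card J ≤ X'.card := by
    rcases X'.eq_empty_or_nonempty with h | ⟨z, hz⟩
    · left; rw [h]; rfl
    · right
      apply mJ
      refine ⟨z, hz, fun x hx => ?_⟩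
      simp [hX'] at hz ⊢
      refine ⟨H1.add_mem (inf1 x hx) hz.1, ?_⟩
      rw [add_assoc, hH2 x (inf2 x hx)]
      exact hz.2
  have hYJ' : Y.card = 0 ∨ Nat.card J ≤ Y.card := by
    rcases Y.eq_empty_or_nonempty with h | ⟨z, hz⟩
    · left; rw [h]; rfl
    · right
      apply mJ
      refine ⟨z, hz, fun x hx => ?_⟩
      simp [hY] at hz ⊢
      refine ⟨H2.add_mem (inf2 x hx) hz.1, ?_⟩
      rw [add_assoc, hH1 x (inf1 x hx)]
      exact hz.2
  have s1 : (X + Y').card ≤ (C2 \ C1).card := by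
    apply card_le_card_of_injOn (fun x => x + c)
    · intro z hz
      obtain ⟨x, hx, y, hy, rfl⟩ := mem_add.1 (mem_coe.1 hz)
      simp [hX, hY'] at hx hy ⊢
      refine ⟨?_, ?_⟩
      · rw [add_comm x y, add_assoc, hH2 y hy.1]; exact hx.2
      · rw [add_assoc, hH1 x hx.1]; exact hy.2
    · intro x _ y _ h
      simpa using h
  have s2 : (X' + Y).card ≤ (C1 \ C2).card := by
    apply card_le_card_of_injOn (fun x => x + c)
    · intro z hz
      obtain ⟨x, hx, y, hy, rfl⟩ := mem_add.1 (mem_coe.1 hz)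
      simp [hX', hY] at hx hy ⊢
      refine ⟨?_, ?_⟩
      · rw [add_assoc, hH1 x hx.1]; exact hy.2
      · rw [add_comm x y, add_assoc, hH2 y hy.1]; exact hx.2
    · intro x _ y _ h
      simpa using h
  have t1 := fiber_sum_bound H1 H2 X Y' (by simp [hX]; tauto) (by simp [hY']; tauto)
  have t2 := fiber_sum_bound H1 H2 X' Y (by simp [hX']; tauto) (by simp [hY]; tauto)
  have hpos : 0 < Nat.card J := Nat.card_pos
  rw [← hJdef] at t1 t2
  apply union_arith X.card Y.card (Nat.card H1) (Nat.card H2) (Nat.card J) _ _ hpos hXJ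
    (by omega) (by omega) _ _ (by omega) (by omega)
  · rw [← hYY, Nat.add_sub_cancel_left]
    exact t1.trans (Nat.mul_le_mul_left _ s1)
  · rw [← hXX, Nat.add_sub_cancel_left]
    exact t2.trans (Nat.mul_le_mul_left _ s2)

lemma mem_stab {G : Type*} [AddCommGroup G] [DecidableEq G] (C : Finset G) (x : G) :
    x ∈ AddAction.stabilizer G C ↔ ∀ c, x + c ∈ C ↔ c ∈ C := by
  rw [AddAction.mem_stabilizer_finset]
  rfl

lemma stab_le_inf {G : Type*} [AddCommGroup G] [Fintype G] [DecidableEq G] (C1 C2 : Finset G) :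
    AddAction.stabilizer G C1 ⊓ AddAction.stabilizer G C2 ≤ AddAction.stabilizer G (C1 ∪ C2) := by
  intro x hx
  rw [AddSubgroup.mem_inf, mem_stab, mem_stab] at hx
  rw [mem_stab]
  intro c
  rw [mem_union, mem_union, hx.1, hx.2]

lemma union_lemma {G : Type*} [AddCommGroup G] [Fintype G] [DecidableEq G]
    (C1 C2 : Finset G) (m : ℕ)
    (h1 : m ≤ C1.card + Nat.card (AddAction.stabilizer G C1))
    (h2 : m ≤ C2.card + Nat.card (AddAction.stabilizer G C2)) :
    m ≤ (C1 ∪ C2).card + Nat.card (AddAction.stabilizer G (C1 ∪ C2)) := by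
  classical
  by_cases c12 : C1 ⊆ C2
  · rw [union_eq_right.2 c12]; exact h2
  by_cases c21 : C2 ⊆ C1
  · rw [union_eq_left.2 c21]; exact h1
  rw [not_subset] at c12 c21
  obtain ⟨c, hc1, hc2⟩ := c12
  obtain ⟨d, hd2, hd1⟩ := c21
  have hle := Nat.card_mono (Set.toFinite _)
    (show ((AddAction.stabilizer G C1 ⊓ AddAction.stabilizer G C2 : AddSubgroup G) : Set G) ⊆
      (AddAction.stabilizer G (C1 ∪ C2) : AddSubgroup G) from stab_le_inf C1 C2)
  have u1 := union_aux C1 C2 _ _ (fun x hx => (mem_stab C1 x).1 hx)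
    (fun x hx => (mem_stab C2 x).1 hx) d hd2 hd1
  have u2 := union_aux C2 C1 _ _ (fun x hx => (mem_stab C2 x).1 hx)
    (fun x hx => (mem_stab C1 x).1 hx) c hc1 hc2
  rw [inf_comm] at u2
  have e1 : (C1 ∪ C2).card = C1.card + (C2 \ C1).card := by
    rw [union_comm, ← card_sdiff_add_card, add_comm]
  have e2 : (C1 ∪ C2).card = C2.card + (C1 \ C2).card := by
    rw [← card_sdiff_add_card, add_comm]
  simp only [SetLike.coe_sort_coe] at hle
  omega

lemma transform_lemma {G : Type*} [AddCommGroup G] [Fintype G] [DecidableEq G] (k : ℕ) :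
    ∀ (A B : Finset G) (a : G), B.card ≤ k → a ∈ A → (0 : G) ∈ B →
    ∃ C, a ∈ C ∧ C ⊆ A + B ∧ A.card + B.card ≤ C.card + Nat.card (AddAction.stabilizer G C) := by
  classical
  induction k with
  | zero =>
    intro A B a hB ha h0
    have : B = ∅ := card_eq_zero.1 (by omega)
    simp [this] at h0
  | succ k ih =>
    intro A B a hB ha h0
    by_cases h : ∀ e ∈ A, ∀ b ∈ B, b + e ∈ A
    · refine ⟨A, ha, ?_, ?_⟩
      · intro x hx
        exact mem_add.2 ⟨x, hx, 0, h0, add_zero x⟩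
      · have hsub : ∀ b ∈ B, b ∈ AddAction.stabilizer G A := by
          intro b hb
          rw [AddAction.mem_stabilizer_iff]
          apply eq_of_subset_of_card_le
          · intro x hx
            obtain ⟨y, hy, rfl⟩ := mem_vadd_finset.1 hx
            exact h y hy b hb
          · rw [card_vadd_finset]
        have : B.card ≤ Nat.card (AddAction.stabilizer G A) := by
          rw [Nat.card_eq_fintype_card, Fintype.card_subtype]
          exact card_le_card (fun b hb => by simpa using hsub b hb)
        omega
    · push Not at h
      obtain ⟨e, he, b, hb, hbe⟩ := h
      set B1 := B.filter (fun b => b + e ∈ A) with hB1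
      set A1 := A ∪ (B.filter (fun b => b + e ∉ A)).image (fun b => b + e) with hA1
      have hlt : B1.card < B.card := by
        apply card_lt_card
        rw [hB1, filter_ssubset]
        exact ⟨b, hb, hbe⟩
      obtain ⟨C, haC, hCs, hC⟩ := ih A1 B1 a (by omega) (mem_union_left _ ha)
        (by rw [hB1, mem_filter]; exact ⟨h0, by simpa using he⟩)
      refine ⟨C, haC, hCs.trans ?_, ?_⟩
      · intro x hx
        obtain ⟨y, hy, z, hz, rfl⟩ := mem_add.1 hx
        rw [hB1, mem_filter] at hz
        rw [hA1, mem_union, mem_image] at hy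
        rcases hy with hy | ⟨w, hw, rfl⟩
        · exact add_mem_add hy hz.1
        · rw [mem_filter] at hw
          have : w + e + z = (z + e) + w := by abel
          rw [this]
          exact add_mem_add hz.2 hw.1
      · have : A1.card = A.card + (B.filter (fun b => b + e ∉ A)).card := by
          rw [hA1, card_union_of_disjoint, card_image_of_injective]
          · exact add_left_injective e
          · rw [disjoint_left]
            intro x hx hx'
            obtain ⟨w, hw, rfl⟩ := mem_image.1 hx'
            rw [mem_filter] at hw
            exact hw.2 hx
        have h2 : B1.card + (B.filter (fun b => b + e ∉ A)).card = B.card :=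
          card_filter_add_card_filter_not _
        omega

lemma transform_lemma' {G : Type*} [AddCommGroup G] [Fintype G] [DecidableEq G] 
    (A B : Finset G) (c : G) (hc : c ∈ A + B) :
    ∃ C, c ∈ C ∧ C ⊆ A + B ∧ A.card + B.card ≤ C.card + Nat.card (AddAction.stabilizer G C) := by
  classical
  obtain ⟨a, ha, b, hb, rfl⟩ := mem_add.1 hc
  obtain ⟨C, h1, h2, h3⟩ := transform_lemma _ (A.image (· + b)) (B.image (· - b)) (a + b) le_rfl
    (mem_image_of_mem _ ha) (mem_image.2 ⟨b, hb, sub_self b⟩)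
  refine ⟨C, h1, h2.trans ?_, ?_⟩
  · intro x hx
    obtain ⟨y, hy, z, hz, rfl⟩ := mem_add.1 hx
    obtain ⟨y, hy', rfl⟩ := mem_image.1 hy
    obtain ⟨z, hz', rfl⟩ := mem_image.1 hz
    have : y + b + (z - b) = y + z := by abel
    rw [this]
    exact add_mem_add hy' hz'
  · rwa [card_image_of_injective _ (add_left_injective b),
      card_image_of_injective _ (sub_left_injective (b := b))] at h3

/-- Kneser's theorem, weak form. -/
lemma kneser_weak {G : Type*} [AddCommGroup G] [Fintype G] [DecidableEq G] 
    (A B : Finset G) (hA : A.Nonempty) (hB : B.Nonempty) :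
    A.card + B.card ≤ (A + B).card + Nat.card (AddAction.stabilizer G (A + B)) := by
  classical
  choose! C h1 h2 h3 using transform_lemma' A B
  have key : ∀ T : Finset G, T.Nonempty → T ⊆ A + B →
      A.card + B.card ≤ (T.biUnion C).card + Nat.card (AddAction.stabilizer G (T.biUnion C)) := by
    intro T hT
    induction hT using Finset.Nonempty.cons_induction with
    | singleton a =>
      intro h
      rw [singleton_biUnion]
      exact h3 a (h (mem_singleton_self a))
    | cons a s ha hs ih =>
      intro h
      rw [cons_eq_insert, biUnion_insert]
      rw [cons_eq_insert] at h
      apply union_lemma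
      · exact h3 a (h (mem_insert_self a s))
      · exact ih ((subset_insert a s).trans h)
  have hU : (A + B).biUnion C = A + B := by
    apply Subset.antisymm
    · exact biUnion_subset.2 h2
    · intro x hx
      exact mem_biUnion.2 ⟨x, hx, h1 x hx⟩
  have := key (A + B) (hA.add hB) Subset.rfl
  rwa [hU] at this
lemma card_preimage_quot {G : Type*} [AddCommGroup G] [Fintype G] [DecidableEq G]
    (L : AddSubgroup G) [DecidableEq (G ⧸ L)] (Z : Finset (G ⧸ L)) :
    (univ.filter (fun x : G => (QuotientAddGroup.mk x : G ⧸ L) ∈ Z)).card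
      = Nat.card L * Z.card := by
  have := Nat.card_congr (QuotientAddGroup.preimageMkEquivAddSubgroupProdSet L (Z : Set (G ⧸ L)))
  rw [Nat.card_prod] at this
  have hZ : Nat.card (Z : Set (G ⧸ L)) = Z.card := by simp
  rw [hZ] at this
  rw [← this, ← Set.ncard_coe_finset, Nat.card_coe_set_eq]
  congr 1
  ext x
  simp

lemma kneser_quot {G : Type*} [AddCommGroup G] [Fintype G] [DecidableEq G]
    (A B : Finset G) (hA : A.Nonempty) (hB : B.Nonempty)
    (L : AddSubgroup G) (hL : L = AddAction.stabilizer G (A + B)) [DecidableEq (G ⧸ L)] :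
    (A.image (QuotientAddGroup.mk : G → G ⧸ L)).card + (B.image (QuotientAddGroup.mk : G → G ⧸ L)).card
      ≤ (A.image (QuotientAddGroup.mk : G → G ⧸ L) + B.image (QuotientAddGroup.mk : G → G ⧸ L)).card + 1
    ∧ Nat.card L * (A.image (QuotientAddGroup.mk : G → G ⧸ L)
        + B.image (QuotientAddGroup.mk : G → G ⧸ L)).card = (A + B).card := by
  set X := A.image (QuotientAddGroup.mk : G → G ⧸ L) with hX
  set Y := B.image (QuotientAddGroup.mk : G → G ⧸ L) with hY
  have hsum : ∀ x : G, (QuotientAddGroup.mk x : G ⧸ L) ∈ X + Y ↔ x ∈ A + B := by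
    intro x
    constructor
    · intro h
      obtain ⟨u, hu, v, hv, huv⟩ := mem_add.1 h
      obtain ⟨a, ha, rfl⟩ := mem_image.1 hu
      obtain ⟨b, hb, rfl⟩ := mem_image.1 hv
      rw [← QuotientAddGroup.mk_add, QuotientAddGroup.eq, hL, mem_stab] at huv
      have := (huv (a + b)).2 (add_mem_add ha hb)
      rwa [show -(a + b) + x + (a + b) = x by abel] at this
    · intro h
      obtain ⟨a, ha, b, hb, rfl⟩ := mem_add.1 h
      rw [QuotientAddGroup.mk_add]
      exact add_mem_add (mem_image_of_mem _ ha) (mem_image_of_mem _ hb)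
  have hAB : A + B = univ.filter (fun x : G => (QuotientAddGroup.mk x : G ⧸ L) ∈ X + Y) := by
    ext x; simp [hsum]
  have hcard : Nat.card L * (X + Y).card = (A + B).card := by
    rw [hAB, card_preimage_quot]
  refine ⟨?_, hcard⟩
  set A1 := univ.filter (fun x : G => (QuotientAddGroup.mk x : G ⧸ L) ∈ X) with hA1
  set B1 := univ.filter (fun x : G => (QuotientAddGroup.mk x : G ⧸ L) ∈ Y) with hB1
  have hAA : A ⊆ A1 := fun a ha => by
    rw [hA1, mem_filter]; exact ⟨mem_univ _, mem_image_of_mem _ ha⟩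
  have hBB : B ⊆ B1 := fun a ha => by
    rw [hB1, mem_filter]; exact ⟨mem_univ _, mem_image_of_mem _ ha⟩
  have h11 : A1 + B1 = A + B := by
    apply Subset.antisymm
    · intro z hz
      obtain ⟨a, ha, b, hb, rfl⟩ := mem_add.1 hz
      rw [← hsum, QuotientAddGroup.mk_add]
      rw [hA1, mem_filter] at ha
      rw [hB1, mem_filter] at hb
      exact add_mem_add ha.2 hb.2
    · exact add_subset_add hAA hBB
  have hk := kneser_weak A1 B1 (hA.mono hAA) (hB.mono hBB)
  rw [h11, ← hL, ← hcard, hA1, hB1, card_preimage_quot, card_preimage_quot] at hk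
  have hpos : 0 < Nat.card L := Nat.card_pos
  apply Nat.le_of_mul_le_mul_left _ hpos
  linarith

/-- A set in a fibre of the quotient is no bigger than the subgroup. -/
lemma card_fiber_le {G : Type*} [AddCommGroup G] [Fintype G] [DecidableEq G]
    (L : AddSubgroup G) [DecidableEq (G ⧸ L)] (A : Finset G) (z : G ⧸ L) :
    (A.filter (fun x : G => (QuotientAddGroup.mk x : G ⧸ L) = z)).card ≤ Nat.card L := by
  have := card_preimage_quot L {z}
  simp only [card_singleton, mul_one, mem_singleton] at this
  rw [← this]
  exact card_le_card (filter_subset_filter _ (subset_univ A))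

lemma card_le_image_mul {G : Type*} [AddCommGroup G] [Fintype G] [DecidableEq G]
    (L : AddSubgroup G) [DecidableEq (G ⧸ L)] (A : Finset G) :
    A.card ≤ Nat.card L * (A.image (QuotientAddGroup.mk : G → G ⧸ L)).card := by
  apply card_le_mul_card_image
  intro z _
  exact card_fiber_le L A z
lemma card_pairs_eq {α β G : Type*} [Fintype G] [DecidableEq G] 
    (P : Finset α) (Q : Finset β) (f : α → G) (g : β → G) :
    ((P ×ˢ Q).filter (fun z => f z.1 = g z.2)).card
      = ∑ x : G, (P.filter (fun p => f p = x)).card * (Q.filter (fun q => g q = x)).card := by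
  classical
  rw [card_eq_sum_card_fiberwise (f := fun z => f z.1) (t := univ) (fun _ _ => mem_coe.2 (mem_univ _))]
  apply sum_congr rfl
  intro x _
  rw [← card_product]
  congr 1
  ext ⟨p, q⟩
  simp only [mem_filter, mem_product]
  constructor
  · rintro ⟨⟨⟨h1, h2⟩, h3⟩, h4⟩
    exact ⟨⟨h1, h4⟩, h2, h3 ▸ h4⟩
  · rintro ⟨⟨h1, h2⟩, h3, h4⟩
    exact ⟨⟨⟨h1, h3⟩, h2.trans h4.symm⟩, h2⟩

lemma energy_identity {G : Type*} [AddCommGroup G] [Fintype G] [DecidableEq G] (A B : Finset G) :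
    ∑ x : G, ((A ×ˢ B).filter (fun p => p.1 + p.2 = x)).card ^ 2
      = ∑ x : G, ((A ×ˢ A).filter (fun p => p.1 - p.2 = x)).card
          * ((B ×ˢ B).filter (fun p => p.1 - p.2 = x)).card := by
  classical
  simp only [sq]
  rw [← card_pairs_eq, ← card_pairs_eq]
  apply card_bij (fun z _ => ((z.1.1, z.2.1), (z.2.2, z.1.2)))
  · rintro ⟨⟨a, b⟩, ⟨a', b'⟩⟩ h
    simp only [mem_filter, mem_product] at h ⊢
    refine ⟨⟨⟨h.1.1.1, h.1.2.1⟩, h.1.2.2, h.1.1.2⟩, ?_⟩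
    rw [sub_eq_sub_iff_add_eq_add, h.2, add_comm]
  · rintro ⟨⟨a, b⟩, ⟨a', b'⟩⟩ _ ⟨⟨c, d⟩, ⟨c', d'⟩⟩ _ h
    simp only [Prod.mk.injEq] at h ⊢
    tauto
  · rintro ⟨⟨a, a'⟩, ⟨b', b⟩⟩ h
    simp only [mem_filter, mem_product] at h
    refine ⟨((a, b), (a', b')), ?_, rfl⟩
    simp only [mem_filter, mem_product]
    refine ⟨⟨⟨h.1.1.1, h.1.2.2⟩, h.1.1.2, h.1.2.1⟩, ?_⟩
    have := h.2
    rw [sub_eq_sub_iff_add_eq_add] at this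
    rw [this, add_comm]

lemma diff_pop {G : Type*} [AddCommGroup G] [DecidableEq G] (A B S : Finset G) (e : ℝ)
    (mA : ∀ a ∈ A, ((B.filter (fun b => a + b ∉ S)).card : ℝ) ≤ e) (a a' : G)
    (ha : a ∈ A) (ha' : a' ∈ A) :
    2 * ((B.card : ℝ) - e) - S.card
      ≤ (((B ×ˢ B).filter (fun p => p.1 - p.2 = a - a')).card : ℝ) := by
  classical
  have key : ∀ a ∈ A, (B.card : ℝ) - e ≤ ((B.filter (fun b => a + b ∈ S)).image (fun b => a + b)).card := by
    intro a ha
    rw [card_image_of_injective _ (add_right_injective a)]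
    have := card_filter_add_card_filter_not (s := B) (fun b => a + b ∈ S)
    have h2 : ((B.filter (fun b => a + b ∈ S)).card : ℝ) + (B.filter (fun b => a + b ∉ S)).card
      = B.card := by exact_mod_cast this
    linarith [mA a ha]
  set I1 := (B.filter (fun b => a + b ∈ S)).image (fun b => a + b) with hI1
  set I2 := (B.filter (fun b => a' + b ∈ S)).image (fun b => a' + b) with hI2
  have s1 : I1 ∪ I2 ⊆ S := by
    apply union_subset
    · intro x hx
      obtain ⟨b, hb, rfl⟩ := mem_image.1 hx
      exact (mem_filter.1 hb).2
    · intro x hx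
      obtain ⟨b, hb, rfl⟩ := mem_image.1 hx
      exact (mem_filter.1 hb).2
  have h3 := card_le_card s1
  have h4 := card_union_add_card_inter I1 I2
  have h5 : (I1 ∩ I2).card ≤ ((B ×ˢ B).filter (fun p => p.1 - p.2 = a - a')).card := by
    apply card_le_card_of_injOn (fun s => (s - a', s - a))
    · intro s hs
      rw [mem_coe, mem_inter] at hs
      obtain ⟨b, hb, rfl⟩ := mem_image.1 hs.1
      obtain ⟨b', hb', h⟩ := mem_image.1 hs.2
      simp only [mem_coe, mem_filter, mem_product]
      refine ⟨⟨?_, ?_⟩, by abel⟩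
      · rw [← h, add_sub_cancel_left]; exact (mem_filter.1 hb').1
      · rw [add_sub_cancel_left]; exact (mem_filter.1 hb).1
    · intro s _ t _ h
      simp only [Prod.mk.injEq] at h
      exact sub_left_injective h.1
  have k1 := key a ha
  have k2 := key a' ha'
  rw [← hI1] at k1
  rw [← hI2] at k2
  have h3' : ((I1 ∪ I2).card : ℝ) ≤ S.card := by exact_mod_cast h3
  have h4' : ((I1 ∪ I2).card : ℝ) + (I1 ∩ I2).card = I1.card + I2.card := by exact_mod_cast h4
  have h5' : ((I1 ∩ I2).card : ℝ) ≤ ((B ×ˢ B).filter (fun p => p.1 - p.2 = a - a')).card := by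
    exact_mod_cast h5
  linarith

/-- The final numerical inequality behind the golden ratio. -/
lemma golden_arith (n e φ p q s : ℝ) (he : 2 < e) (hφ : φ ^ 2 = φ + 1) (h1 : 1.618 < φ)
    (h2 : φ < 1.6181) (h11 : 11 * e ≤ (φ - 1) * n) (hp : n - 1.5 * e ≤ p)
    (hq : n - 1.5 * e ≤ q) (hq' : q ≤ n) (hs : s = φ * n - 7.5 * e) :
    s * (q ^ 2 - (2 * (q - e) - s) * (q - e)) < p * q ^ 2 - 2 * q * e ^ 2 := by
  have hn : 17 * e ≤ n := by nlinarith
  obtain ⟨w, rfl⟩ : ∃ w, q = n - w := ⟨n - q, by ring⟩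
  have hw : w ≤ 1.5 * e := by linarith
  have hw0 : 0 ≤ w := by linarith
  have hmono : (n - 1.5 * e) * (n - w) ^ 2 ≤ p * (n - w) ^ 2 :=
    mul_le_mul_of_nonneg_right hp (sq_nonneg _)
  refine lt_of_lt_of_le ?_ (sub_le_sub_right hmono _)
  subst hs
  have : 0 < ((n - 1.5 * e) * (n - w) ^ 2 - 2 * (n - w) * e ^ 2) -
    (φ * n - 7.5 * e) * ((n - w) ^ 2 - (2 * ((n - w) - e) - (φ * n - 7.5 * e)) * ((n - w) - e)) := by
    have id : ((n - 1.5 * e) * (n - w) ^ 2 - 2 * (n - w) * e ^ 2) -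
        (φ * n - 7.5 * e) * ((n - w) ^ 2 - (2 * ((n - w) - e) - (φ * n - 7.5 * e)) * ((n - w) - e))
        = n ^ 2 * ((12 * φ - 8) * e - (φ + 1) * w)
          + n * ((1 + φ) * w ^ 2 + (18 - 11 * φ) * (e * w) - (13 * φ + 28.25) * e ^ 2)
          + e * (28.25 * e * w + 41.25 * e ^ 2 - 9 * w ^ 2) := by
      linear_combination (-(n ^ 2 * (n - w - e))) * hφ
    rw [id]
    have n0 : 0 < n := by linarith
    have c1 : 7 * e ≤ (12 * φ - 8) * e - (φ + 1) * w := by nlinarith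
    have c2 : -50 * e ^ 2 ≤ (1 + φ) * w ^ 2 + (18 - 11 * φ) * (e * w) - (13 * φ + 28.25) * e ^ 2 := by
      have : 0 ≤ (1 + φ) * w ^ 2 := by positivity
      have : 0 ≤ (18 - 11 * φ) * (e * w) := by
        apply mul_nonneg
        · linarith
        · positivity
      nlinarith [sq_nonneg e]
    have c3 : 0 ≤ e * (28.25 * e * w + 41.25 * e ^ 2 - 9 * w ^ 2) := by
      apply mul_nonneg (by linarith)
      nlinarith
    have d1 : n ^ 2 * (7 * e) ≤ n ^ 2 * ((12 * φ - 8) * e - (φ + 1) * w) :=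
      mul_le_mul_of_nonneg_left c1 (sq_nonneg n)
    have d2 := mul_le_mul_of_nonneg_left c2 n0.le
    have d3 : n * e * (17 * e) ≤ n * e * n := mul_le_mul_of_nonneg_left hn (by positivity)
    have d4 : 0 < n * e * e := by positivity
    nlinarith
  linarith

set_option maxHeartbeats 2000000 in
lemma golden_pop {G : Type*} [AddCommGroup G] [Fintype G] [DecidableEq G] (A B S : Finset G)
    (n e φ : ℝ) (he : 2 < e) (hφ : φ ^ 2 = φ + 1) (h1 : 1.618 < φ)
    (h2 : φ < 1.6181) (h11 : 11 * e ≤ (φ - 1) * n)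
    (hp : n - 1.5 * e ≤ A.card) (hp' : (A.card : ℝ) ≤ n)
    (hq : n - 1.5 * e ≤ B.card) (hq' : (B.card : ℝ) ≤ n)
    (mA : ∀ a ∈ A, ((B.filter (fun b => a + b ∉ S)).card : ℝ) ≤ e)
    (mB : ∀ b ∈ B, ((A.filter (fun a => b + a ∉ S)).card : ℝ) ≤ e)
    (mT : (((A ×ˢ B).filter (fun z => z.1 + z.2 ∉ S)).card : ℝ) ≤ e ^ 2)
    (hs : (S.card : ℝ) ≤ φ * n - 7.5 * e) (c : G) (hc : c ∈ A + B) :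
    e ≤ ((A ×ˢ B).filter (fun z => z.1 + z.2 = c)).card := by
  classical
  by_contra hcon
  push Not at hcon
  have hn : 17 * e ≤ n := by nlinarith
  obtain ⟨a, ha, b, hb, rfl⟩ := mem_add.1 hc
  set s := φ * n - 7.5 * e with hsdef
  set p : ℝ := (A.card : ℝ) with hpdef
  set q : ℝ := (B.card : ℝ) with hqdef
  set ρ := 2 * (q - e) - s with hρ
  set r : G → ℝ := fun x => ((A ×ˢ B).filter (fun z => z.1 + z.2 = x)).card with hr
  set rA : G → ℝ := fun x => ((A ×ˢ A).filter (fun z => z.1 - z.2 = x)).card with hrA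
  set rB : G → ℝ := fun x => ((B ×ˢ B).filter (fun z => z.1 - z.2 = x)).card with hrB
  have hρ0 : 0 < ρ := by rw [hρ, hsdef]; nlinarith
  set D := A - A with hD
  have popB : ∀ x ∈ D, ρ ≤ rB x := by
    intro x hx
    obtain ⟨u, hu, v, hv, rfl⟩ := mem_sub.1 hx
    refine le_trans ?_ (diff_pop A B S e mA u v hu hv)
    rw [hρ, hqdef]; linarith
  have supA : ∀ x, x ∉ D → rA x = 0 := by
    intro x hx
    simp only [hrA, Nat.cast_eq_zero, card_eq_zero, filter_eq_empty_iff, mem_product]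
    rintro ⟨u, v⟩ ⟨hu, hv⟩ h
    exact hx (h ▸ sub_mem_sub hu hv)
  have leA : ∀ x, rA x ≤ p := by
    intro x
    simp only [hrA, hpdef]
    norm_cast
    apply card_le_card_of_injOn Prod.fst
    · intro z hz
      simp only [coe_filter, mem_product, Set.mem_ofPred_eq] at hz
      exact hz.1.1
    · rintro ⟨u, v⟩ hz ⟨u', v'⟩ hz' h
      simp only [coe_filter, mem_product, Set.mem_ofPred_eq] at hz hz' h
      subst h
      have := hz.2.trans hz'.2.symm
      simp only [sub_right_inj] at this
      rw [this]
  have sumA : ∑ x : G, rA x = p ^ 2 := by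
    have := card_eq_sum_card_fiberwise (s := A ×ˢ A) (f := fun z => z.1 - z.2) (t := univ)
      (fun _ _ => mem_coe.2 (mem_univ _))
    rw [card_product] at this
    simp only [hrA, hpdef, sq]
    exact_mod_cast this.symm
  have sumB : ∑ x : G, rB x = q ^ 2 := by
    have := card_eq_sum_card_fiberwise (s := B ×ˢ B) (f := fun z => z.1 - z.2) (t := univ)
      (fun _ _ => mem_coe.2 (mem_univ _))
    rw [card_product] at this
    simp only [hrB, hqdef, sq]
    exact_mod_cast this.symm
  have hEn : ∑ x : G, r x ^ 2 = ∑ x : G, rA x * rB x := by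
    simp only [hr, hrA, hrB]
    exact_mod_cast energy_identity A B
  -- upper bound for the energy
  have up1 : ∑ x : G, rA x * rB x = ∑ x ∈ D, rA x * rB x := by
    symm
    apply sum_subset (subset_univ D)
    intro x _ hx
    rw [supA x hx, zero_mul]
  have upA : ∑ x ∈ D, rA x = p ^ 2 := by
    rw [← sumA]
    apply sum_subset (subset_univ D)
    intro x _ hx
    rw [supA x hx]
  have upB : ∑ x ∈ D, rB x ≤ q ^ 2 := by
    rw [← sumB]
    apply sum_le_univ_sum_of_nonneg
    intro x
    simp only [hrB]; positivity
  have up2 : ∑ x ∈ D, rA x * rB x ≤ ∑ x ∈ D, (p * rB x + ρ * rA x - p * ρ) := by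
    apply sum_le_sum
    intro x hx
    nlinarith [mul_nonneg (sub_nonneg.2 (leA x)) (sub_nonneg.2 (popB x hx))]
  have up3 : ∑ x ∈ D, (p * rB x + ρ * rA x - p * ρ)
      = p * ∑ x ∈ D, rB x + ρ * ∑ x ∈ D, rA x - D.card * (p * ρ) := by
    rw [sum_sub_distrib, sum_add_distrib, mul_sum, mul_sum, sum_const, nsmul_eq_mul]
  have hp0 : 0 < p := by linarith
  have hq0 : 0 < q := by linarith
  -- the difference set is large
  have hDcard : p + q - e ≤ D.card := by
    set D1 := A.image (fun x => a - x) with hD1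
    set D2 := B.image (fun x => x - b) with hD2
    have c1 : D1.card = A.card := card_image_of_injective _ (sub_right_injective)
    have c2 : D2.card = B.card := card_image_of_injective _ (sub_left_injective)
    have sub : D1 ∪ D2 ⊆ D := by
      apply union_subset
      · intro x hx
        obtain ⟨u, hu, rfl⟩ := mem_image.1 hx
        exact sub_mem_sub ha hu
      · intro x hx
        obtain ⟨u, hu, rfl⟩ := mem_image.1 hx
        have := diff_pop B A S e mB u b hu hb
        have pos : (0 : ℝ) < ((A ×ˢ A).filter (fun z => z.1 - z.2 = u - b)).card := by
          refine lt_of_lt_of_le ?_ this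
          rw [← hpdef]
          nlinarith
        have pos' : 0 < ((A ×ˢ A).filter (fun z => z.1 - z.2 = u - b)).card := by
          exact_mod_cast pos
        obtain ⟨⟨y, z⟩, hz⟩ := card_pos.1 pos'
        simp only [mem_filter, mem_product] at hz
        rw [← hz.2]
        exact sub_mem_sub hz.1.1 hz.1.2
    have hint : (D1 ∩ D2).card ≤ ((A ×ˢ B).filter (fun z => z.1 + z.2 = a + b)).card := by
      apply card_le_card_of_injOn (fun x => (a - x, x + b))
      · intro x hx
        rw [mem_coe, mem_inter] at hx
        obtain ⟨u, hu, hu'⟩ := mem_image.1 hx.1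
        obtain ⟨v, hv, hv'⟩ := mem_image.1 hx.2
        simp only [mem_coe, mem_filter, mem_product]
        refine ⟨⟨?_, ?_⟩, by abel⟩
        · rw [← hu', sub_sub_cancel]; exact hu
        · rw [← hv', sub_add_cancel]; exact hv
      · intro x _ y _ h
        simp only [Prod.mk.injEq] at h
        simpa using h.2
    have h4 := card_union_add_card_inter D1 D2
    have h4' : ((D1 ∪ D2).card : ℝ) + (D1 ∩ D2).card = p + q := by
      rw [hpdef, hqdef, ← c1, ← c2]; exact_mod_cast h4
    have h5 : ((D1 ∩ D2).card : ℝ) < e := lt_of_le_of_lt (by exact_mod_cast hint) hcon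
    have h6 : ((D1 ∪ D2).card : ℝ) ≤ D.card := by exact_mod_cast card_le_card sub
    linarith
  have up : ∑ x : G, r x ^ 2 ≤ p * (q ^ 2 - ρ * (q - e)) := by
    rw [hEn, up1]
    refine up2.trans ?_
    rw [up3, upA]
    have g1 := mul_le_mul_of_nonneg_left upB hp0.le
    have g2 := mul_le_mul_of_nonneg_right hDcard (mul_pos hp0 hρ0).le
    have g3 : p * (q ^ 2 - ρ * (q - e)) = p * q ^ 2 + ρ * p ^ 2 - (p + q - e) * (p * ρ) := by ring
    rw [g3]
    exact sub_le_sub (add_le_add g1 le_rfl) g2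
  -- lower bound for the energy
  have lowΓ : p * q - e ^ 2 ≤ ∑ x ∈ S, r x := by
    have f1 := card_filter_add_card_filter_not (s := A ×ˢ B) (fun z => z.1 + z.2 ∈ S)
    rw [card_product] at f1
    have f2 := card_eq_sum_card_fiberwise (s := (A ×ˢ B).filter (fun z => z.1 + z.2 ∈ S))
      (f := fun z => z.1 + z.2) (t := S)
      (fun z hz => by
        simp only [coe_filter, Set.mem_ofPred_eq] at hz
        exact hz.2)
    have f3 : ∑ x ∈ S, r x = ((A ×ˢ B).filter (fun z => z.1 + z.2 ∈ S)).card := by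
      rw [f2]
      push_cast
      apply sum_congr rfl
      intro x hx
      simp only [hr]
      congr 2
      ext z
      simp only [mem_filter]
      constructor
      · rintro ⟨h1, h2⟩; exact ⟨⟨h1, h2 ▸ hx⟩, h2⟩
      · rintro ⟨⟨h1, _⟩, h2⟩; exact ⟨h1, h2⟩
    rw [f3]
    have f1' : (((A ×ˢ B).filter (fun z => z.1 + z.2 ∈ S)).card : ℝ)
      + ((A ×ˢ B).filter (fun z => z.1 + z.2 ∉ S)).card = p * q := by
      rw [hpdef, hqdef]; exact_mod_cast f1
    linarith
  have cs : (∑ x ∈ S, r x) ^ 2 ≤ S.card * ∑ x ∈ S, r x ^ 2 := sq_sum_le_card_mul_sum_sq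
  have cs2 : ∑ x ∈ S, r x ^ 2 ≤ ∑ x : G, r x ^ 2 := by
    apply sum_le_univ_sum_of_nonneg
    intro x; positivity
  have fin := golden_arith n e φ p q s he hφ h1 h2 h11 hp hq hq' hsdef
  have pos1 : 0 ≤ p * q - e ^ 2 := by nlinarith
  have l1 : (p * q - e ^ 2) ^ 2 ≤ s * (p * (q ^ 2 - ρ * (q - e))) := by
    calc (p * q - e ^ 2) ^ 2 ≤ (∑ x ∈ S, r x) ^ 2 := pow_le_pow_left₀ pos1 lowΓ 2
      _ ≤ S.card * ∑ x ∈ S, r x ^ 2 := cs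
      _ ≤ s * (p * (q ^ 2 - ρ * (q - e))) := by
        apply mul_le_mul hs (cs2.trans up)
        · apply sum_nonneg; intro x _; positivity
        · rw [hsdef]; nlinarith
  have l2 := mul_lt_mul_of_pos_left fin hp0
  nlinarith [sq_nonneg (e ^ 2)]

lemma sum_almost_in {G : Type*} [AddCommGroup G] [Fintype G] [DecidableEq G] (A B S : Finset G)
    (e : ℝ) (he : 2 < e)
    (mT : (((A ×ˢ B).filter (fun z => z.1 + z.2 ∉ S)).card : ℝ) ≤ e ^ 2)
    (hpop : ∀ c ∈ A + B, e ≤ ((A ×ˢ B).filter (fun z => z.1 + z.2 = c)).card) :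
    ((A + B).card : ℝ) ≤ S.card + e := by
  classical
  have f2 := card_eq_sum_card_fiberwise (s := (A ×ˢ B).filter (fun z => z.1 + z.2 ∉ S))
      (f := fun z => z.1 + z.2) (t := (A + B) \ S)
      (fun z hz => by
        simp only [coe_filter, mem_product, Set.mem_ofPred_eq] at hz
        rw [mem_coe, mem_sdiff]
        exact ⟨add_mem_add hz.1.1 hz.1.2, hz.2⟩)
  have f3 : (((A + B) \ S).card : ℝ) * e ≤ ((A ×ˢ B).filter (fun z => z.1 + z.2 ∉ S)).card := by
    rw [f2, ← nsmul_eq_mul]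
    push_cast
    apply card_nsmul_le_sum
    intro x hx
    rw [mem_sdiff] at hx
    refine (hpop x hx.1).trans ?_
    norm_cast
    apply card_le_card
    intro z hz
    rw [mem_filter] at hz
    rw [mem_filter, mem_filter]
    exact ⟨⟨hz.1, hz.2 ▸ hx.2⟩, hz.2⟩
  have f4 : (((A + B) \ S).card : ℝ) ≤ e := by
    have : (((A + B) \ S).card : ℝ) * e ≤ e * e := by nlinarith
    exact le_of_mul_le_mul_right this (by linarith)
  have f5 : (A + B).card ≤ ((A + B) \ S).card + S.card := by
    rw [card_sdiff_add_card]
    exact card_le_card subset_union_left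
  have f5' : ((A + B).card : ℝ) ≤ ((A + B) \ S).card + S.card := by exact_mod_cast f5
  linarith
lemma structure_lemma {G : Type*} [AddCommGroup G] [Fintype G] [DecidableEq G] (A B S : Finset G)
    (n e φ : ℝ) (he : 2 < e) (hφ : φ ^ 2 = φ + 1) (h1 : 1.618 < φ)
    (h2 : φ < 1.6181) (h11 : 11 * e ≤ (φ - 1) * n)
    (hp : n - 1.5 * e ≤ A.card) (hp' : (A.card : ℝ) ≤ n)
    (hq : n - 1.5 * e ≤ B.card) (hq' : (B.card : ℝ) ≤ n)
    (mA : ∀ a ∈ A, ((B.filter (fun b => a + b ∉ S)).card : ℝ) ≤ e)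
    (mB : ∀ b ∈ B, ((A.filter (fun a => b + a ∉ S)).card : ℝ) ≤ e)
    (mT : (((A ×ˢ B).filter (fun z => z.1 + z.2 ∉ S)).card : ℝ) ≤ e ^ 2)
    (hs : (S.card : ℝ) ≤ φ * n - 7.5 * e) :
    ∃ L : AddSubgroup G,
      ((∀ a ∈ A, ∀ a' ∈ A, a - a' ∈ L) ∧ (∀ b ∈ B, ∀ b' ∈ B, b - b' ∈ L) ∧
        (Nat.card L : ℝ) ≤ S.card + e) ∨
      ∃ x0 x1 y0 y1 : G ⧸ L, (∀ a ∈ A, (a : G ⧸ L) = x0 ∨ (a : G ⧸ L) = x1) ∧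
        (∀ b ∈ B, (b : G ⧸ L) = y0 ∨ (b : G ⧸ L) = y1) ∧ x0 ≠ x1 ∧ y0 ≠ y1 ∧
        x0 + y0 ≠ x1 + y1 ∧ 3 * (Nat.card L : ℝ) ≤ S.card + e := by
  classical
  have hn : 17 * e ≤ n := by nlinarith
  have hpop := golden_pop A B S n e φ he hφ h1 h2 h11 hp hp' hq hq' mA mB mT hs
  have hsum := sum_almost_in A B S e he mT hpop
  have hA0 : A.Nonempty := by
    rw [← card_pos]; have : (0 : ℝ) < A.card := by linarith
    exact_mod_cast this
  have hB0 : B.Nonempty := by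
    rw [← card_pos]; have : (0 : ℝ) < B.card := by linarith
    exact_mod_cast this
  obtain ⟨L, hL⟩ : ∃ L, L = AddAction.stabilizer G (A + B) := ⟨_, rfl⟩
  refine ⟨L, ?_⟩
  obtain ⟨k1, k2⟩ := kneser_quot A B hA0 hB0 L hL
  have k3 := card_le_image_mul L A
  have k4 := card_le_image_mul L B
  set X := A.image (QuotientAddGroup.mk : G → G ⧸ L) with hX
  set Y := B.image (QuotientAddGroup.mk : G → G ⧸ L) with hY
  set l := Nat.card L with hl
  have hX0 : 1 ≤ X.card := card_pos.2 (hA0.image _)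
  have hY0 : 1 ≤ Y.card := card_pos.2 (hB0.image _)
  have r1 : (X.card : ℝ) + Y.card ≤ (X + Y).card + 1 := by exact_mod_cast k1
  have r2 : (l : ℝ) * (X + Y).card = (A + B).card := by exact_mod_cast k2
  have r3 : (A.card : ℝ) ≤ l * X.card := by exact_mod_cast k3
  have r4 : (B.card : ℝ) ≤ l * Y.card := by exact_mod_cast k4
  have l0 : (0 : ℝ) ≤ l := by positivity
  have r5 : (l : ℝ) * (X.card + Y.card) ≤ l * ((X + Y).card + 1) := mul_le_mul_of_nonneg_left r1 l0
  have hφn : φ * n ≤ 1.6181 * n := by nlinarith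
  have hx : X.card ≤ 2 := by
    by_contra h
    have : (3 : ℝ) ≤ X.card := by exact_mod_cast (by omega : 3 ≤ X.card)
    have := mul_le_mul_of_nonneg_left this l0
    linarith
  have hy : Y.card ≤ 2 := by
    by_contra h
    have : (3 : ℝ) ≤ Y.card := by exact_mod_cast (by omega : 3 ≤ Y.card)
    have := mul_le_mul_of_nonneg_left this l0
    linarith
  have memX : ∀ a ∈ A, (a : G ⧸ L) ∈ X := fun a ha => mem_image_of_mem _ ha
  have memY : ∀ a ∈ B, (a : G ⧸ L) ∈ Y := fun a ha => mem_image_of_mem _ ha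
  obtain hx1 | hx2 : X.card = 1 ∨ X.card = 2 := by omega
  · obtain hy1 | hy2 : Y.card = 1 ∨ Y.card = 2 := by omega
    · left
      obtain ⟨x, hx⟩ := card_eq_one.1 hx1
      obtain ⟨y, hy⟩ := card_eq_one.1 hy1
      refine ⟨?_, ?_, ?_⟩
      · intro a ha a' ha'
        have u1 := memX a ha
        have u2 := memX a' ha'
        rw [hx, mem_singleton] at u1 u2
        have := QuotientAddGroup.eq.1 (u2.trans u1.symm)
        rwa [neg_add_eq_sub] at this
      · intro a ha a' ha'
        have u1 := memY a ha
        have u2 := memY a' ha'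
        rw [hy, mem_singleton] at u1 u2
        have := QuotientAddGroup.eq.1 (u2.trans u1.symm)
        rwa [neg_add_eq_sub] at this
      · rw [hx1, hy1] at r5
        push_cast at r5
        linarith
    · exfalso
      rw [hx1] at r3 r5
      rw [hy2] at r4 r5
      push_cast at r3 r4 r5
      linarith
  · obtain hy1 | hy2 : Y.card = 1 ∨ Y.card = 2 := by omega
    · exfalso
      rw [hx2] at r3 r5
      rw [hy1] at r4 r5
      push_cast at r3 r4 r5
      linarith
    · right
      have h3 : 3 * (l : ℝ) ≤ S.card + e := by
        rw [hx2, hy2] at r5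
        push_cast at r5
        linarith
      obtain ⟨x0, x1, hxx, hx⟩ := card_eq_two.1 hx2
      obtain ⟨y0, y1, hyy, hy⟩ := card_eq_two.1 hy2
      have pA : ∀ a ∈ A, (a : G ⧸ L) = x0 ∨ (a : G ⧸ L) = x1 := by
        intro a ha
        have := memX a ha
        rw [hx] at this
        simpa using this
      have pB : ∀ a ∈ B, (a : G ⧸ L) = y0 ∨ (a : G ⧸ L) = y1 := by
        intro a ha
        have := memY a ha
        rw [hy] at this
        simpa using this
      by_cases hne : x0 + y0 = x1 + y1
      · refine ⟨x0, x1, y1, y0, pA, fun b hb => (pB b hb).symm, hxx, hyy.symm, ?_, h3⟩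
        intro hne'
        have sub : X + Y ⊆ {x0 + y0, x0 + y1} := by
          rw [hx, hy]
          intro z hz
          obtain ⟨u, hu, v, hv, rfl⟩ := mem_add.1 hz
          simp only [mem_insert, mem_singleton] at hu hv ⊢
          rcases hu with rfl | rfl <;> rcases hv with rfl | rfl
          · left; rfl
          · right; rfl
          · right; exact hne'.symm
          · left; exact hne.symm
        have := (card_le_card sub).trans card_le_two
        omega
      · exact ⟨x0, x1, y0, y1, pA, pB, hxx, hyy, hne, h3⟩
lemma cell_bound (A B S : Finset ℤ) (hA : A.Nonempty) (hB : B.Nonempty) (e : ℝ)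
    (mA : ∀ a ∈ A, ((B.filter (fun b => a + b ∉ S)).card : ℝ) ≤ e)
    (mB : ∀ b ∈ B, ((A.filter (fun a => b + a ∉ S)).card : ℝ) ≤ e) :
    (A.card : ℝ) + B.card - 2 * e - 1 ≤ (S ∩ (A + B)).card := by
  classical
  set m := A.min' hA with hm
  set M := B.max' hB with hM
  have hmA : m ∈ A := A.min'_mem hA
  have hMB : M ∈ B := B.max'_mem hB
  set U := (B.filter (fun b => m + b ∈ S)).image (fun b => m + b) with hU
  set V := (A.filter (fun a => M + a ∈ S)).image (fun a => M + a) with hV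
  have cU : (B.card : ℝ) - e ≤ U.card := by
    rw [hU, card_image_of_injective _ (add_right_injective m)]
    have := card_filter_add_card_filter_not (s := B) (fun b => m + b ∈ S)
    have h2 : ((B.filter (fun b => m + b ∈ S)).card : ℝ) + (B.filter (fun b => m + b ∉ S)).card
      = B.card := by exact_mod_cast this
    linarith [mA m hmA]
  have cV : (A.card : ℝ) - e ≤ V.card := by
    rw [hV, card_image_of_injective _ (add_right_injective M)]
    have := card_filter_add_card_filter_not (s := A) (fun b => M + b ∈ S)
    have h2 : ((A.filter (fun b => M + b ∈ S)).card : ℝ) + (A.filter (fun b => M + b ∉ S)).card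
      = A.card := by exact_mod_cast this
    linarith [mB M hMB]
  have sub : U ∪ V ⊆ S ∩ (A + B) := by
    apply union_subset
    · intro x hx
      obtain ⟨b, hb, rfl⟩ := mem_image.1 hx
      rw [mem_filter] at hb
      exact mem_inter.2 ⟨hb.2, add_mem_add hmA hb.1⟩
    · intro x hx
      obtain ⟨a, ha, rfl⟩ := mem_image.1 hx
      rw [mem_filter] at ha
      refine mem_inter.2 ⟨ha.2, ?_⟩
      rw [add_comm M a]
      exact add_mem_add ha.1 hMB
  have int : (U ∩ V).card ≤ 1 := by
    rw [card_le_one_iff_subset_singleton]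
    refine ⟨m + M, ?_⟩
    intro x hx
    rw [mem_inter] at hx
    obtain ⟨b, hb, h1⟩ := mem_image.1 hx.1
    obtain ⟨a, ha, h2⟩ := mem_image.1 hx.2
    rw [mem_filter] at ha hb
    have l1 := A.min'_le a ha.1
    have l2 := B.le_max' b hb.1
    rw [mem_singleton]
    omega
  have h4 := card_union_add_card_inter U V
  have h5 := card_le_card sub
  have h6 : (U.card : ℝ) + V.card ≤ (S ∩ (A + B)).card + 1 := by
    exact_mod_cast (by omega : U.card + V.card ≤ (S ∩ (A + B)).card + 1)
  linarith

lemma hat_mA {G H : Type*} [AddCommGroup G] [AddCommGroup H] [DecidableEq G] [DecidableEq H]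
    (f : G →+ H) (A B S : Finset G) (e : ℝ)
    (mA : ∀ a ∈ A, ((B.filter (fun b => a + b ∉ S)).card : ℝ) ≤ e) :
    ∀ a ∈ A.image f, (((B.image f).filter (fun b => a + b ∉ S.image f)).card : ℝ) ≤ e := by
  intro x hx
  obtain ⟨a, ha, rfl⟩ := mem_image.1 hx
  refine le_trans ?_ (mA a ha)
  norm_cast
  refine le_trans (card_le_card ?_) (card_image_le (f := f))
  intro y hy
  rw [mem_filter] at hy
  obtain ⟨b, hb, rfl⟩ := mem_image.1 hy.1
  refine mem_image_of_mem _ (mem_filter.2 ⟨hb, fun h => hy.2 ?_⟩)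
  rw [← map_add]
  exact mem_image_of_mem _ h

lemma hat_mT {G H : Type*} [AddCommGroup G] [AddCommGroup H] [DecidableEq G] [DecidableEq H]
    (f : G →+ H) (A B S : Finset G) (e : ℝ)
    (mT : (((A ×ˢ B).filter (fun z => z.1 + z.2 ∉ S)).card : ℝ) ≤ e) :
    ((((A.image f) ×ˢ (B.image f)).filter (fun z => z.1 + z.2 ∉ S.image f)).card : ℝ) ≤ e := by
  refine le_trans ?_ mT
  norm_cast
  refine le_trans (card_le_card ?_) (card_image_le (f := fun z : G × G => (f z.1, f z.2)))
  rintro ⟨x, y⟩ hz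
  rw [mem_filter, mem_product] at hz
  obtain ⟨⟨hx, hy⟩, hz⟩ := hz
  obtain ⟨a, ha, rfl⟩ := mem_image.1 hx
  obtain ⟨b, hb, rfl⟩ := mem_image.1 hy
  refine mem_image.2 ⟨(a, b), mem_filter.2 ⟨mem_product.2 ⟨ha, hb⟩, fun h => hz ?_⟩, rfl⟩
  simp only [← map_add]
  exact mem_image_of_mem _ h

lemma hat_card (l : ℕ) (A : Finset ℤ) (m : ℤ) (h : ∀ a ∈ A, m ≤ a ∧ a ≤ m + l) :
    A.card ≤ (A.image (Int.castAddHom (ZMod l))).card + 1 := by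
  have h1 : ((A.erase (m + l)).image (Int.castAddHom (ZMod l))).card = (A.erase (m + l)).card := by
    apply card_image_of_injOn
    intro a ha b hb hab
    rw [mem_coe, mem_erase] at ha hb
    have ha2 := h a ha.2
    have hb2 := h b hb.2
    simp only [Int.coe_castAddHom] at hab
    rw [ZMod.intCast_eq_intCast_iff_dvd_sub] at hab
    have : b - a = 0 := by
      apply Int.eq_zero_of_abs_lt_dvd hab
      rw [abs_lt]
      have := ha.1
      have := hb.1
      constructor <;> omega
    omega
  have h2 : ((A.erase (m + l)).image (Int.castAddHom (ZMod l))).card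
      ≤ (A.image (Int.castAddHom (ZMod l))).card := card_le_card (image_subset_image (erase_subset _ _))
  have h3 := pred_card_le_card_erase (s := A) (a := m + l)
  omega

lemma hat_S (l : ℕ) (hl : 0 < l) (B S : Finset ℤ) (m k : ℤ) (h : ∀ b ∈ B, k ≤ b ∧ b ≤ k + l)
    (e : ℝ)
    (m1 : ((B.filter (fun b => m + b ∉ S)).card : ℝ) ≤ e)
    (m2 : ((B.filter (fun b => m + l + b ∉ S)).card : ℝ) ≤ e) :
    ((S.image (Int.castAddHom (ZMod l))).card : ℝ) + B.card ≤ S.card + 2 * e + 1 := by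
  classical
  set T := (B.filter (fun b => m + b ∈ S ∧ m + l + b ∈ S)).erase k with hT
  set V := T.image (fun b => m + l + b) with hV
  have cV : V.card = T.card := card_image_of_injective _ (add_right_injective _)
  have sV : V ⊆ S := by
    intro x hx
    obtain ⟨b, hb, rfl⟩ := mem_image.1 hx
    rw [hT, mem_erase, mem_filter] at hb
    exact hb.2.2.2
  have sub : S.image (Int.castAddHom (ZMod l)) ⊆ (S \ V).image (Int.castAddHom (ZMod l)) := by
    intro x hx
    obtain ⟨s, hs, rfl⟩ := mem_image.1 hx
    by_cases hsV : s ∈ V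
    · obtain ⟨b, hb, rfl⟩ := mem_image.1 hsV
      rw [hT, mem_erase, mem_filter] at hb
      refine mem_image.2 ⟨m + b, mem_sdiff.2 ⟨hb.2.2.1, ?_⟩, ?_⟩
      · intro hbV
        obtain ⟨c, hc, hcc⟩ := mem_image.1 hbV
        rw [hT, mem_erase, mem_filter] at hc
        have u1 := h b hb.2.1
        have u2 := h c hc.2.1
        have := hc.1
        omega
      · simp
    · exact mem_image_of_mem _ (mem_sdiff.2 ⟨hs, hsV⟩)
  have c1 := (card_le_card sub).trans card_image_le
  have c2 := card_sdiff_add_card_eq_card sV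
  have c3 := pred_card_le_card_erase (s := B.filter (fun b => m + b ∈ S ∧ m + l + b ∈ S)) (a := k)
  rw [← hT] at c3
  have c4 : B.card ≤ (B.filter (fun b => m + b ∈ S ∧ m + l + b ∈ S)).card
      + ((B.filter (fun b => m + b ∉ S)).card + (B.filter (fun b => m + l + b ∉ S)).card) := by
    refine le_trans (card_le_card ?_) ((card_union_le _ _).trans
      (Nat.add_le_add_left (card_union_le _ _) _))
    intro b hb
    simp only [mem_union, mem_filter, hb, true_and]
    tauto
  have c5 : (S.image (Int.castAddHom (ZMod l))).card + B.card ≤ S.card + 1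
      + ((B.filter (fun b => m + b ∉ S)).card + (B.filter (fun b => m + l + b ∉ S)).card) := by
    omega
  have c6 : ((S.image (Int.castAddHom (ZMod l))).card : ℝ) + B.card ≤ S.card + 1
      + ((B.filter (fun b => m + b ∉ S)).card + (B.filter (fun b => m + l + b ∉ S)).card) := by
    exact_mod_cast c5
  linarith

lemma in_progression (l : ℕ) (hl : 0 < l) (L : AddSubgroup (ZMod l)) (A : Finset ℤ) (m : ℤ)
    (hm : m ∈ A) (h : ∀ a ∈ A, m ≤ a ∧ a ≤ m + l)
    (hL : ∀ a ∈ A.image (Int.castAddHom (ZMod l)), ∀ a' ∈ A.image (Int.castAddHom (ZMod l)),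
      a - a' ∈ L) :
    A ⊆ (range (Nat.card L + 1)).image (fun i : ℕ => m + ((l / Nat.card L : ℕ) : ℤ) * (i : ℤ)) := by
  have : NeZero l := ⟨hl.ne'⟩
  have hdvd : Nat.card L ∣ l := by
    have := AddSubgroup.card_addSubgroup_dvd_card L
    rwa [Nat.card_zmod] at this
  obtain ⟨g, hg⟩ := hdvd
  set k := Nat.card L with hk
  have k0 : 0 < k := Nat.pos_of_ne_zero (by rintro h; rw [h] at hg; omega)
  have hdiv : l / k = g := by rw [hg, Nat.mul_div_cancel_left _ k0]
  have g0 : 0 < g := Nat.pos_of_ne_zero (by rintro h; rw [h] at hg; omega)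
  rw [hdiv]
  intro a ha
  have h1 := hL _ (mem_image_of_mem _ ha) _ (mem_image_of_mem _ hm)
  have h2 : k • ((Int.castAddHom (ZMod l)) a - (Int.castAddHom (ZMod l)) m) = 0 := by
    have := card_nsmul_eq_zero' (G := L) (x := ⟨_, h1⟩)
    exact congrArg Subtype.val this
  have h3 : ((k * (a - m) : ℤ) : ZMod l) = 0 := by
    rw [nsmul_eq_mul] at h2
    simpa using h2
  rw [ZMod.intCast_zmod_eq_zero_iff_dvd] at h3
  have h4 : (g : ℤ) ∣ a - m := by
    rw [hg] at h3
    push_cast at h3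
    exact Int.dvd_of_mul_dvd_mul_left (by exact_mod_cast k0.ne') h3
  obtain ⟨i, hi⟩ := h4
  have hb := h a ha
  have hg' : (l : ℤ) = k * g := by exact_mod_cast hg
  have gz : (0 : ℤ) < g := by exact_mod_cast g0
  have i0 : 0 ≤ i := by
    by_contra hc
    push Not at hc
    nlinarith
  have ik : i ≤ k := by
    by_contra hc
    push Not at hc
    nlinarith
  lift i to ℕ using i0
  refine mem_image.2 ⟨i, mem_range.2 (by omega), by omega⟩
lemma coset_cell_le (l : ℕ) (hl : 0 < l) (L : AddSubgroup (ZMod l)) (A A0 : Finset ℤ) (m : ℤ)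
    (h : ∀ a ∈ A, m ≤ a ∧ a ≤ m + l) (hA0 : A0 ⊆ A) (x : ZMod l ⧸ L)
    (hx : ∀ a ∈ A0, (((a : ZMod l)) : ZMod l ⧸ L) = x) : A0.card ≤ Nat.card L + 1 := by
  classical
  have : NeZero l := ⟨hl.ne'⟩
  have h1 := hat_card l A0 m (fun a ha => h a (hA0 ha))
  have h2 := card_fiber_le L (A0.image (Int.castAddHom (ZMod l))) x
  rw [filter_true_of_mem] at h2
  · omega
  · intro y hy
    obtain ⟨a, ha, rfl⟩ := mem_image.1 hy
    exact hx a ha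

lemma cell_missing {P Q S : Finset ℤ} {P0 Q0 : Finset ℤ} {e : ℝ} (hP : P0 ⊆ P) (hQ : Q0 ⊆ Q)
    (mA : ∀ a ∈ P, ((Q.filter (fun b => a + b ∉ S)).card : ℝ) ≤ e) :
    ∀ a ∈ P0, ((Q0.filter (fun b => a + b ∉ S)).card : ℝ) ≤ e := by
  intro a ha
  refine le_trans ?_ (mA a (hP ha))
  exact_mod_cast card_le_card (filter_subset_filter _ hQ)

lemma two_cosets_bound (l : ℕ) (hl : 0 < l) (L : AddSubgroup (ZMod l)) (A B S : Finset ℤ)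
    (m k : ℤ) (hA : ∀ a ∈ A, m ≤ a ∧ a ≤ m + l) (hB : ∀ b ∈ B, k ≤ b ∧ b ≤ k + l) (e : ℝ)
    (mA : ∀ a ∈ A, ((B.filter (fun b => a + b ∉ S)).card : ℝ) ≤ e)
    (mB : ∀ b ∈ B, ((A.filter (fun a => b + a ∉ S)).card : ℝ) ≤ e)
    (x0 x1 y0 y1 : ZMod l ⧸ L)
    (pA : ∀ a ∈ A, ((a : ZMod l) : ZMod l ⧸ L) = x0 ∨ ((a : ZMod l) : ZMod l ⧸ L) = x1)
    (pB : ∀ a ∈ B, ((a : ZMod l) : ZMod l ⧸ L) = y0 ∨ ((a : ZMod l) : ZMod l ⧸ L) = y1)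
    (hx : x0 ≠ x1) (hy : y0 ≠ y1) (hxy : x0 + y0 ≠ x1 + y1)
    (hAL : (Nat.card L : ℝ) + 1 < A.card) (hBL : (Nat.card L : ℝ) + 1 < B.card) :
    2 * (A.card : ℝ) + 2 * B.card - 2 * Nat.card L - 6 * e - 5 ≤ S.card := by
  classical
  set c : ℤ → ZMod l ⧸ L := fun a => ((a : ZMod l) : ZMod l ⧸ L) with hc
  have cadd : ∀ a b, c (a + b) = c a + c b := by
    intro a b
    simp only [hc, Int.cast_add, QuotientAddGroup.mk_add]
  set A0 := A.filter (fun a => c a = x0) with hA0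
  set A1 := A.filter (fun a => c a = x1) with hA1
  set B0 := B.filter (fun a => c a = y0) with hB0
  set B1 := B.filter (fun a => c a = y1) with hB1
  have sA0 : A0 ⊆ A := filter_subset _ _
  have sA1 : A1 ⊆ A := filter_subset _ _
  have sB0 : B0 ⊆ B := filter_subset _ _
  have sB1 : B1 ⊆ B := filter_subset _ _
  have lA0 := coset_cell_le l hl L A A0 m hA sA0 x0 (fun a ha => (mem_filter.1 ha).2)
  have lA1 := coset_cell_le l hl L A A1 m hA sA1 x1 (fun a ha => (mem_filter.1 ha).2)
  have lB0 := coset_cell_le l hl L B B0 k hB sB0 y0 (fun a ha => (mem_filter.1 ha).2)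
  have lB1 := coset_cell_le l hl L B B1 k hB sB1 y1 (fun a ha => (mem_filter.1 ha).2)
  have hAL' : Nat.card L + 1 < A.card := by exact_mod_cast hAL
  have hBL' : Nat.card L + 1 < B.card := by exact_mod_cast hBL
  have tA : A.card = A0.card + A1.card := by
    rw [← card_union_of_disjoint]
    · congr 1
      ext a
      simp only [hA0, hA1, mem_union, mem_filter, ← and_or_left]
      exact ⟨fun h => ⟨h, pA a h⟩, fun h => h.1⟩
    · rw [disjoint_left]
      intro a h0 h1
      exact hx ((mem_filter.1 h0).2.symm.trans (mem_filter.1 h1).2)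
  have tB : B.card = B0.card + B1.card := by
    rw [← card_union_of_disjoint]
    · congr 1
      ext a
      simp only [hB0, hB1, mem_union, mem_filter, ← and_or_left]
      exact ⟨fun h => ⟨h, pB a h⟩, fun h => h.1⟩
    · rw [disjoint_left]
      intro a h0 h1
      exact hy ((mem_filter.1 h0).2.symm.trans (mem_filter.1 h1).2)
  have nA0 : A0.Nonempty := card_pos.1 (by omega)
  have nA1 : A1.Nonempty := card_pos.1 (by omega)
  have nB0 : B0.Nonempty := card_pos.1 (by omega)
  have nB1 : B1.Nonempty := card_pos.1 (by omega)
  have b00 := cell_bound A0 B0 S nA0 nB0 e (cell_missing sA0 sB0 mA) (cell_missing sB0 sA0 mB)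
  have b01 := cell_bound A0 B1 S nA0 nB1 e (cell_missing sA0 sB1 mA) (cell_missing sB1 sA0 mB)
  have b11 := cell_bound A1 B1 S nA1 nB1 e (cell_missing sA1 sB1 mA) (cell_missing sB1 sA1 mB)
  have cls : ∀ (P Q : Finset ℤ) (x y : ZMod l ⧸ L), (∀ a ∈ P, c a = x) → (∀ b ∈ Q, c b = y) →
      ∀ z ∈ S ∩ (P + Q), c z = x + y := by
    intro P Q x y hP hQ z hz
    obtain ⟨a, ha, b, hb, rfl⟩ := mem_add.1 (mem_inter.1 hz).2
    rw [cadd, hP a ha, hQ b hb]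
  have e00 := cls A0 B0 x0 y0 (fun a ha => (mem_filter.1 ha).2) (fun a ha => (mem_filter.1 ha).2)
  have e01 := cls A0 B1 x0 y1 (fun a ha => (mem_filter.1 ha).2) (fun a ha => (mem_filter.1 ha).2)
  have e11 := cls A1 B1 x1 y1 (fun a ha => (mem_filter.1 ha).2) (fun a ha => (mem_filter.1 ha).2)
  have d1 : Disjoint (S ∩ (A0 + B0)) (S ∩ (A0 + B1)) := by
    rw [disjoint_left]
    intro z h0 h1
    exact hy (add_left_cancel ((e00 z h0).symm.trans (e01 z h1)))
  have d2 : Disjoint (S ∩ (A0 + B0) ∪ S ∩ (A0 + B1)) (S ∩ (A1 + B1)) := by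
    rw [disjoint_left]
    intro z h0 h1
    rcases mem_union.1 h0 with h0 | h0
    · exact hxy ((e00 z h0).symm.trans (e11 z h1))
    · exact hx (add_right_cancel ((e01 z h0).symm.trans (e11 z h1)))
  have tot : (S ∩ (A0 + B0) ∪ S ∩ (A0 + B1) ∪ S ∩ (A1 + B1)).card ≤ S.card :=
    card_le_card (union_subset (union_subset inter_subset_left inter_subset_left) inter_subset_left)
  rw [card_union_of_disjoint d2, card_union_of_disjoint d1] at tot
  have tot' : ((S ∩ (A0 + B0)).card : ℝ) + (S ∩ (A0 + B1)).card + (S ∩ (A1 + B1)).card ≤ S.card := by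
    exact_mod_cast tot
  have lA1' : (A1.card : ℝ) ≤ Nat.card L + 1 := by exact_mod_cast lA1
  have lB0' : (B0.card : ℝ) ≤ Nat.card L + 1 := by exact_mod_cast lB0
  have tA' : (A.card : ℝ) = A0.card + A1.card := by exact_mod_cast tA
  have tB' : (B.card : ℝ) = B0.card + B1.card := by exact_mod_cast tB
  linarith

lemma core_half (A B S : Finset ℤ) (n e φ σ : ℝ) (he : 2 < e) (hφ : φ ^ 2 = φ + 1)
    (h1 : 1.618 < φ) (h2 : φ < 1.6181) (hσ0 : 2 * n ≤ σ) (hσ : σ + 11 * e ≤ (1 + φ) * n)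
    (hp : n - e ≤ A.card) (hp' : (A.card : ℝ) ≤ n)
    (hq : n - e ≤ B.card) (hq' : (B.card : ℝ) ≤ n)
    (mA : ∀ a ∈ A, ((B.filter (fun b => a + b ∉ S)).card : ℝ) ≤ e)
    (mB : ∀ b ∈ B, ((A.filter (fun a => b + a ∉ S)).card : ℝ) ≤ e)
    (mT : (((A ×ˢ B).filter (fun z => z.1 + z.2 ∉ S)).card : ℝ) ≤ e ^ 2)
    (hs : (S.card : ℝ) ≤ σ) (l : ℕ) (hl : 0 < l) (m k : ℤ) (hm : m ∈ A) (hM : m + l ∈ A)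
    (hk : k ∈ B) (hA : ∀ a ∈ A, m ≤ a ∧ a ≤ m + l) (hB : ∀ b ∈ B, k ≤ b ∧ b ≤ k + l) :
    ∃ (g : ℤ) (N : ℕ) (x y : ℤ), g ≠ 0 ∧ (N : ℝ) ≤ σ - n + 5 * e ∧
      A ⊆ (range N).image (fun i : ℕ => x + g * (i : ℤ)) ∧
      B ⊆ (range N).image (fun i : ℕ => y + g * (i : ℤ)) := by
  classical
  have : NeZero l := ⟨hl.ne'⟩
  have h11 : 11 * e ≤ (φ - 1) * n := by linarith
  have hn : 17 * e ≤ n := by nlinarith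
  have hφn : φ * n ≤ 1.6181 * n := by nlinarith
  have cA : (A.card : ℝ) ≤ (A.image (Int.castAddHom (ZMod l))).card + 1 := by
    exact_mod_cast hat_card l A m hA
  have cB : (B.card : ℝ) ≤ (B.image (Int.castAddHom (ZMod l))).card + 1 := by
    exact_mod_cast hat_card l B k hB
  have cA' : ((A.image (Int.castAddHom (ZMod l))).card : ℝ) ≤ A.card := by
    exact_mod_cast card_image_le
  have cB' : ((B.image (Int.castAddHom (ZMod l))).card : ℝ) ≤ B.card := by
    exact_mod_cast card_image_le
  have cS := hat_S l hl B S m k hB e (mA m hm) (mA _ hM)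
  obtain ⟨L, h | h⟩ := structure_lemma (A.image (Int.castAddHom (ZMod l)))
    (B.image (Int.castAddHom (ZMod l))) (S.image (Int.castAddHom (ZMod l))) n e φ he hφ h1 h2 h11
    (by linarith) (by linarith) (by linarith) (by linarith)
    (hat_mA _ A B S e mA) (hat_mA _ B A S e mB) (hat_mT _ A B S _ mT) (by linarith)
  · obtain ⟨hLA, hLB, hc⟩ := h
    have i1 := in_progression l hl L A m hm hA hLA
    have i2 := in_progression l hl L B k hk hB hLB
    refine ⟨((l / Nat.card L : ℕ) : ℤ), Nat.card L + 1, m, k, ?_, ?_, i1, i2⟩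
    · have hdvd : Nat.card L ∣ l := by
        have := AddSubgroup.card_addSubgroup_dvd_card L
        rwa [Nat.card_zmod] at this
      have := Nat.div_pos (Nat.le_of_dvd hl hdvd) (Nat.pos_of_dvd_of_pos hdvd hl)
      exact_mod_cast this.ne'
    · push_cast
      linarith
  · exfalso
    obtain ⟨x0, x1, y0, y1, pA, pB, hx, hy, hxy, hc⟩ := h
    have := two_cosets_bound l hl L A B S m k hA hB e mA mB x0 x1 y0 y1
      (fun a ha => pA _ (mem_image_of_mem _ ha)) (fun a ha => pB _ (mem_image_of_mem _ ha))
      hx hy hxy (by linarith) (by linarith)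
    linarith

lemma core (A B S : Finset ℤ) (n e φ σ : ℝ) (he : 2 < e) (hφ : φ ^ 2 = φ + 1)
    (h1 : 1.618 < φ) (h2 : φ < 1.6181) (hσ0 : 2 * n ≤ σ) (hσ : σ + 11 * e ≤ (1 + φ) * n)
    (hp : n - e ≤ A.card) (hp' : (A.card : ℝ) ≤ n)
    (hq : n - e ≤ B.card) (hq' : (B.card : ℝ) ≤ n)
    (mA : ∀ a ∈ A, ((B.filter (fun b => a + b ∉ S)).card : ℝ) ≤ e)
    (mB : ∀ b ∈ B, ((A.filter (fun a => b + a ∉ S)).card : ℝ) ≤ e)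
    (mT : (((A ×ˢ B).filter (fun z => z.1 + z.2 ∉ S)).card : ℝ) ≤ e ^ 2)
    (hs : (S.card : ℝ) ≤ σ) :
    ∃ (g : ℤ) (N : ℕ) (x y : ℤ), g ≠ 0 ∧ (N : ℝ) ≤ σ - n + 5 * e ∧
      A ⊆ (range N).image (fun i : ℕ => x + g * (i : ℤ)) ∧
      B ⊆ (range N).image (fun i : ℕ => y + g * (i : ℤ)) := by
  classical
  have hn : 17 * e ≤ n := by nlinarith
  have cA : 1 < A.card := by
    have : (1 : ℝ) < A.card := by linarith
    exact_mod_cast this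
  have cB : 1 < B.card := by
    have : (1 : ℝ) < B.card := by linarith
    exact_mod_cast this
  have nA : A.Nonempty := card_pos.1 (by omega)
  have nB : B.Nonempty := card_pos.1 (by omega)
  have ltA := A.min'_lt_max'_of_card cA
  have ltB := B.min'_lt_max'_of_card cB
  have bA : ∀ a ∈ A, A.min' nA ≤ a ∧ a ≤ A.max' nA := fun a ha => ⟨A.min'_le a ha, A.le_max' a ha⟩
  have bB : ∀ a ∈ B, B.min' nB ≤ a ∧ a ≤ B.max' nB := fun a ha => ⟨B.min'_le a ha, B.le_max' a ha⟩
  have a1 := A.min'_mem nA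
  have a2 := A.max'_mem nA
  have b1 := B.min'_mem nB
  have b2 := B.max'_mem nB
  generalize A.min' nA = m at *
  generalize A.max' nA = M at *
  generalize B.min' nB = k at *
  generalize B.max' nB = K at *
  rcases le_total (K - k) (M - m) with h | h
  · obtain ⟨l, hl⟩ := Int.eq_ofNat_of_zero_le (by omega : 0 ≤ M - m)
    have hM : M = m + l := by omega
    exact core_half A B S n e φ σ he hφ h1 h2 hσ0 hσ hp hp' hq hq' mA mB mT hs l (by omega) m k
      a1 (hM ▸ a2) b1 (fun a ha => by have := bA a ha; omega) (fun a ha => by have := bB a ha; omega)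
  · obtain ⟨l, hl⟩ := Int.eq_ofNat_of_zero_le (by omega : 0 ≤ K - k)
    have hM : K = k + l := by omega
    have mT' : (((B ×ˢ A).filter (fun z => z.1 + z.2 ∉ S)).card : ℝ) ≤ e ^ 2 := by
      refine le_trans ?_ mT
      norm_cast
      refine le_trans (card_le_card ?_) (card_image_le (f := Prod.swap))
      rintro ⟨x, y⟩ hz
      rw [mem_filter, mem_product] at hz
      refine mem_image.2 ⟨(y, x), mem_filter.2 ⟨mem_product.2 ⟨hz.1.2, hz.1.1⟩, ?_⟩, rfl⟩
      have := hz.2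
      simpa only [add_comm y x] using this
    obtain ⟨g, N, x, y, q1, q2, q3, q4⟩ :=
      core_half B A S n e φ σ he hφ h1 h2 hσ0 hσ hq hq' hp hp' mB mA mT' hs l (by omega) k m
      b1 (hM ▸ b2) a1 (fun a ha => by have := bB a ha; omega) (fun a ha => by have := bA a ha; omega)
    exact ⟨g, N, y, x, q1, q2, q4, q3⟩

lemma trim_card (A B S : Finset ℤ) (e : ℝ) (he : 0 < e)
    (mT : (((A ×ˢ B).filter (fun z => z.1 + z.2 ∉ S)).card : ℝ) ≤ e ^ 2) :
    (A.card : ℝ) - e ≤ (A.filter (fun a => ((B.filter (fun b => a + b ∉ S)).card : ℝ) ≤ e)).card := by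
  classical
  have h1 := card_filter_add_card_filter_not (s := A)
    (fun a => ((B.filter (fun b => a + b ∉ S)).card : ℝ) ≤ e)
  set D := A.filter (fun a => ¬ ((B.filter (fun b => a + b ∉ S)).card : ℝ) ≤ e) with hD
  have h2 : ((A.filter (fun a => ((B.filter (fun b => a + b ∉ S)).card : ℝ) ≤ e)).card : ℝ) + D.card
    = A.card := by exact_mod_cast h1
  have h3 : (D.card : ℝ) * e ≤ e ^ 2 := by
    refine le_trans ?_ mT
    rw [card_eq_sum_card_fiberwise (f := Prod.fst) (t := A)
      (fun z hz => by
        have := (mem_filter.1 (mem_coe.1 hz)).1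
        exact (mem_product.1 this).1)]
    push_cast
    calc (D.card : ℝ) * e ≤ ∑ a ∈ D, ((((A ×ˢ B).filter (fun z => z.1 + z.2 ∉ S)).filter
            (fun z => z.1 = a)).card : ℝ) := by
          rw [← nsmul_eq_mul]
          apply card_nsmul_le_sum
          intro a ha
          rw [hD, mem_filter] at ha
          have := ha.2
          push Not at this
          refine this.le.trans ?_
          norm_cast
          apply card_le_card_of_injOn (fun b => (a, b))
          · intro b hb
            have hb := mem_filter.1 (mem_coe.1 hb)
            rw [mem_coe, mem_filter, mem_filter, mem_product]
            exact ⟨⟨⟨ha.1, hb.1⟩, hb.2⟩, rfl⟩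
          · intro b _ b' _ h
            exact (Prod.mk.inj h).2
      _ ≤ _ := by
          apply sum_le_sum_of_subset_of_nonneg (filter_subset _ _)
          intro a _ _
          positivity
  have h4 : (D.card : ℝ) ≤ e := by
    have : (D.card : ℝ) * e ≤ e * e := by rw [← sq]; exact h3
    exact le_of_mul_le_mul_right this he
  linarith

lemma swap_missing (A B S : Finset ℤ) (t : ℝ)
    (mT : (((A ×ˢ B).filter (fun z => z.1 + z.2 ∉ S)).card : ℝ) ≤ t) :
    (((B ×ˢ A).filter (fun z => z.1 + z.2 ∉ S)).card : ℝ) ≤ t := by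
  refine le_trans ?_ mT
  norm_cast
  refine le_trans (card_le_card ?_) (card_image_le (f := Prod.swap))
  rintro ⟨x, y⟩ hz
  rw [mem_filter, mem_product] at hz
  refine mem_image.2 ⟨(y, x), mem_filter.2 ⟨mem_product.2 ⟨hz.1.2, hz.1.1⟩, ?_⟩, rfl⟩
  have := hz.2
  simpa only [add_comm y x] using this

lemma unpopular_count (A B : Finset ℤ) (t : ℝ) (ht : 0 ≤ t) :
    (((A ×ˢ B).filter (fun z => z.1 + z.2 ∉ (A + B).filter fun x =>
        t / ((A + B).card : ℝ)
          ≤ (((A ×ˢ B).filter fun p => p.1 + p.2 = x).card : ℝ))).card : ℝ) ≤ t := by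
  classical
  set S := (A + B).filter fun x => t / ((A + B).card : ℝ)
          ≤ (((A ×ˢ B).filter fun p => p.1 + p.2 = x).card : ℝ) with hS
  rw [card_eq_sum_card_fiberwise (f := fun z : ℤ × ℤ => z.1 + z.2) (t := (A + B) \ S)
      (fun z hz => by
        have := mem_filter.1 (mem_coe.1 hz)
        have h2 := mem_product.1 this.1
        exact mem_coe.2 (mem_sdiff.2 ⟨add_mem_add h2.1 h2.2, this.2⟩))]
  push_cast
  calc _ ≤ ∑ x ∈ (A + B) \ S, t / ((A + B).card : ℝ) := by
        apply sum_le_sum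
        intro x hx
        rw [mem_sdiff] at hx
        have h : ((A ×ˢ B).filter fun p => p.1 + p.2 = x).card < t / ((A + B).card : ℝ) := by
          by_contra hcon
          push Not at hcon
          exact hx.2 (mem_filter.2 ⟨hx.1, hcon⟩)
        refine le_trans ?_ h.le
        norm_cast
        exact card_le_card (filter_subset_filter _ (filter_subset _ _))
    _ = ((A + B) \ S).card * (t / ((A + B).card : ℝ)) := by rw [sum_const, nsmul_eq_mul]
    _ ≤ (A + B).card * (t / ((A + B).card : ℝ)) := by
        apply mul_le_mul_of_nonneg_right
        · exact_mod_cast card_le_card sdiff_subset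
        · positivity
    _ ≤ t := by
        rcases eq_or_ne ((A + B).card : ℝ) 0 with h | h
        · rw [h, zero_mul]; exact ht
        · rw [mul_div_cancel₀ _ h]

theorem popular_sum_robust (A B : Finset ℤ) (n : ℕ) (hA : A.card = n) (hB : B.card = n)
    (η δ : ℝ) (hη : 0 < η) (hδ : 0 < δ)
    (hηδ : 11 * Real.sqrt η + δ < (Real.sqrt 5 - 1) / 2)
    (hn : 2 / Real.sqrt η < (n : ℝ))
    (hpop : ((((A + B).filter fun x =>
        η * (n : ℝ) ^ 2 / ((A + B).card : ℝ)
          ≤ (((A ×ˢ B).filter fun p => p.1 + p.2 = x).card : ℝ)).card : ℝ))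
      ≤ (2 + δ) * n) :
    ∃ (P Q : Finset ℤ) (d : ℤ),
      (∃ x, P = (Finset.range P.card).image fun i : ℕ => x + d * (i : ℤ)) ∧
      (∃ y, Q = (Finset.range Q.card).image fun i : ℕ => y + d * (i : ℤ)) ∧
      (P.card : ℝ) ≤ (1 + δ + 5 * Real.sqrt η) * n ∧
      (Q.card : ℝ) ≤ (1 + δ + 5 * Real.sqrt η) * n ∧
      (1 - Real.sqrt η) * n ≤ ((A ∩ P).card : ℝ) ∧
      (1 - Real.sqrt η) * n ≤ ((B ∩ Q).card : ℝ) := by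
  classical
  have hs0 : 0 < Real.sqrt η := Real.sqrt_pos.2 hη
  have hcount := unpopular_count A B (η * (n : ℝ) ^ 2) (by positivity)
  set S := (A + B).filter fun x => η * (n : ℝ) ^ 2 / ((A + B).card : ℝ)
          ≤ (((A ×ˢ B).filter fun p => p.1 + p.2 = x).card : ℝ) with hS
  obtain ⟨e, hedef⟩ : ∃ e, e = Real.sqrt η * n := ⟨_, rfl⟩
  have he : 2 < e := by
    rw [div_lt_iff₀ hs0] at hn
    rw [hedef]; linarith
  have hesq : η * (n : ℝ) ^ 2 = e ^ 2 := by
    rw [hedef, mul_pow, Real.sq_sqrt hη.le]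
  rw [hesq] at hcount
  set A' := A.filter (fun a => ((B.filter (fun b => a + b ∉ S)).card : ℝ) ≤ e) with hA'
  set B' := B.filter (fun b => ((A.filter (fun a => b + a ∉ S)).card : ℝ) ≤ e) with hB'
  have sA : A' ⊆ A := filter_subset _ _
  have sB : B' ⊆ B := filter_subset _ _
  have tA := trim_card A B S e (by linarith) hcount
  have tB := trim_card B A S e (by linarith) (swap_missing A B S _ hcount)
  rw [← hA', hA] at tA
  rw [← hB', hB] at tB
  have lA : (A'.card : ℝ) ≤ n := by rw [← hA]; exact_mod_cast card_le_card sA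
  have lB : (B'.card : ℝ) ≤ n := by rw [← hB]; exact_mod_cast card_le_card sB
  have s5 : Real.sqrt 5 ^ 2 = 5 := Real.sq_sqrt (by norm_num)
  have s5l : 2.236 < Real.sqrt 5 := by
    apply Real.lt_sqrt_of_sq_lt; norm_num
  have s5u : Real.sqrt 5 < 2.2362 := by
    rw [Real.sqrt_lt' (by norm_num)]; norm_num
  have n0 : (0 : ℝ) ≤ n := by positivity
  obtain ⟨g, N, x, y, hg, hN, iA, iB⟩ := core A' B' S n e ((1 + Real.sqrt 5) / 2) ((2 + δ) * n) he
    (by nlinarith) (by linarith) (by linarith) (by nlinarith) (by rw [hedef]; nlinarith)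
    tA lA tB lB
    (cell_missing (fun a ha => ha) sB (fun a ha => (mem_filter.1 ha).2))
    (cell_missing (fun a ha => ha) sA (fun a ha => (mem_filter.1 ha).2))
    (by
      refine le_trans ?_ hcount
      exact_mod_cast card_le_card (filter_subset_filter _ (product_subset_product sA sB)))
    hpop
  have cN : ∀ u : ℤ, ((range N).image (fun i : ℕ => u + g * (i : ℤ))).card = N := by
    intro u
    rw [card_image_of_injective, card_range]
    intro i j hij
    have : g * (i : ℤ) = g * j := add_left_cancel hij
    exact_mod_cast mul_left_cancel₀ hg this
  have hN' : (N : ℝ) ≤ (1 + δ + 5 * Real.sqrt η) * n := by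
    rw [hedef] at hN; linarith
  refine ⟨(range N).image (fun i : ℕ => x + g * (i : ℤ)),
    (range N).image (fun i : ℕ => y + g * (i : ℤ)), g, ⟨x, by rw [cN]⟩, ⟨y, by rw [cN]⟩,
    by rw [cN]; exact hN', by rw [cN]; exact hN', ?_, ?_⟩
  · have : (A'.card : ℝ) ≤ (A ∩ (range N).image (fun i : ℕ => x + g * (i : ℤ))).card := by
      exact_mod_cast card_le_card (subset_inter sA iA)
    rw [hedef] at tA; linarith
  · have : (B'.card : ℝ) ≤ (B ∩ (range N).image (fun i : ℕ => y + g * (i : ℤ))).card := by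
      exact_mod_cast card_le_card (subset_inter sB iB)
    rw [hedef] at tB; linarith
end

section
/- Let ε ∈ (0, 2^{-20}). Let A ⊆ ℤ_{>0} be a set of n ≥ 2ε^{-1/2} positive integers with C(A) ≥ (1 − ε)/2. Then there exists an arithmetic progression P of integers containing 0 with size at most (1 + 45ε^{1/2})n such that |A ∩ P| ≥ (1 − ε^{1/2})n. -/
open Finset

theorem near_subgroup {G : Type*} [AddCommGroup G] [DecidableEq G] (B : Finset G)
    (hB : B.Nonempty) (η : ℝ) (hη : 0 < η) (hη' : η ≤ 1 / 64)
    (hbad : (((B ×ˢ B).filter fun p => p.1 - p.2 ∉ B).card : ℝ) ≤ η * (B.card : ℝ) ^ 2) :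
    ∃ H : AddSubgroup G,
      (∀ F : Finset G, (∀ x ∈ F, x ∈ H) → (1 - 16 * η) * (F.card : ℝ) ≤ B.card) ∧
      (∀ K : Finset G, K ⊆ B → (∀ x ∈ K, x ∉ H) → (K.card : ℝ) ≤ 2 * η * B.card) := by
  classical
  set m : ℝ := (B.card : ℝ) with hm
  have hm0 : 0 < m := by simpa [hm] using hB.card_pos
  let r : G → ℕ := fun h => (B.filter fun x => x - h ∈ B).card
  let g : G → ℕ := fun x => (B.filter fun y => x - y ∉ B).card
  let Q : Finset G := B.filter fun x => 8 * η * m < g x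
  have hgsum : ((∑ x ∈ B, g x : ℕ) : ℝ) ≤ η * m ^ 2 := by
    refine le_trans (le_of_eq ?_) hbad
    congr 1
    simp only [g, Finset.card_filter, Finset.sum_product]
  have hrsum : ((∑ x ∈ B, (B.card - r x) : ℕ) : ℝ) ≤ η * m ^ 2 := by
    refine le_trans (le_of_eq ?_) hbad
    congr 1
    have : ∀ x ∈ B, B.card - r x = (B.filter fun y => y - x ∉ B).card := by
      intro x _
      have := Finset.card_filter_add_card_filter_not (s := B) (fun y => y - x ∈ B)
      simp only [r]
      omega
    rw [Finset.sum_congr rfl this]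
    simp only [Finset.card_filter, Finset.sum_product]
    rw [Finset.sum_comm]
  have hQ : (Q.card : ℝ) ≤ m / 8 := by
    have h1 : (Q.card : ℝ) * (8 * η * m) ≤ ((∑ x ∈ B, g x : ℕ) : ℝ) := by
      push_cast
      calc (Q.card : ℝ) * (8 * η * m) = ∑ x ∈ Q, (8 * η * m) := by simp
        _ ≤ ∑ x ∈ Q, (g x : ℝ) := Finset.sum_le_sum fun x hx => (Finset.mem_filter.1 hx).2.le
        _ ≤ ∑ x ∈ B, (g x : ℝ) :=
          Finset.sum_le_sum_of_subset_of_nonneg (Finset.filter_subset _ _) (by intros; positivity)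
    have h2 : (Q.card : ℝ) * (8 * η * m) ≤ (m / 8) * (8 * η * m) := by nlinarith
    exact le_of_mul_le_mul_right h2 (by positivity)
  have hgood : ∀ x ∈ B, ∀ y ∈ B, x ∉ Q → y ∉ Q → (1 - 16 * η) * m ≤ r (x - y) := by
    intro x hx y hy hxQ hyQ
    have hgx : (g x : ℝ) ≤ 8 * η * m := by
      by_contra h
      exact hxQ (Finset.mem_filter.2 ⟨hx, not_le.1 h⟩)
    have hgy : (g y : ℝ) ≤ 8 * η * m := by
      by_contra h
      exact hyQ (Finset.mem_filter.2 ⟨hy, not_le.1 h⟩)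
    have h1 : (B.filter fun z => x - z ∈ B ∧ y - z ∈ B).card ≤ r (x - y) := by
      refine Finset.card_le_card_of_injOn (fun z => x - z) ?_ ?_
      · intro z hz
        simp only [Finset.coe_filter, Set.mem_ofPred_eq] at hz ⊢
        refine ⟨hz.2.1, ?_⟩
        have : x - z - (x - y) = y - z := by abel
        rw [this]; exact hz.2.2
      · intro a _ b _ hab
        simpa using hab
    have h2 : B.card ≤ (B.filter fun z => x - z ∈ B ∧ y - z ∈ B).card + g x + g y := by
      have : B ⊆ (B.filter fun z => x - z ∈ B ∧ y - z ∈ B) ∪ (B.filter fun z => x - z ∉ B) ∪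
          (B.filter fun z => y - z ∉ B) := by
        intro z hz
        simp only [Finset.mem_union, Finset.mem_filter]
        tauto
      refine (Finset.card_le_card this).trans ((Finset.card_union_le _ _).trans ?_)
      exact Nat.add_le_add_right (Finset.card_union_le _ _) _
    have h3 : m ≤ (r (x - y) : ℝ) + g x + g y := by
      rw [hm]; exact_mod_cast h2.trans (by omega)
    linarith
  have hgap : ∀ h, m / 4 < r h → (1 - 16 * η) * m ≤ r h := by
    intro h hh
    have : ∃ x ∈ B, x - h ∈ B ∧ x ∉ Q ∧ x - h ∉ Q := by
      by_contra hne
      push Not at hne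
      have hsub : (B.filter fun x => x - h ∈ B) ⊆ Q ∪ Q.image (fun x => x + h) := by
        intro x hx
        rw [Finset.mem_filter] at hx
        rw [Finset.mem_union, Finset.mem_image]
        by_cases hxQ : x ∈ Q
        · exact Or.inl hxQ
        · exact Or.inr ⟨x - h, hne x hx.1 hx.2 hxQ, by abel⟩
      have h1 : r h ≤ Q.card + Q.card :=
        (Finset.card_le_card hsub).trans ((Finset.card_union_le _ _).trans
          (Nat.add_le_add_left Finset.card_image_le _))
      have h2 : (r h : ℝ) ≤ Q.card + Q.card := by exact_mod_cast h1
      linarith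
    obtain ⟨x, hx, hxh, hxQ, hxhQ⟩ := this
    have := hgood x hx (x - h) hxh hxQ hxhQ
    simpa using this
  have hsubc : ∀ h h', m / 4 < r h → m / 4 < r h' → m / 4 < r (h - h') := by
    intro h h' hh hh'
    have e1 := hgap h hh
    have e2 := hgap h' hh'
    have h1 : (B.filter fun z => z - h ∈ B ∧ z - h' ∈ B).card ≤ r (h - h') := by
      refine Finset.card_le_card_of_injOn (fun z => z - h') ?_ ?_
      · intro z hz
        simp only [Finset.coe_filter, Set.mem_ofPred_eq] at hz ⊢
        refine ⟨hz.2.2, ?_⟩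
        have : z - h' - (h - h') = z - h := by abel
        rw [this]; exact hz.2.1
      · intro a _ b _ hab
        simpa using hab
    have h2 : r h + r h' ≤ (B.filter fun z => z - h ∈ B ∧ z - h' ∈ B).card + B.card := by
      have e3 := Finset.card_union_add_card_inter (B.filter fun z => z - h ∈ B)
        (B.filter fun z => z - h' ∈ B)
      rw [← Finset.filter_and] at e3
      have e4 : ((B.filter fun z => z - h ∈ B) ∪ (B.filter fun z => z - h' ∈ B)).card ≤ B.card :=
        Finset.card_le_card (Finset.union_subset (Finset.filter_subset _ _)
          (Finset.filter_subset _ _))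
      simp only [r]
      omega
    have h3 : (r h : ℝ) + r h' ≤ r (h - h') + m := by
      rw [hm]; exact_mod_cast h2.trans (by omega)
    nlinarith
  have hr0 : m / 4 < r 0 := by
    have : r 0 = B.card := by simp [r]
    rw [this]; linarith
  have hneg : ∀ h, m / 4 < r h → m / 4 < r (-h) := by
    intro h hh
    simpa using hsubc 0 h hr0 hh
  let H : AddSubgroup G :=
    { carrier := {h | m / 4 < r h}
      zero_mem' := hr0
      add_mem' := by
        intro a b ha hb
        have := hsubc a (-b) ha (hneg b hb)
        simpa using this
      neg_mem' := by
        intro a ha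
        exact hneg a ha }
  have hH : ∀ h, h ∈ H ↔ m / 4 < r h := fun h => Iff.rfl
  refine ⟨H, ?_, ?_⟩
  · intro F hF
    have h1 : ∑ h ∈ F, r h ≤ B.card * B.card := by
      have : ∑ h ∈ F, r h = ∑ x ∈ B, (F.filter fun h => x - h ∈ B).card := by
        simp only [r, Finset.card_filter]
        rw [Finset.sum_comm]
      rw [this, ← smul_eq_mul]
      refine Finset.sum_le_card_nsmul _ _ _ ?_
      intro x _
      refine Finset.card_le_card_of_injOn (fun h => x - h) ?_ ?_
      · intro z hz
        simp only [Finset.coe_filter, Set.mem_ofPred_eq] at hz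
        exact hz.2
      · intro a _ b _ hab
        simpa using hab
    have h2 : (F.card : ℝ) * ((1 - 16 * η) * m) ≤ m * m := by
      calc (F.card : ℝ) * ((1 - 16 * η) * m) = ∑ h ∈ F, ((1 - 16 * η) * m) := by simp
        _ ≤ ∑ h ∈ F, (r h : ℝ) := Finset.sum_le_sum fun h hh => hgap h ((hH h).1 (hF h hh))
        _ ≤ m * m := by rw [hm]; exact_mod_cast h1
    refine le_of_mul_le_mul_right ?_ hm0
    linarith
  · intro K hKB hK
    have h1 : (K.card : ℝ) * (3 / 4 * m) ≤ η * m ^ 2 := by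
      refine le_trans ?_ hrsum
      push_cast
      calc (K.card : ℝ) * (3 / 4 * m) = ∑ x ∈ K, (3 / 4 * m) := by simp
        _ ≤ ∑ x ∈ K, ((B.card - r x : ℕ) : ℝ) := by
          refine Finset.sum_le_sum fun x hx => ?_
          have h3 : (r x : ℝ) ≤ m / 4 := not_lt.1 fun h => hK x hx ((hH x).2 h)
          have h4 : r x ≤ B.card := Finset.card_filter_le _ _
          rw [Nat.cast_sub h4]
          linarith
        _ ≤ ∑ x ∈ B, ((B.card - r x : ℕ) : ℝ) :=
          Finset.sum_le_sum_of_subset_of_nonneg hKB (by intros; positivity)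
    have h2 : (K.card : ℝ) * (3 / 4 * m) ≤ (2 * η * m) * (3 / 4 * m) := by nlinarith [mul_pos hη (mul_pos hm0 hm0)]
    exact le_of_mul_le_mul_right h2 (by positivity)

/-- The bad pairs. -/
def badPairs (A : Finset ℤ) : Finset (ℤ × ℤ) :=
  (A ×ˢ A).filter fun p => p.2 < p.1 ∧ p.1 - p.2 ∉ A

theorem badPairs_card (A : Finset ℤ) (hpos : ∀ a ∈ A, 0 < a) :
    2 * (badPairs A).card + 2 * ((A ×ˢ A).filter fun p => p.1 + p.2 ∈ A).card + A.card
      = A.card ^ 2 := by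
  classical
  have h1 : ((A ×ˢ A).filter fun p => p.1 + p.2 ∈ A).card =
      ((A ×ˢ A).filter fun p => p.2 < p.1 ∧ p.1 - p.2 ∈ A).card := by
    refine Finset.card_bij' (fun p _ => (p.1 + p.2, p.2)) (fun p _ => (p.1 - p.2, p.2)) ?_ ?_ ?_ ?_
    · rintro ⟨a, b⟩ h
      simp only [Finset.mem_filter, Finset.mem_product] at h ⊢
      have := hpos a h.1.1
      refine ⟨⟨h.2, h.1.2⟩, by omega, by simpa using h.1.1⟩
    · rintro ⟨a, b⟩ h
      simp only [Finset.mem_filter, Finset.mem_product] at h ⊢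
      refine ⟨⟨h.2.2, h.1.2⟩, by simpa using h.1.1⟩
    · rintro ⟨a, b⟩ h; simp
    · rintro ⟨a, b⟩ h; simp
  have h2 : (badPairs A).card + ((A ×ˢ A).filter fun p => p.2 < p.1 ∧ p.1 - p.2 ∈ A).card =
      ((A ×ˢ A).filter fun p => p.2 < p.1).card := by
    have := Finset.card_filter_add_card_filter_not (s := (A ×ˢ A).filter fun p => p.2 < p.1)
      (fun p => p.1 - p.2 ∈ A)
    rw [Finset.filter_filter, Finset.filter_filter] at this
    unfold badPairs
    omega
  have h3 : ((A ×ˢ A).filter fun p => p.2 < p.1).card =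
      ((A ×ˢ A).filter fun p => p.1 < p.2).card := by
    refine Finset.card_bij' (fun p _ => p.swap) (fun p _ => p.swap) ?_ ?_ ?_ ?_ <;>
    · rintro ⟨a, b⟩ h
      simp at h ⊢
      try tauto
  have h4 : ((A ×ˢ A).filter fun p => p.1 = p.2).card = A.card := by
    have : ((A ×ˢ A).filter fun p => p.1 = p.2) = A.diag := by
      ext ⟨a, b⟩
      simp only [Finset.mem_filter, Finset.mem_product, Finset.mem_diag]
      constructor
      · rintro ⟨⟨h, _⟩, e⟩; exact ⟨h, e⟩
      · rintro ⟨h, e⟩; exact ⟨⟨h, e ▸ h⟩, e⟩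
    rw [this, Finset.diag_card]
  have h5 : (A ×ˢ A).card = ((A ×ˢ A).filter fun p => p.2 < p.1).card +
      (((A ×ˢ A).filter fun p => p.1 < p.2).card + ((A ×ˢ A).filter fun p => p.1 = p.2).card) := by
    rw [← Finset.card_filter_add_card_filter_not (s := A ×ˢ A) (fun p => p.2 < p.1)]
    congr 1
    rw [← Finset.card_filter_add_card_filter_not
      (s := (A ×ˢ A).filter fun p => ¬ p.2 < p.1) (fun p => p.1 < p.2)]
    rw [Finset.filter_filter, Finset.filter_filter]
    congr 2
    · apply Finset.filter_congr; intro p _; omega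
    · apply Finset.filter_congr; intro p _; omega
  rw [Finset.card_product] at h5
  rw [sq]
  omega

theorem outside_card (A : Finset ℤ) (d : ℤ) :
    (A.filter fun a => ¬ d ∣ a).card * (A.filter fun a => d ∣ a).card ≤
      (badPairs A).card + 2 * (A.filter fun a => ¬ d ∣ a).card ^ 2 := by
  classical
  set K := A.filter fun a => ¬ d ∣ a with hK
  set L := A.filter fun a => d ∣ a with hL
  have mK : ∀ x, x ∈ K ↔ x ∈ A ∧ ¬ d ∣ x := by intro x; simp [hK]
  have mL : ∀ x, x ∈ L ↔ x ∈ A ∧ d ∣ x := by intro x; simp [hL]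
  let S1 := (K ×ˢ L).filter fun p => p.1 - p.2 ∈ A
  let S2 := (K ×ˢ L).filter fun p => p.2 - p.1 ∈ A
  let S3 := (K ×ˢ L).filter fun p => p.1 - p.2 ∉ A ∧ p.2 - p.1 ∉ A
  have hS1 : S1.card ≤ (K ×ˢ K).card := by
    refine Finset.card_le_card_of_injOn (fun p => (p.1, p.1 - p.2)) ?_ ?_
    · rintro ⟨a, b⟩ h
      simp only [S1, Finset.coe_filter, Set.mem_ofPred_eq, Finset.mem_product, mK, mL,
        Finset.mem_coe] at h ⊢
      exact ⟨h.1.1, h.2, fun hd => h.1.1.2 ((dvd_sub_left h.1.2.2).1 hd)⟩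
    · rintro ⟨a, b⟩ _ ⟨a', b'⟩ _ h
      simp only [Prod.mk.injEq] at h ⊢
      omega
  have hS2 : S2.card ≤ (K ×ˢ K).card := by
    refine Finset.card_le_card_of_injOn (fun p => (p.1, p.2 - p.1)) ?_ ?_
    · rintro ⟨a, b⟩ h
      simp only [S2, Finset.coe_filter, Set.mem_ofPred_eq, Finset.mem_product, mK, mL,
        Finset.mem_coe] at h ⊢
      exact ⟨h.1.1, h.2, fun hd => h.1.1.2 ((dvd_sub_right h.1.2.2).1 hd)⟩
    · rintro ⟨a, b⟩ _ ⟨a', b'⟩ _ h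
      simp only [Prod.mk.injEq] at h ⊢
      omega
  have hS3 : S3.card ≤ (badPairs A).card := by
    refine Finset.card_le_card_of_injOn (fun p => (max p.1 p.2, min p.1 p.2)) ?_ ?_
    · rintro ⟨a, b⟩ h
      simp only [S3, badPairs, Finset.coe_filter, Set.mem_ofPred_eq, Finset.mem_product, mK, mL,
        Finset.mem_coe] at h ⊢
      have hne : a ≠ b := by rintro rfl; exact h.1.1.2 h.1.2.2
      rcases lt_or_gt_of_ne hne with hlt | hlt
      · rw [max_eq_right hlt.le, min_eq_left hlt.le]
        exact ⟨⟨h.1.2.1, h.1.1.1⟩, hlt, h.2.2⟩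
      · rw [max_eq_left hlt.le, min_eq_right hlt.le]
        exact ⟨⟨h.1.1.1, h.1.2.1⟩, hlt, h.2.1⟩
    · rintro ⟨a, b⟩ h1 ⟨a', b'⟩ h2 h
      simp only [S3, Finset.coe_filter, Set.mem_ofPred_eq, Finset.mem_product, mK, mL] at h1 h2
      simp only [Prod.mk.injEq] at h ⊢
      by_cases e : a = a'
      · omega
      · exfalso
        have : a = b' := by omega
        exact h1.1.1.2 (this ▸ h2.1.2.2)
  have hcov : K ×ˢ L ⊆ S1 ∪ S2 ∪ S3 := by
    intro p hp
    simp only [S1, S2, S3, Finset.mem_union, Finset.mem_filter]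
    tauto
  have := (Finset.card_le_card hcov).trans ((Finset.card_union_le _ _).trans
    (Nat.add_le_add_right (Finset.card_union_le _ _) _))
  rw [Finset.card_product] at this hS1 hS2
  nlinarith

/-- The deficit set. -/
def defSet (A : Finset ℤ) (c : ℤ) : Finset ℤ := A.filter fun y => y < c ∧ c - y ∉ A

theorem sum_defSet (A : Finset ℤ) : ∑ c ∈ A, (defSet A c).card = (badPairs A).card := by
  simp only [defSet, badPairs, Finset.card_filter, Finset.sum_product]

theorem exists_step (A : Finset ℤ) (hpos : ∀ a ∈ A, 0 < a) (c : ℤ) (hc : c ∈ A) (η : ℝ)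
    (hη : 0 < η) (hη' : η ≤ 1 / 64)
    (hb : 2 * ((badPairs A).card : ℝ) + (defSet A c).card * (A.filter fun a => a ≤ c).card ≤
      η * ((A.filter fun a => a ≤ c).card : ℝ) ^ 2) :
    ∃ d : ℤ, ∃ q : ℕ, 0 < d ∧ c = d * q ∧
      (1 - 16 * η) * (q : ℝ) ≤ (A.filter fun a => a ≤ c).card ∧
      (((A.filter fun a => a ≤ c).filter fun a => ¬ d ∣ a).card : ℝ) ≤
        2 * η * (A.filter fun a => a ≤ c).card := by
  classical
  have hc0 := hpos c hc
  obtain ⟨N, rfl⟩ : ∃ N : ℕ, c = N := ⟨c.toNat, by omega⟩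
  set B := A.filter fun a => a ≤ (N : ℤ) with hB
  have mB : ∀ x, x ∈ B ↔ x ∈ A ∧ x ≤ N := by intro x; simp [hB]
  have hinj : Set.InjOn (fun x : ℤ => (x : ZMod N)) B := by
    intro x hx y hy hxy
    have hx := (mB x).1 hx
    have hy := (mB y).1 hy
    have hx0 := hpos x hx.1
    have hy0 := hpos y hy.1
    have h := (ZMod.intCast_eq_intCast_iff_dvd_sub x y N).1 hxy
    obtain ⟨k, hk⟩ := h
    have : k < 1 := by nlinarith
    have : -1 < k := by nlinarith
    have : k = 0 := by omega
    subst this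
    omega
  set B' := B.image (fun x : ℤ => (x : ZMod N)) with hB'
  have hcard : B'.card = B.card := Finset.card_image_of_injOn hinj
  have hbad : (((B' ×ˢ B').filter fun p => p.1 - p.2 ∉ B').card : ℝ) ≤
      η * (B'.card : ℝ) ^ 2 := by
    rw [hcard]
    refine le_trans ?_ hb
    let E := (B ×ˢ B).filter fun p => p.1 < p.2 ∧ p.2 - p.1 ∈ A ∧ (N : ℤ) - (p.2 - p.1) ∉ A
    have hE : E.card ≤ (defSet A N ×ˢ B).card := by
      refine Finset.card_le_card_of_injOn (fun p => (p.2 - p.1, p.2)) ?_ ?_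
      · rintro ⟨a, b⟩ h
        simp only [E, defSet, Finset.coe_filter, Set.mem_ofPred_eq, Finset.mem_product, mB,
          Finset.mem_coe, Finset.mem_filter] at h ⊢
        have := hpos a h.1.1.1
        exact ⟨⟨h.2.2.1, by omega, h.2.2.2⟩, h.1.2⟩
      · rintro ⟨a, b⟩ _ ⟨a', b'⟩ _ h
        simp only [Prod.mk.injEq] at h ⊢
        omega
    have hsub : ((B' ×ˢ B').filter fun p => p.1 - p.2 ∉ B') ⊆
        (badPairs A ∪ (badPairs A).image Prod.swap ∪ E).image
          (fun p : ℤ × ℤ => ((p.1 : ZMod N), (p.2 : ZMod N))) := by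
      rintro ⟨u, v⟩ h
      simp only [Finset.mem_filter, Finset.mem_product] at h
      obtain ⟨⟨hu, hv⟩, huv⟩ := h
      obtain ⟨x, hx, rfl⟩ := Finset.mem_image.1 hu
      obtain ⟨y, hy, rfl⟩ := Finset.mem_image.1 hv
      refine Finset.mem_image.2 ⟨(x, y), ?_, rfl⟩
      have key : ∀ z ∈ A, z ≤ N → (z : ZMod N) ≠ (x : ZMod N) - y := by
        intro z hz hzN e
        exact huv (Finset.mem_image.2 ⟨z, (mB z).2 ⟨hz, hzN⟩, e⟩)
      have hx := (mB x).1 hx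
      have hy := (mB y).1 hy
      have hx0 := hpos x hx.1
      have hy0 := hpos y hy.1
      rw [Finset.mem_union, Finset.mem_union]
      rcases lt_trichotomy x y with hlt | heq | hlt
      · by_cases h1 : y - x ∈ A
        · right
          simp only [E, Finset.mem_filter, Finset.mem_product, mB]
          refine ⟨⟨hx, hy⟩, hlt, h1, fun h2 => ?_⟩
          exact key _ h2 (by omega) (by push_cast; simp)
        · left; right
          refine Finset.mem_image.2 ⟨(y, x), ?_, rfl⟩
          simp only [badPairs, Finset.mem_filter, Finset.mem_product]
          exact ⟨⟨hy.1, hx.1⟩, hlt, h1⟩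
      · exfalso
        exact key N hc le_rfl (by rw [heq]; simp)
      · left; left
        simp only [badPairs, Finset.mem_filter, Finset.mem_product]
        refine ⟨⟨hx.1, hy.1⟩, hlt, fun h2 => ?_⟩
        exact key _ h2 (by omega) (by push_cast; simp)
    have h1 := (Finset.card_le_card hsub).trans (Finset.card_image_le.trans
      ((Finset.card_union_le _ _).trans
      (Nat.add_le_add_right ((Finset.card_union_le _ _).trans
        (Nat.add_le_add_left Finset.card_image_le _)) _)))
    rw [Finset.card_product] at hE
    have h2 : ((B' ×ˢ B').filter fun p => p.1 - p.2 ∉ B').card ≤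
      2 * (badPairs A).card + (defSet A N).card * B.card := by omega
    exact_mod_cast h2
  have hne : B'.Nonempty := ⟨_, Finset.mem_image_of_mem _ ((mB N).2 ⟨hc, le_rfl⟩)⟩
  obtain ⟨H, hH1, hH2⟩ := near_subgroup B' hne η hη hη' hbad
  rw [hcard] at hH1 hH2
  obtain ⟨d0, hd0⟩ := Int.subgroup_cyclic (H.comap (Int.castAddHom (ZMod N)))
  have hmem : ∀ x : ℤ, (x : ZMod N) ∈ H ↔ d0 ∣ x := by
    intro x
    have : (x : ZMod N) ∈ H ↔ x ∈ H.comap (Int.castAddHom (ZMod N)) := Iff.rfl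
    rw [this, hd0, AddSubgroup.mem_closure_singleton]
    constructor
    · rintro ⟨k, hk⟩; exact ⟨k, by rw [← hk]; simp [mul_comm]⟩
    · rintro ⟨k, hk⟩; exact ⟨k, by rw [hk]; simp [mul_comm]⟩
  have hdN : d0 ∣ N := (hmem N).1 (by simp [H.zero_mem])
  have hd0' : d0 ≠ 0 := by
    rintro rfl
    have := zero_dvd_iff.1 hdN
    omega
  obtain ⟨q, hq⟩ : |d0| ∣ (N : ℤ) := (abs_dvd _ _).2 hdN
  have hdpos : 0 < |d0| := abs_pos.2 hd0'
  have hq0 : 0 < q := by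
    by_contra h
    nlinarith
  refine ⟨|d0|, q.toNat, hdpos, by rw [Int.toNat_of_nonneg hq0.le, hq], ?_, ?_⟩
  · let f : ℕ → ZMod N := fun i => ((|d0| * i : ℤ) : ZMod N)
    have hf : Set.InjOn f (Finset.range q.toNat) := by
      intro i hi j hj hij
      have hi : i < q.toNat := Finset.mem_range.1 hi
      have hj : j < q.toNat := Finset.mem_range.1 hj
      have h := (ZMod.intCast_eq_intCast_iff_dvd_sub _ _ N).1 hij
      obtain ⟨k, hk⟩ := h
      rw [hq] at hk
      have h2 : ((j : ℤ) - i) = q * k := by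
        apply mul_left_cancel₀ hdpos.ne'
        linarith
      have : k < 1 := by nlinarith [show (j : ℤ) < q by omega]
      have : -1 < k := by nlinarith [show (i : ℤ) < q by omega]
      have : k = 0 := by omega
      subst this
      omega
    have := hH1 ((Finset.range q.toNat).image f) (by
      intro x hx
      obtain ⟨i, _, rfl⟩ := Finset.mem_image.1 hx
      exact (hmem _).2 (Dvd.dvd.mul_right ((dvd_abs _ _).2 dvd_rfl) _))
    rwa [Finset.card_image_of_injOn hf, Finset.card_range] at this
  · have := hH2 ((B.filter fun a => ¬ |d0| ∣ a).image (fun x : ℤ => (x : ZMod N)))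
      (Finset.image_subset_image (Finset.filter_subset _ _)) (by
        intro x hx
        obtain ⟨i, hi, rfl⟩ := Finset.mem_image.1 hx
        rw [hmem]
        simpa using (Finset.mem_filter.1 hi).2)
    rwa [Finset.card_image_of_injOn (hinj.mono (Finset.coe_subset.2 (Finset.filter_subset _ _)))]
      at this

set_option maxHeartbeats 1000000 in
/-- Structure theorem for sets of positive integers with C(A) close to 1/2. -/
theorem carry_pos (ε : ℝ) (hε : 0 < ε) (hε' : ε < 2 ^ (-20 : ℤ))
    (A : Finset ℤ) (n : ℕ) (hA : A.card = n) (hpos : ∀ a ∈ A, 0 < a)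
    (hn : 2 / Real.sqrt ε ≤ (n : ℝ))
    (hC : (1 - ε) / 2 ≤
      (((A ×ˢ A).filter fun p => p.1 + p.2 ∈ A).card : ℝ) / (n : ℝ) ^ 2) :
    ∃ (P : Finset ℤ) (d : ℤ),
      (∃ x, P = (Finset.range P.card).image fun i : ℕ => x + d * (i : ℤ)) ∧
      (0 : ℤ) ∈ P ∧
      (P.card : ℝ) ≤ (1 + 45 * Real.sqrt ε) * n ∧
      (1 - Real.sqrt ε) * n ≤ ((A ∩ P).card : ℝ) := by
  classical
  set s := Real.sqrt ε with hs
  have hs0 : 0 < s := Real.sqrt_pos.2 hε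
  have hss : s * s = ε := Real.mul_self_sqrt hε.le
  have hs1 : s < 1 / 1024 := by
    by_contra h
    have h := not_lt.1 h
    norm_num at hε'
    nlinarith
  have hsn : 2 ≤ s * n := by
    rw [div_le_iff₀ hs0] at hn
    linarith
  have hn0 : (0 : ℝ) < n := by
    by_contra h
    nlinarith
  set D : ℝ := ((badPairs A).card : ℝ) with hD
  have hDn : 2 * D ≤ s * s * n ^ 2 := by
    have h1 := badPairs_card A hpos
    rw [hA] at h1
    have h2 : 2 * D + 2 * (((A ×ˢ A).filter fun p => p.1 + p.2 ∈ A).card : ℝ) + n = (n : ℝ) ^ 2 := by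
      rw [hD]; exact_mod_cast h1
    rw [le_div_iff₀ (by positivity)] at hC
    rw [hss]
    nlinarith
  have hD0 : 0 ≤ D := by positivity
  -- choice of c
  let Q := A.filter fun x => s * n < (defSet A x).card
  have hQ : (Q.card : ℝ) ≤ s * n / 2 := by
    have h1 : (Q.card : ℝ) * (s * n) ≤ D := by
      rw [hD, ← sum_defSet]
      push_cast
      calc (Q.card : ℝ) * (s * n) = ∑ x ∈ Q, (s * n) := by simp
        _ ≤ ∑ x ∈ Q, ((defSet A x).card : ℝ) :=
          Finset.sum_le_sum fun x hx => (Finset.mem_filter.1 hx).2.le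
        _ ≤ ∑ x ∈ A, ((defSet A x).card : ℝ) :=
          Finset.sum_le_sum_of_subset_of_nonneg (Finset.filter_subset _ _) (by intros; positivity)
    have h2 : (Q.card : ℝ) * (s * n) ≤ (s * n / 2) * (s * n) := by nlinarith
    exact le_of_mul_le_mul_right h2 (by positivity)
  have hne : (A \ Q).Nonempty := by
    rw [Finset.nonempty_iff_ne_empty]
    intro h
    have h1 := Finset.card_le_card (Finset.sdiff_eq_empty_iff_subset.1 h)
    rw [hA] at h1
    have h2 : (n : ℝ) ≤ Q.card := by exact_mod_cast h1
    nlinarith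
  obtain ⟨c, hc, hmax⟩ := Finset.exists_max_image (A \ Q) id hne
  have hcA : c ∈ A := (Finset.mem_sdiff.1 hc).1
  have hcdef : ((defSet A c).card : ℝ) ≤ s * n := by
    by_contra h
    exact (Finset.mem_sdiff.1 hc).2 (Finset.mem_filter.2 ⟨hcA, not_le.1 h⟩)
  set B := A.filter fun a => a ≤ c with hB
  set T := A.filter fun a => ¬ a ≤ c with hT
  have hTQ : T ⊆ Q := by
    intro x hx
    rw [hT, Finset.mem_filter] at hx
    by_contra hxQ
    exact hx.2 (hmax x (Finset.mem_sdiff.2 ⟨hx.1, hxQ⟩))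
  have hTc : (T.card : ℝ) ≤ s * n / 2 :=
    le_trans (by exact_mod_cast Finset.card_le_card hTQ) hQ
  have hBT : (B.card : ℝ) + T.card = n := by
    rw [← hA]; exact_mod_cast Finset.card_filter_add_card_filter_not (s := A) (fun a => a ≤ c)
  set m : ℝ := (B.card : ℝ) with hm
  have hmn : m ≤ n := by
    have : (0 : ℝ) ≤ T.card := by positivity
    linarith
  have hnm : (n : ℝ) * (1 - s / 2) ≤ m := by linarith
  have hnm' : (n : ℝ) ≤ 1.01 * m := by nlinarith
  have hm0 : 0 < m := by linarith
  obtain ⟨d, q, hd, hcq, hq, hK⟩ := exists_step A hpos c hcA (2 * s) (by positivity) (by linarith) (by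
    have e1 : ((defSet A c).card : ℝ) * m ≤ s * n * m := by gcongr
    have e2 : s * n * m ≤ s * (1.01 * m) * m := by gcongr
    have e3 : s * s * (n : ℝ) ^ 2 ≤ s * (1 / 1024) * (1.01 * m) ^ 2 := by gcongr
    have e4 : 0 < s * m * m := by positivity
    nlinarith)
  rw [← hB, ← hm] at hq hK
  set K := A.filter fun a => ¬ d ∣ a with hKdef
  have hKc : (K.card : ℝ) ≤ n / 200 := by
    have hsub : K ⊆ (B.filter fun a => ¬ d ∣ a) ∪ T := by
      intro x hx
      simp only [hKdef, hB, hT, Finset.mem_filter, Finset.mem_union] at hx ⊢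
      tauto
    have h1 : (K.card : ℝ) ≤ (B.filter fun a => ¬ d ∣ a).card + T.card := by
      exact_mod_cast (Finset.card_le_card hsub).trans (Finset.card_union_le _ _)
    nlinarith
  have hK2 : (K.card : ℝ) ≤ s * n / 2 := by
    have h1 := outside_card A d
    have h2 := Finset.card_filter_add_card_filter_not (s := A) (fun a => d ∣ a)
    rw [← hKdef] at h1 h2
    rw [hA] at h2
    have h3 : (K.card : ℝ) * ((A.filter fun a => d ∣ a).card : ℝ) ≤ D + 2 * (K.card : ℝ) ^ 2 := by
      rw [hD]; exact_mod_cast h1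
    have h4 : ((A.filter fun a => d ∣ a).card : ℝ) + K.card = n := by exact_mod_cast h2
    have h5 : ((A.filter fun a => d ∣ a).card : ℝ) = n - K.card := by linarith
    rw [h5] at h3
    set k : ℝ := (K.card : ℝ)
    have hk0 : 0 ≤ k := by positivity
    have h6 : k * k ≤ k * (n / 200) := by gcongr
    have h7 : k * (n * (197 / 200)) ≤ s * s * n ^ 2 / 2 := by linarith
    have h8 : s * s * (n : ℝ) ^ 2 / 2 ≤ (s * n / 4) * (n * (197 / 200)) := by
      have e1 : s * (s * (n : ℝ) ^ 2) ≤ 1 / 1024 * (s * (n : ℝ) ^ 2) := by gcongr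
      have e2 : 0 < s * (n : ℝ) ^ 2 := by positivity
      linarith
    have h9 : k ≤ s * n / 4 := le_of_mul_le_mul_right (h7.trans h8) (by positivity)
    linarith
  have hinj : Function.Injective (fun i : ℕ => (0 : ℤ) + d * (i : ℤ)) := by
    intro i j hij
    simp only [zero_add] at hij
    exact_mod_cast mul_left_cancel₀ hd.ne' hij
  set P := (Finset.range (q + 1)).image (fun i : ℕ => (0 : ℤ) + d * (i : ℤ)) with hP
  have hPc : P.card = q + 1 := by
    rw [hP, Finset.card_image_of_injective _ hinj, Finset.card_range]
  refine ⟨P, d, ⟨0, by rw [hPc]⟩, ?_, ?_, ?_⟩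
  · exact Finset.mem_image.2 ⟨0, by simp, by simp⟩
  · rw [hPc]
    push_cast
    have e1 : (1 - 32 * s) * (q : ℝ) ≤ n := by linarith
    have e2 : (1 - 32 * s) * (q : ℝ) ≤ (1 - 32 * s) * ((1 + 44 * s) * n) := by
      have : 1 ≤ (1 - 32 * s) * (1 + 44 * s) := by nlinarith
      nlinarith
    have e3 := le_of_mul_le_mul_left e2 (by linarith)
    linarith
  · have hsub : A ⊆ (A ∩ P) ∪ K ∪ T := by
      intro x hx
      by_cases h1 : d ∣ x
      · by_cases h2 : x ≤ c
        · refine Finset.mem_union_left _ (Finset.mem_union_left _ (Finset.mem_inter.2 ⟨hx, ?_⟩))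
          obtain ⟨i, rfl⟩ := h1
          have h3 := hpos _ hx
          have hi : 0 < i := by
            by_contra h
            nlinarith
          have hiq : i ≤ q := by
            rw [hcq] at h2
            exact le_of_mul_le_mul_left h2 hd
          refine Finset.mem_image.2 ⟨i.toNat, Finset.mem_range.2 (by omega), ?_⟩
          simp [Int.toNat_of_nonneg hi.le]
        · exact Finset.mem_union_right _ (Finset.mem_filter.2 ⟨hx, h2⟩)
      · exact Finset.mem_union_left _ (Finset.mem_union_right _ (Finset.mem_filter.2 ⟨hx, h1⟩))
    have h1 := (Finset.card_le_card hsub).trans ((Finset.card_union_le _ _).trans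
      (Nat.add_le_add_right (Finset.card_union_le _ _) _))
    rw [hA] at h1
    have h2 : (n : ℝ) ≤ (A ∩ P).card + K.card + T.card := by exact_mod_cast h1
    linarith
end

section
/- Let d₁, d₂, ℓ₁, ℓ₂ be positive integers and let P₁ = {0, d₁, 2d₁, …, (ℓ₁−1)d₁} and P₂ = {−(ℓ₂−1)d₂, …, −2d₂, −d₂, 0}. If d₁ ≠ d₂, then the number of pairs (a₁, a₂) ∈ P₁ × P₂ with a₁ + a₂ ∉ P₁ ∪ P₂ is at least (1/4)·min(ℓ₁², ℓ₂²) − (1/2)(ℓ₁ − ℓ₂)² − ℓ₁ − ℓ₂. -/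
open Finset

open Classical in
lemma fiber_one (d₁ d₂ y i : ℕ) (hd₁ : 0 < d₁) (hd₂ : 0 < d₂) :
    ((range y).filter fun j => ∃ k, i * d₁ = j * d₂ + k * d₁).card ≤ i + 1 := by
  have h : ((range y).filter fun j => ∃ k, i * d₁ = j * d₂ + k * d₁).card
      ≤ (range (i + 1)).card := by
    have key : ∀ j, (∃ k, i * d₁ = j * d₂ + k * d₁) →
        j * d₂ / d₁ < i + 1 ∧ j * d₂ / d₁ * d₁ = j * d₂ := by
      rintro j ⟨k, hk⟩
      have hdvd : d₁ ∣ j * d₂ :=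
        (Nat.dvd_add_left (Dvd.intro_left k rfl)).1 (hk ▸ Dvd.intro_left i rfl)
      refine ⟨?_, Nat.div_mul_cancel hdvd⟩
      have : j * d₂ / d₁ ≤ i := Nat.div_le_of_le_mul (by nlinarith)
      omega
    refine card_le_card_of_injOn (fun j => j * d₂ / d₁) ?_ ?_
    · intro j hj
      have hj := (mem_filter.1 (mem_coe.1 hj)).2
      exact mem_coe.2 (mem_range.2 (key j hj).1)
    · intro j hj j' hj' h
      have h1 := (key j (mem_filter.1 (mem_coe.1 hj)).2).2
      have h2 := (key j' (mem_filter.1 (mem_coe.1 hj')).2).2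
      simp only at h
      rw [h, h2] at h1
      exact (Nat.eq_of_mul_eq_mul_right hd₂ h1).symm
  simpa using h

open Classical in
lemma fiber_two (d₁ d₂ y i : ℕ) (hd₁ : 0 < d₁) (hlt : d₁ < d₂) :
    ((range y).filter fun j => ∃ k, i * d₁ = j * d₂ + k * d₁).card ≤ i / 2 + 1 := by
  have h : ((range y).filter fun j => ∃ k, i * d₁ = j * d₂ + k * d₁).card
      ≤ (range (i / 2 + 1)).card := by
    obtain ⟨g, a, b, hg, hco, ha, hb⟩ := Nat.exists_coprime' (m := d₁) (n := d₂)
      (Nat.gcd_pos_of_pos_left _ hd₁)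
    have ha0 : 0 < a := by
      rcases Nat.eq_zero_or_pos a with h | h
      · subst h; omega
      · exact h
    have hab : a < b := by
      rw [ha, hb] at hlt
      exact Nat.lt_of_mul_lt_mul_right hlt
    have key : ∀ j, (∃ k, i * d₁ = j * d₂ + k * d₁) →
        j / a < i / 2 + 1 ∧ j / a * a = j := by
      rintro j ⟨k, hk⟩
      have hk' : i * a = j * b + k * a := by
        apply Nat.eq_of_mul_eq_mul_right hg
        rw [ha, hb] at hk
        linarith
      have hdvd : a ∣ j * b :=
        (Nat.dvd_add_left (Dvd.intro_left k rfl)).1 (hk' ▸ Dvd.intro_left i rfl)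
      obtain ⟨t, rfl⟩ := hco.dvd_of_dvd_mul_right hdvd
      rw [Nat.mul_div_cancel_left _ ha0]
      refine ⟨?_, by ring⟩
      have h3 : t * b ≤ i := by
        apply Nat.le_of_mul_le_mul_right _ ha0
        nlinarith
      have : t * 2 ≤ t * b := Nat.mul_le_mul_left _ (by omega)
      omega
    refine card_le_card_of_injOn (fun j => j / a) ?_ ?_
    · intro j hj
      have hj := (mem_filter.1 (mem_coe.1 hj)).2
      exact mem_coe.2 (mem_range.2 (key j hj).1)
    · intro j hj j' hj' h
      have h1 := (key j (mem_filter.1 (mem_coe.1 hj)).2).2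
      have h2 := (key j' (mem_filter.1 (mem_coe.1 hj')).2).2
      simp only at h
      rw [h, h2] at h1
      exact h1.symm
  simpa using h

open Classical in
/-- Number of pairs whose sum falls back in the first progression. -/
noncomputable def cnt (d₁ d₂ x y : ℕ) : ℕ :=
  ∑ i ∈ range x, ((range y).filter fun j => ∃ k, i * d₁ = j * d₂ + k * d₁).card

open Classical in
lemma cnt_one (d₁ d₂ x y : ℕ) (hd₁ : 0 < d₁) (hd₂ : 0 < d₂) :
    2 * cnt d₁ d₂ x y ≤ x ^ 2 + x := by
  induction x with
  | zero => simp [cnt]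
  | succ n ih =>
    have := fiber_one d₁ d₂ y n hd₁ hd₂
    unfold cnt at *
    rw [sum_range_succ]
    nlinarith

open Classical in
lemma cnt_two (d₁ d₂ x y : ℕ) (hd₁ : 0 < d₁) (hlt : d₁ < d₂) :
    4 * cnt d₁ d₂ x y ≤ x ^ 2 + 3 * x := by
  induction x with
  | zero => simp [cnt]
  | succ n ih =>
    have := fiber_two d₁ d₂ y n hd₁ hlt
    have h2 : 2 * (n / 2) ≤ n := Nat.mul_div_le n 2
    unfold cnt at *
    rw [sum_range_succ]
    nlinarith

open Classical in
lemma cnt_left (d₁ d₂ x y : ℕ) :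
    ((range x ×ˢ range y).filter fun p : ℕ × ℕ => ∃ k, p.1 * d₁ = p.2 * d₂ + k * d₁).card
      = cnt d₁ d₂ x y := by
  simp only [cnt, card_filter, sum_product]

open Classical in
lemma cnt_right (d₁ d₂ x y : ℕ) :
    ((range x ×ˢ range y).filter fun p : ℕ × ℕ => ∃ k, p.2 * d₂ = p.1 * d₁ + k * d₂).card
      = cnt d₂ d₁ y x := by
  simp only [cnt, card_filter, sum_product_right]

lemma main_count (d₁ d₂ x y : ℕ) (hd₁ : 0 < d₁) (hd₂ : 0 < d₂) (P₁ P₂ : Finset ℤ)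
    (hP₁ : P₁ = (Finset.range x).image fun i : ℕ => (i : ℤ) * d₁)
    (hP₂ : P₂ = (Finset.range y).image fun i : ℕ => -((i : ℤ) * d₂)) :
    x * y ≤ ((P₁ ×ˢ P₂).filter fun p => p.1 + p.2 ∉ P₁ ∪ P₂).card
      + cnt d₁ d₂ x y + cnt d₂ d₁ y x := by
  classical
  have hxy : (range x ×ˢ range y).card = x * y := by simp
  rw [← cnt_left, ← cnt_right d₁ d₂ x y, ← hxy]
  set A := (range x ×ˢ range y).filter fun p : ℕ × ℕ => ∃ k, p.1 * d₁ = p.2 * d₂ + k * d₁ with hA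
  set B := (range x ×ˢ range y).filter fun p : ℕ × ℕ => ∃ k, p.2 * d₂ = p.1 * d₁ + k * d₂ with hB
  have h1 : (range x ×ˢ range y).card ≤ ((range x ×ˢ range y) \ (A ∪ B)).card + (A ∪ B).card := by
    rw [← card_union_of_disjoint sdiff_disjoint]
    apply card_le_card
    intro p hp
    by_cases h : p ∈ A ∪ B
    · exact mem_union_right _ h
    · exact mem_union_left _ (mem_sdiff.2 ⟨hp, h⟩)
  have h2 := card_union_le A B
  have h3 : ((range x ×ˢ range y) \ (A ∪ B)).card
      ≤ ((P₁ ×ˢ P₂).filter fun p => p.1 + p.2 ∉ P₁ ∪ P₂).card := by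
    refine card_le_card_of_injOn
      (fun p : ℕ × ℕ => ((p.1 : ℤ) * d₁, -((p.2 : ℤ) * d₂))) ?_ ?_
    · rintro ⟨i, j⟩ hp
      obtain ⟨hp, hn⟩ := mem_sdiff.1 (mem_coe.1 hp)
      have hij := mem_product.1 hp
      refine mem_coe.2 (mem_filter.2 ⟨mem_product.2 ⟨?_, ?_⟩, ?_⟩)
      · rw [hP₁]; exact mem_image_of_mem (fun i : ℕ => (i : ℤ) * d₁) hij.1
      · rw [hP₂]; exact mem_image_of_mem (fun i : ℕ => -((i : ℤ) * d₂)) hij.2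
      · intro hmem
        apply hn
        rcases mem_union.1 hmem with h | h
        · rw [hP₁] at h
          obtain ⟨k, -, hk⟩ := mem_image.1 h
          refine mem_union_left _ (mem_filter.2 ⟨hp, k, ?_⟩)
          simp only at hk ⊢
          zify
          linarith
        · rw [hP₂] at h
          obtain ⟨k, -, hk⟩ := mem_image.1 h
          refine mem_union_right _ (mem_filter.2 ⟨hp, k, ?_⟩)
          simp only at hk ⊢
          zify
          linarith
    · rintro ⟨i, j⟩ - ⟨i', j'⟩ - h
      simpa [hd₁.ne', hd₂.ne'] using h
  omega

/-- If two APs (one starting at 0, one ending at 0) have distinct common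
differences, then many pairwise sums escape their union. -/
theorem two_APs_different_differences (d₁ d₂ ℓ₁ ℓ₂ : ℕ)
    (hd₁ : 0 < d₁) (hd₂ : 0 < d₂) (hℓ₁ : 0 < ℓ₁) (hℓ₂ : 0 < ℓ₂) (hne : d₁ ≠ d₂)
    (P₁ P₂ : Finset ℤ)
    (hP₁ : P₁ = (Finset.range ℓ₁).image fun i : ℕ => (i : ℤ) * d₁)
    (hP₂ : P₂ = (Finset.range ℓ₂).image fun i : ℕ => -((i : ℤ) * d₂)) :
    (1 : ℝ) / 4 * min ((ℓ₁ : ℝ) ^ 2) ((ℓ₂ : ℝ) ^ 2)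
        - 1 / 2 * ((ℓ₁ : ℝ) - (ℓ₂ : ℝ)) ^ 2 - ℓ₁ - ℓ₂
      ≤ (((P₁ ×ˢ P₂).filter fun p => p.1 + p.2 ∉ P₁ ∪ P₂).card : ℝ) := by
  have h := main_count d₁ d₂ ℓ₁ ℓ₂ hd₁ hd₂ P₁ P₂ hP₁ hP₂
  generalize ((P₁ ×ˢ P₂).filter fun p => p.1 + p.2 ∉ P₁ ∪ P₂).card = N at h ⊢
  have hR : (ℓ₁ : ℝ) * ℓ₂ ≤ N + cnt d₁ d₂ ℓ₁ ℓ₂ + cnt d₂ d₁ ℓ₂ ℓ₁ := by exact_mod_cast h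
  have m1 := min_le_left ((ℓ₁ : ℝ) ^ 2) ((ℓ₂ : ℝ) ^ 2)
  have m2 := min_le_right ((ℓ₁ : ℝ) ^ 2) ((ℓ₂ : ℝ) ^ 2)
  have p1 : (0 : ℝ) ≤ ℓ₁ := Nat.cast_nonneg _
  have p2 : (0 : ℝ) ≤ ℓ₂ := Nat.cast_nonneg _
  rcases lt_or_gt_of_ne hne with hlt | hlt
  · have a1 : 4 * (cnt d₁ d₂ ℓ₁ ℓ₂ : ℝ) ≤ (ℓ₁ : ℝ) ^ 2 + 3 * ℓ₁ := by
      exact_mod_cast cnt_two d₁ d₂ ℓ₁ ℓ₂ hd₁ hlt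
    have a2 : 2 * (cnt d₂ d₁ ℓ₂ ℓ₁ : ℝ) ≤ (ℓ₂ : ℝ) ^ 2 + ℓ₂ := by
      exact_mod_cast cnt_one d₂ d₁ ℓ₂ ℓ₁ hd₂ hd₁
    linarith
  · have a1 : 4 * (cnt d₂ d₁ ℓ₂ ℓ₁ : ℝ) ≤ (ℓ₂ : ℝ) ^ 2 + 3 * ℓ₂ := by
      exact_mod_cast cnt_two d₂ d₁ ℓ₂ ℓ₁ hd₂ hlt
    have a2 : 2 * (cnt d₁ d₂ ℓ₁ ℓ₂ : ℝ) ≤ (ℓ₁ : ℝ) ^ 2 + ℓ₁ := by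
      exact_mod_cast cnt_one d₁ d₂ ℓ₁ ℓ₂ hd₁ hd₂
    linarith
end

section
/- Let A ⊆ ℝ be a measurable set with finite Lebesgue measure λ(A), and let ε ∈ (0, 2^{-100}). Assume that ∫∫ 1_A(y) 1_A(x − y) 1_A(x) dx dy ≥ (1 − ε) · (3/4) λ(A)². Then there exists an interval J ⊆ ℝ centred at the origin such that λ(J) ≤ (1 + 561ε^{1/4}) λ(A) and λ(A ∩ J) ≥ (1 − 21ε^{1/4}) λ(A). -/
open MeasureTheory

lemma circle_lemma (L : ℝ) [hL : Fact (0 < L)] (P : Set (AddCircle L)) (hP : MeasurableSet P)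
    (K : ENNReal)
    (hK : ∫⁻ v in P, volume {u : AddCircle L | u ∈ P ∧ u - v ∉ P} ≤ K)
    (h16 : 16 * K ≤ volume P ^ 2) (hpos : volume P ≠ 0) :
    volume P ^ 2 * ENNReal.ofReal L ≤ volume P ^ 3 + 4 * K * ENNReal.ofReal L := by
  set β := volume P with hβ
  have hβt : β ≠ ⊤ := measure_ne_top _ _
  have hKt : K ≠ ⊤ := by
    intro h
    rw [h] at h16
    have : β ^ 2 ≠ ⊤ := ENNReal.pow_ne_top hβt
    apply this
    rw [ENNReal.mul_top (by norm_num)] at h16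
    exact top_le_iff.mp h16
  let D : AddCircle L → ENNReal := fun h => volume {u : AddCircle L | u ∈ P ∧ u - h ∉ P}
  let R : AddCircle L → ENNReal := fun h => volume {u : AddCircle L | u ∈ P ∧ u - h ∈ P}
  have hSD : MeasurableSet {p : AddCircle L × AddCircle L | p.2 ∈ P ∧ p.2 - p.1 ∉ P} :=
    (measurable_snd hP).inter ((measurable_snd.sub measurable_fst) hP.compl)
  have hSR : MeasurableSet {p : AddCircle L × AddCircle L | p.2 ∈ P ∧ p.2 - p.1 ∈ P} :=
    (measurable_snd hP).inter ((measurable_snd.sub measurable_fst) hP)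
  have hDm : Measurable D := measurable_measure_prodMk_left hSD
  have hRm : Measurable R := measurable_measure_prodMk_left hSR
  have hDset : ∀ h, MeasurableSet {u : AddCircle L | u ∈ P ∧ u - h ∉ P} := fun h =>
    hP.inter ((measurable_id.sub_const h) hP.compl)
  have hRset : ∀ h, MeasurableSet {u : AddCircle L | u ∈ P ∧ u - h ∈ P} := fun h =>
    hP.inter ((measurable_id.sub_const h) hP)
  have hRD : ∀ h, R h + D h = β := by
    intro h
    have := measure_inter_add_sdiff (μ := volume) P ((measurable_id.sub_const h) hP)
    exact this
  have hRneg : ∀ h, R (-h) = R h := by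
    intro h
    have := (measurePreserving_sub_right (volume : Measure (AddCircle L)) h).measure_preimage
      (hRset (-h)).nullMeasurableSet
    show volume {u : AddCircle L | u ∈ P ∧ u - (-h) ∈ P} = _
    rw [← this]
    congr 1
    ext u
    simp [and_comm]
  have hDt : ∀ h, D h ≠ ⊤ := fun h => measure_ne_top _ _
  have hRt : ∀ h, R h ≠ ⊤ := fun h => measure_ne_top _ _
  have hDneg : ∀ h, D (-h) = D h := by
    intro h
    have h1 := hRD h
    have h2 := hRD (-h)
    rw [hRneg, ← h1] at h2
    exact (ENNReal.add_right_inj (hRt h)).mp h2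
  have hDsub : ∀ h k, D (h + k) ≤ D h + D k := by
    intro h k
    have := (measurePreserving_sub_right (volume : Measure (AddCircle L)) h).measure_preimage
      (hDset k).nullMeasurableSet
    show _ ≤ D h + volume {u : AddCircle L | u ∈ P ∧ u - k ∉ P}
    rw [← this]
    refine le_trans (measure_mono ?_) (measure_union_le _ _)
    rintro u ⟨hu, hu2⟩
    by_cases h3 : u - h ∈ P
    · right
      refine ⟨h3, ?_⟩
      rwa [sub_sub]
    · left
      exact ⟨hu, h3⟩
  have hRint : ∫⁻ h, R h = β * β := by
    have e1 := Measure.prod_apply (μ := (volume : Measure (AddCircle L)))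
      (ν := (volume : Measure (AddCircle L))) hSR
    have e2 := Measure.prod_apply_symm (μ := (volume : Measure (AddCircle L)))
      (ν := (volume : Measure (AddCircle L))) hSR
    have e3 : ∫⁻ h, R h = ∫⁻ u, P.indicator (fun _ => β) u := by
      rw [show ∫⁻ h, R h = _ from e1.symm, e2]
      congr 1
      ext u
      by_cases hu : u ∈ P
      · rw [Set.indicator_of_mem hu]
        have := (Measure.measurePreserving_sub_left (volume : Measure (AddCircle L)) u).measure_preimage
          hP.nullMeasurableSet
        rw [hβ, ← this]
        congr 1
        ext x
        simp [hu]
      · rw [Set.indicator_of_notMem hu]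
        convert measure_empty (μ := (volume : Measure (AddCircle L)))
        ext x
        simp [hu]
    rw [e3, lintegral_indicator_const hP]
  have hPD : ∫⁻ h in P, R h + D h = β * β := by
    simp only [hRD]
    rw [setLIntegral_const]
  rw [lintegral_add_left hRm] at hPD
  have hPR : ∫⁻ h in P, R h ≠ ⊤ := by
    intro h
    rw [h] at hPD
    simp at hPD
    exact ENNReal.mul_ne_top hβt hβt hPD.symm
  have hPc : ∫⁻ h in Pᶜ, R h = ∫⁻ h in P, D h := by
    have := lintegral_add_compl R hP (μ := volume)
    rw [hRint, ← hPD] at this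
    exact (ENNReal.add_right_inj hPR).mp this
  have hKD : ∫⁻ h in P, D h ≤ K := hK
  have claim : ∀ h, 2 * D h ≤ β → β * D h ≤ 4 * K := by
    intro h hh
    set Q := {u : AddCircle L | u ∈ P ∧ u - h ∉ P} with hQ
    have hQP : Q ⊆ P := fun u hu => hu.1
    have h1 : ∫⁻ k in Q, R (k - h) ≤ K := by
      refine le_trans ?_ (hPc.trans_le hKD)
      rw [← lintegral_indicator (hDset h), ← lintegral_indicator hP.compl,
        ← lintegral_sub_right_eq_self (Pᶜ.indicator R) h]
      apply lintegral_mono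
      intro k
      show Q.indicator (fun k => R (k - h)) k ≤ Pᶜ.indicator R (k - h)
      by_cases hk : k ∈ Q
      · have : k - h ∈ Pᶜ := hk.2
        simp only [Set.indicator_of_mem hk, Set.indicator_of_mem this]
        exact le_rfl
      · simp only [Set.indicator_of_notMem hk]
        exact zero_le
    have h2 : ∫⁻ k in Q, D k ≤ K := (lintegral_mono_set hQP).trans hKD
    have h3 : β * D h ≤ K + K + D h * D h := by
      calc β * D h = ∫⁻ k in Q, β := by rw [setLIntegral_const]
        _ ≤ ∫⁻ k in Q, (R (k - h) + D k) + D h := by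
          apply lintegral_mono
          intro k
          show β ≤ (R (k - h) + D k) + D h
          rw [← hRD (k - h), add_assoc]
          gcongr
          rw [sub_eq_add_neg, ← hDneg h]
          exact hDsub _ _
        _ = (∫⁻ k in Q, R (k - h)) + (∫⁻ k in Q, D k) + D h * D h := by
          rw [lintegral_add_right _ measurable_const,
            lintegral_add_right _ hDm, setLIntegral_const]
        _ ≤ _ := by gcongr
    have h4 : β * D h + β * D h ≤ 4 * K + β * D h := by
      calc β * D h + β * D h = 2 * (β * D h) := by ring
        _ ≤ 2 * (K + K + D h * D h) := by gcongr
        _ = 4 * K + (2 * D h) * D h := by ring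
        _ ≤ _ := by gcongr
    exact ENNReal.le_of_add_le_add_right (ENNReal.mul_ne_top hβt (hDt h)) h4
  let N : AddSubgroup (AddCircle L) :=
    { carrier := {h | 2 * D h ≤ β}
      zero_mem' := by
        show 2 * D 0 ≤ β
        have : D 0 = 0 := by
          show volume {u : AddCircle L | u ∈ P ∧ u - 0 ∉ P} = 0
          convert measure_empty (μ := (volume : Measure (AddCircle L)))
          ext x
          simp
        rw [this]; simp
      neg_mem' := by
        intro h hh
        show 2 * D (-h) ≤ β
        rw [hDneg]; exact hh
      add_mem' := by
        intro h k hh hk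
        show 2 * D (h + k) ≤ β
        have e1 := claim h hh
        have e2 := claim k hk
        have : β * (2 * D (h + k)) ≤ β * β := by
          calc β * (2 * D (h + k)) ≤ β * (2 * (D h + D k)) := by gcongr; exact hDsub _ _
            _ = 2 * (β * D h + β * D k) := by ring
            _ ≤ 2 * (4 * K + 4 * K) := by gcongr
            _ = 16 * K := by ring
            _ ≤ β ^ 2 := h16
            _ = β * β := by ring
        exact (ENNReal.mul_le_mul_iff_right hpos hβt).mp this }
  have hNn : (N : Set (AddCircle L)) ∈ nhds (0 : AddCircle L) := by
    let f : AddCircle L → C(AddCircle L, AddCircle L) := fun h =>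
      ⟨fun u => u - h, by fun_prop⟩
    have hfc : Continuous f := by
      apply ContinuousMap.continuous_of_continuous_uncurry
      show Continuous (fun p : AddCircle L × AddCircle L => p.2 - p.1)
      fun_prop
    have hmp : ∀ h, MeasurePreserving (f h) volume volume := fun h =>
      measurePreserving_sub_right volume h
    have := tendsto_measure_symmDiff_preimage_nhds_zero (s := P) (hfc.tendsto 0)
      (Filter.Eventually.of_forall hmp) (hmp 0) hP.nullMeasurableSet hβt
    have h2 := this.eventually_lt_const (u := β / 2) (by simpa [pos_iff_ne_zero] using hpos)
    filter_upwards [h2] with h hh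
    show 2 * D h ≤ β
    have h3 : D h ≤ β / 2 := by
      refine le_trans (measure_mono ?_) hh.le
      rintro u ⟨hu, hu2⟩
      right
      refine ⟨?_, hu2⟩
      show u - 0 ∈ P
      simpa using hu
    calc 2 * D h ≤ 2 * (β / 2) := by gcongr
      _ = β := ENNReal.mul_div_cancel (by norm_num) (by norm_num)
  have hNo : IsOpen (N : Set (AddCircle L)) := N.isOpen_of_mem_nhds hNn
  have hNc : IsClosed (N : Set (AddCircle L)) := N.isClosed_of_isOpen hNo
  have hcs : PreconnectedSpace (AddCircle L) := by
    have : Function.Surjective ((↑) : ℝ → AddCircle L) := QuotientAddGroup.mk_surjective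
    refine ⟨?_⟩
    rw [← this.range_eq]
    exact isPreconnected_range (AddCircle.continuous_mk' L)
  have hNu : (N : Set (AddCircle L)) = Set.univ := by
    refine IsClopen.eq_univ ⟨hNc, hNo⟩ ⟨0, N.zero_mem⟩
  have hall : ∀ h, β * D h ≤ 4 * K := by
    intro h
    apply claim
    have : h ∈ (N : Set (AddCircle L)) := by rw [hNu]; trivial
    exact this
  have hu : (volume : Measure (AddCircle L)) Set.univ = ENNReal.ofReal L := AddCircle.measure_univ L
  have h5 : β * ENNReal.ofReal L = β * β + ∫⁻ h, D h := by
    rw [← hRint, ← lintegral_add_left hRm]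
    simp only [hRD]
    rw [lintegral_const, hu]
  have h6 : β * ∫⁻ h, D h ≤ 4 * K * ENNReal.ofReal L := by
    rw [← lintegral_const_mul _ hDm, ← hu, ← lintegral_const]
    exact lintegral_mono hall
  calc β ^ 2 * ENNReal.ofReal L = β * (β * ENNReal.ofReal L) := by ring
    _ = β ^ 3 + β * ∫⁻ h, D h := by rw [h5]; ring
    _ ≤ _ := by gcongr

lemma quantile_exists (B : Set ℝ) (hB : MeasurableSet B) (hBt : volume B ≠ ⊤) (c : ℝ)
    (hc : 0 < c) (hc' : c < (volume B).toReal) :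
    ∃ s : ℝ, (volume (B ∩ Set.Iic s)).toReal = c := by
  have hfin : ∀ S : Set ℝ, volume (B ∩ S) ≠ ⊤ := fun S =>
    ne_top_of_le_ne_top hBt (measure_mono Set.inter_subset_left)
  have hlip : LipschitzWith 1 (fun s : ℝ => (volume (B ∩ Set.Iic s)).toReal) := by
    apply LipschitzWith.of_le_add
    intro x y
    have h1 : volume (B ∩ Set.Iic x) ≤ volume (B ∩ Set.Iic y) + ENNReal.ofReal (dist x y) := by
      calc volume (B ∩ Set.Iic x) ≤ volume ((B ∩ Set.Iic y) ∪ Set.Ioc y x) := by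
            apply measure_mono
            rintro u ⟨hu, hu2⟩
            by_cases h : u ≤ y
            · left; exact ⟨hu, h⟩
            · right; exact ⟨not_le.mp h, hu2⟩
        _ ≤ volume (B ∩ Set.Iic y) + volume (Set.Ioc y x) := measure_union_le _ _
        _ ≤ _ := by
            rw [Real.volume_Ioc]
            gcongr
            rw [Real.dist_eq]
            exact le_abs_self _
    have h2 := ENNReal.toReal_mono (by simp [hfin]) h1
    rwa [ENNReal.toReal_add (hfin _) ENNReal.ofReal_ne_top, ENNReal.toReal_ofReal dist_nonneg] at h2
  have hcont := hlip.continuous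
  have htop : ∃ s, c ≤ (volume (B ∩ Set.Iic s)).toReal := by
    have h1 := tendsto_measure_Iic_atTop (volume.restrict B)
    rw [Measure.restrict_apply_univ] at h1
    have h2 := ((ENNReal.tendsto_toReal hBt).comp h1).eventually_const_lt hc'
    obtain ⟨s, hs⟩ := h2.exists
    refine ⟨s, ?_⟩
    simp only [Function.comp, Measure.restrict_apply measurableSet_Iic] at hs
    rw [Set.inter_comm]
    exact hs.le
  have hbot : ∃ s, (volume (B ∩ Set.Iic s)).toReal ≤ c := by
    have h1 := tendsto_measure_Ici_atBot (volume.restrict B)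
    rw [Measure.restrict_apply_univ] at h1
    have h2 := ((ENNReal.tendsto_toReal hBt).comp h1).eventually_const_lt
      (u := (volume B).toReal - c) (by linarith)
    obtain ⟨s, hs⟩ := h2.exists
    refine ⟨s - 1, ?_⟩
    simp only [Function.comp, Measure.restrict_apply measurableSet_Ici] at hs
    rw [Set.inter_comm] at hs
    have h3 : volume (B ∩ Set.Iic (s - 1)) + volume (B ∩ Set.Ici s) ≤ volume B := by
      rw [← measure_union _ (hB.inter measurableSet_Ici)]
      · apply measure_mono
        rintro u (h | h) <;> exact h.1
      · rw [Set.disjoint_left]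
        rintro u ⟨_, h⟩ ⟨_, h'⟩
        simp only [Set.mem_Iic, Set.mem_Ici] at h h'
        linarith
    have h4 := ENNReal.toReal_mono hBt h3
    rw [ENNReal.toReal_add (hfin _) (hfin _)] at h4
    linarith
  obtain ⟨s, hs⟩ := mem_range_of_exists_le_of_exists_ge hcont hbot htop
  exact ⟨s, hs⟩

/-- Swapping the order of integration for the pairs in `B × B` with difference outside `A`. -/
lemma swap_pairs (A B : Set ℝ) (hA : MeasurableSet A) (hB : MeasurableSet B) :
    ∫⁻ y in B, volume {x : ℝ | x ∈ B ∧ x - y ∉ A} =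
      ∫⁻ x in B, volume {y : ℝ | y ∈ B ∧ x - y ∉ A} := by
  have hS : MeasurableSet {p : ℝ × ℝ | (p.1 ∈ B ∧ p.2 ∈ B) ∧ p.1 - p.2 ∉ A} :=
    ((measurable_fst hB).inter (measurable_snd hB)).inter
      ((measurable_fst.sub measurable_snd) hA.compl)
  have e1 := Measure.prod_apply (μ := (volume : Measure ℝ)) (ν := (volume : Measure ℝ)) hS
  have e2 := Measure.prod_apply_symm (μ := (volume : Measure ℝ)) (ν := (volume : Measure ℝ)) hS
  rw [← lintegral_indicator hB, ← lintegral_indicator hB]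
  have f1 : ∀ x, B.indicator (fun x => volume {y : ℝ | y ∈ B ∧ x - y ∉ A}) x =
      volume (Prod.mk x ⁻¹' {p : ℝ × ℝ | (p.1 ∈ B ∧ p.2 ∈ B) ∧ p.1 - p.2 ∉ A}) := by
    intro x
    by_cases hx : x ∈ B <;> simp [hx]
  have f2 : ∀ y, B.indicator (fun y => volume {x : ℝ | x ∈ B ∧ x - y ∉ A}) y =
      volume ((fun x => (x, y)) ⁻¹' {p : ℝ × ℝ | (p.1 ∈ B ∧ p.2 ∈ B) ∧ p.1 - p.2 ∉ A}) := by
    intro x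
    by_cases hx : x ∈ B <;> simp [hx]
  simp only [f1, f2]
  rw [← e1, ← e2]

/-- The deficit estimate: `m` is a median of `A`. -/
lemma deficit (A : Set ℝ) (hA : MeasurableSet A) (m : ℝ) (b : ENNReal)
    (h1 : volume (A ∩ Set.Iic m) = b) (h2 : volume (A ∩ Set.Ioi m) = b) :
    (∫⁻ x in A, volume {y : ℝ | y ∈ A ∧ x - y ∈ A}) +
      ((∫⁻ x in A ∩ Set.Iic (2 * m), volume {y : ℝ | y ∈ A ∩ Set.Iic m ∧ x - y ∉ A}) +
      (∫⁻ x in A ∩ Set.Ioi (2 * m), volume {y : ℝ | y ∈ A ∩ Set.Ioi m ∧ x - y ∉ A})) ≤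
      3 * b ^ 2 := by
  set Am := A ∩ Set.Iic m with hAm
  set Ap := A ∩ Set.Ioi m with hAp
  have mAm : MeasurableSet Am := hA.inter measurableSet_Iic
  have mAp : MeasurableSet Ap := hA.inter measurableSet_Ioi
  have mset : ∀ (S T : Set ℝ) (x : ℝ), MeasurableSet S → MeasurableSet T →
      MeasurableSet {y : ℝ | y ∈ S ∧ x - y ∈ T} := fun S T x hS hT =>
    hS.inter ((measurable_id.const_sub x) hT)
  have mfun : ∀ (S T : Set ℝ), MeasurableSet S → MeasurableSet T →
      Measurable (fun x : ℝ => volume {y : ℝ | y ∈ S ∧ x - y ∈ T}) := fun S T hS hT =>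
    measurable_measure_prodMk_left
      (s := {p : ℝ × ℝ | p.2 ∈ S ∧ p.1 - p.2 ∈ T})
      ((measurable_snd hS).inter ((measurable_fst.sub measurable_snd) hT))
  let H : ℝ → ENNReal := fun x => volume {y : ℝ | y ∈ Ap ∧ x - y ∈ Am}
  have hH : ∀ x, volume {y : ℝ | y ∈ Am ∧ x - y ∈ Ap} = H x := by
    intro x
    have := (Measure.measurePreserving_sub_left (volume : Measure ℝ) x).measure_preimage
      (mset Ap Am x mAp mAm).nullMeasurableSet
    show _ = volume {y : ℝ | y ∈ Ap ∧ x - y ∈ Am}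
    rw [← this]
    congr 1
    ext y
    simp [and_comm]
  have hHint : ∫⁻ x, H x = b * b := by
    have hS : MeasurableSet {p : ℝ × ℝ | p.2 ∈ Ap ∧ p.1 - p.2 ∈ Am} :=
      (measurable_snd mAp).inter ((measurable_fst.sub measurable_snd) mAm)
    have e1 := Measure.prod_apply (μ := (volume : Measure ℝ)) (ν := (volume : Measure ℝ)) hS
    have e2 := Measure.prod_apply_symm (μ := (volume : Measure ℝ)) (ν := (volume : Measure ℝ)) hS
    rw [show ∫⁻ h, H h = _ from e1.symm, e2]
    have : ∀ y, volume ((fun x => (x, y)) ⁻¹' {p : ℝ × ℝ | p.2 ∈ Ap ∧ p.1 - p.2 ∈ Am}) =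
        Ap.indicator (fun _ => b) y := by
      intro y
      by_cases hy : y ∈ Ap
      · rw [Set.indicator_of_mem hy]
        have := (measurePreserving_sub_right (volume : Measure ℝ) y).measure_preimage
          mAm.nullMeasurableSet
        rw [← h1, ← this]
        congr 1
        ext x
        simp [hy]
      · simp [hy]
    simp only [this]
    rw [lintegral_indicator_const mAp, h2]
  have hsplit : ∀ x, volume {y : ℝ | y ∈ A ∧ x - y ∈ A} =
      volume {y : ℝ | y ∈ Am ∧ x - y ∈ A} + volume {y : ℝ | y ∈ Ap ∧ x - y ∈ A} := by
    intro x
    rw [← measure_inter_add_sdiff {y : ℝ | y ∈ A ∧ x - y ∈ A} (measurableSet_Iic (a := m))]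
    congr 2
    · ext y; simp [hAm]; tauto
    · ext y; simp [hAp]; tauto
  have hcomp : ∀ (S : Set ℝ) (x : ℝ), MeasurableSet S → volume {y : ℝ | y ∈ S ∧ x - y ∈ A} +
      volume {y : ℝ | y ∈ S ∧ x - y ∉ A} = volume S := by
    intro S x hS
    exact measure_inter_add_sdiff S ((measurable_id.const_sub x) hA)
  have mf := mfun A A hA hA
  have hAu : volume A = b + b := by
    rw [← measure_inter_add_sdiff A (measurableSet_Iic (a := m))]
    congr 1
    rw [← h2]
    congr 1
    ext y; simp [hAp]
  have hL : ∀ x ∈ A ∩ Set.Iic (2 * m), volume {y : ℝ | y ∈ A ∧ x - y ∈ A} +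
      volume {y : ℝ | y ∈ Am ∧ x - y ∉ A} ≤ b + H x := by
    rintro x ⟨_, hx⟩
    rw [hsplit, add_right_comm, hcomp Am x mAm, h1]
    gcongr
    apply measure_mono
    rintro y ⟨hy, hy2⟩
    refine ⟨hy, hy2, ?_⟩
    have := hy.2
    simp only [Set.mem_Iic, Set.mem_Ioi] at *
    linarith
  have hR : ∀ x ∈ A ∩ Set.Ioi (2 * m), volume {y : ℝ | y ∈ A ∧ x - y ∈ A} +
      volume {y : ℝ | y ∈ Ap ∧ x - y ∉ A} ≤ b + H x := by
    rintro x ⟨_, hx⟩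
    rw [hsplit, add_assoc, hcomp Ap x mAp, h2, add_comm]
    gcongr
    rw [← hH]
    apply measure_mono
    rintro y ⟨hy, hy2⟩
    refine ⟨hy, hy2, ?_⟩
    have := hy.2
    simp only [Set.mem_Iic, Set.mem_Ioi] at *
    linarith
  have hsp : ∀ g : ℝ → ENNReal, ∫⁻ x in A, g x = (∫⁻ x in A ∩ Set.Iic (2 * m), g x) +
      ∫⁻ x in A ∩ Set.Ioi (2 * m), g x := by
    intro g
    rw [← lintegral_inter_add_sdiff g A (measurableSet_Iic (a := 2 * m))]
    congr 3
    ext y; simp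
  rw [hsp, add_add_add_comm, ← lintegral_add_left mf, ← lintegral_add_left mf]
  calc _ ≤ (∫⁻ x in A ∩ Set.Iic (2 * m), b + H x) + ∫⁻ x in A ∩ Set.Ioi (2 * m), b + H x := by
        gcongr ?_ + ?_
        · exact setLIntegral_mono' (hA.inter measurableSet_Iic) hL
        · exact setLIntegral_mono' (hA.inter measurableSet_Ioi) hR
    _ = ∫⁻ x in A, b + H x := (hsp _).symm
    _ = b * volume A + ∫⁻ x in A, H x := by
        rw [lintegral_add_left measurable_const, setLIntegral_const]
    _ ≤ b * (b + b) + b * b := by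
        rw [hAu, ← hHint]
        gcongr
        exact Measure.restrict_le_self
    _ = 3 * b ^ 2 := by ring

lemma line_lemma (A B : Set ℝ) (hA : MeasurableSet A) (hB : MeasurableSet B) (b σ : ℝ)
    (hb : 0 < b) (hσ : 0 < σ) (hσ' : σ ≤ 1 / 1000)
    (hvB : volume B = ENNReal.ofReal b) (hvA : volume A = ENNReal.ofReal (2 * b))
    (h : ∫⁻ y in B, volume {x : ℝ | x ∈ B ∧ x - y ∉ A} ≤ ENNReal.ofReal (3 * σ ^ 2 * b ^ 2)) :
    ∃ L : ℝ, 0 < L ∧ 2 * b - 10 * σ * b ≤ (volume (A ∩ Set.Icc (-L) L)).toReal ∧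
      (1 - 48 * σ) * L ≤ b := by
  have hBt : volume B ≠ ⊤ := by rw [hvB]; exact ENNReal.ofReal_ne_top
  have hAt : volume A ≠ ⊤ := by rw [hvA]; exact ENNReal.ofReal_ne_top
  have hvBr : (volume B).toReal = b := by rw [hvB, ENNReal.toReal_ofReal hb.le]
  have hvAr : (volume A).toReal = 2 * b := by rw [hvA, ENNReal.toReal_ofReal (by linarith)]
  have hσb : 0 < σ * b := mul_pos hσ hb
  have hσb' : σ * b ≤ b / 1000 := by nlinarith
  have hBfin : ∀ S : Set ℝ, volume (B ∩ S) ≠ ⊤ := fun S =>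
    ne_top_of_le_ne_top hBt (measure_mono Set.inter_subset_left)
  let N : ℝ → ENNReal := fun y => volume {x : ℝ | x ∈ B ∧ x - y ∉ A}
  have hNm : Measurable N := measurable_measure_prodMk_left
      (s := {p : ℝ × ℝ | p.2 ∈ B ∧ p.2 - p.1 ∉ A})
      ((measurable_snd hB).inter ((measurable_snd.sub measurable_fst) hA.compl))
  have hN : ∫⁻ y in B, N y ≤ ENNReal.ofReal (3 * σ ^ 2 * b ^ 2) := h
  -- choice of a good point in a part of measure `σ b`
  have hgood : ∀ S : Set ℝ, MeasurableSet S → (volume (B ∩ S)).toReal = σ * b →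
      ∃ y ∈ B ∩ S, N y ≤ ENNReal.ofReal (3 * σ * b) := by
    intro S hS hv
    have hv' : volume (B ∩ S) = ENNReal.ofReal (σ * b) := by
      rw [← hv, ENNReal.ofReal_toReal (hBfin _)]
    obtain ⟨y, hy, hy2⟩ := exists_le_setLAverage (μ := volume) (s := B ∩ S) (f := N)
      (by rw [hv']; simpa using hσb) (hBfin _) hNm.aemeasurable
    refine ⟨y, hy, hy2.trans ?_⟩
    rw [setLAverage_eq, hv']
    apply ENNReal.div_le_of_le_mul
    rw [← ENNReal.ofReal_mul (by positivity)]
    refine (lintegral_mono_set Set.inter_subset_left).trans (hN.trans_eq ?_)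
    congr 1
    ring
  obtain ⟨s0, hs0⟩ := quantile_exists B hB hBt (σ * b) hσb (by rw [hvBr]; linarith)
  obtain ⟨s1, hs1⟩ := quantile_exists B hB hBt (b - σ * b) (by linarith) (by rw [hvBr]; linarith)
  have hs1' : (volume (B ∩ Set.Ioi s1)).toReal = σ * b := by
    have := measure_inter_add_sdiff (μ := volume) B (measurableSet_Iic (a := s1))
    rw [show B \ Set.Iic s1 = B ∩ Set.Ioi s1 by ext; simp] at this
    have h2 := congrArg ENNReal.toReal this
    rw [ENNReal.toReal_add (hBfin _) (hBfin _)] at h2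
    linarith
  obtain ⟨y0, hy0, hN0⟩ := hgood _ measurableSet_Iic hs0
  obtain ⟨y1, hy1, hN1⟩ := hgood _ measurableSet_Ioi hs1'
  have hs01 : s0 < s1 := by
    by_contra hcon
    have := ENNReal.toReal_mono (hBfin (Set.Iic s0))
      (measure_mono (μ := volume) (Set.inter_subset_inter_right B
        (Set.Iic_subset_Iic.mpr (not_lt.mp hcon))))
    rw [hs0, hs1] at this
    linarith
  have hy0' : y0 ≤ s0 := hy0.2
  have hy1' : s1 < y1 := hy1.2
  have hL : 0 < y1 - y0 := by linarith
  set L := y1 - y0 with hLdef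
  set B' := B ∩ Set.Ioc y0 y1 with hB'
  have mB' : MeasurableSet B' := hB.inter measurableSet_Ioc
  have hβt : volume B' ≠ ⊤ := hBfin _
  set β := (volume B').toReal with hβ
  have hβb : β ≤ b := by
    rw [← hvBr]
    exact ENNReal.toReal_mono hBt (measure_mono Set.inter_subset_left)
  have hβl : b - 2 * (σ * b) ≤ β := by
    have h1 : volume B ≤ volume B' + (volume (B ∩ Set.Iic s0) + volume (B ∩ Set.Ioi s1)) := by
      refine le_trans (measure_mono ?_) ((measure_union_le _ _).trans
        (add_le_add le_rfl (measure_union_le _ _)))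
      intro u hu
      by_cases h1 : u ≤ s0
      · right; left; exact ⟨hu, h1⟩
      by_cases h2 : s1 < u
      · right; right; exact ⟨hu, h2⟩
      left
      exact ⟨hu, by linarith, by linarith⟩
    have h2 := ENNReal.toReal_mono (by simp [hβt, hBfin]) h1
    rw [ENNReal.toReal_add hβt (by simp [hBfin]), ENNReal.toReal_add (hBfin _) (hBfin _), hs0,
      hs1', hvBr] at h2
    linarith
  have hvB' : volume B' = ENNReal.ofReal β := (ENNReal.ofReal_toReal hβt).symm
  let V : ℝ → Set ℝ := fun y => {u | u + y ∈ B'}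
  have mV : ∀ y, MeasurableSet (V y) := fun y => (measurable_id.add_const y) mB'
  have hvV : ∀ y, volume (V y) = volume B' := fun y =>
    (measurePreserving_add_right (volume : Measure ℝ) y).measure_preimage mB'.nullMeasurableSet
  have hVA : ∀ y, volume (V y \ A) ≤ N y := by
    intro y
    have e := (measurePreserving_add_right (volume : Measure ℝ) y).measure_preimage
      (s := {x : ℝ | x ∈ B ∧ x - y ∉ A})
      (hB.inter ((measurable_id.sub_const y) hA.compl)).nullMeasurableSet
    show _ ≤ volume {x : ℝ | x ∈ B ∧ x - y ∉ A}
    rw [← e]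
    apply measure_mono
    rintro u ⟨hu, hu2⟩
    exact ⟨hu.1, by simpa using hu2⟩
  have hV0 : V y0 ⊆ Set.Ioc 0 L := by
    rintro u ⟨_, hu⟩
    simp only [Set.mem_Ioc] at *
    constructor <;> linarith [hu.1, hu.2]
  have hV1 : V y1 ⊆ Set.Ioc (-L) 0 := by
    rintro u ⟨_, hu⟩
    simp only [Set.mem_Ioc] at *
    constructor <;> linarith [hu.1, hu.2]
  set U := V y0 ∪ V y1 with hU
  have mU : MeasurableSet U := (mV y0).union (mV y1)
  have hdis : Disjoint (V y0) (V y1) := by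
    rw [Set.disjoint_left]
    intro u h1 h2
    have := (hV0 h1).1
    have := (hV1 h2).2
    linarith
  have hvU : volume U = ENNReal.ofReal (2 * β) := by
    rw [hU, measure_union hdis (mV y1), hvV, hvV, hvB', two_mul,
      ENNReal.ofReal_add ENNReal.toReal_nonneg ENNReal.toReal_nonneg]
  have hUA : volume (U \ A) ≤ ENNReal.ofReal (6 * σ * b) := by
    rw [hU, Set.union_sdiff_distrib]
    refine (measure_union_le _ _).trans ((add_le_add ((hVA y0).trans hN0)
      ((hVA y1).trans hN1)).trans_eq ?_)
    rw [← ENNReal.ofReal_add (by positivity) (by positivity)]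
    congr 1
    ring
  have hAfin : ∀ S : Set ℝ, volume (A ∩ S) ≠ ⊤ := fun S =>
    ne_top_of_le_ne_top hAt (measure_mono Set.inter_subset_left)
  have hAU : 2 * b - 10 * σ * b ≤ (volume (A ∩ U)).toReal := by
    have h1 := measure_inter_add_sdiff (μ := volume) U hA
    rw [Set.inter_comm, hvU] at h1
    have h2 : ENNReal.ofReal (2 * β) ≤ volume (A ∩ U) + ENNReal.ofReal (6 * σ * b) := by
      rw [← h1]; gcongr
    have h3 := ENNReal.toReal_mono (by simp [hAfin]) h2
    rw [ENNReal.toReal_add (hAfin _) ENNReal.ofReal_ne_top, ENNReal.toReal_ofReal (by positivity),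
      ENNReal.toReal_ofReal (by positivity)] at h3
    linarith
  have hAU' : volume (A \ U) ≤ ENNReal.ofReal (10 * σ * b) := by
    have h1 := measure_inter_add_sdiff (μ := volume) A mU
    have hf : volume (A \ U) ≠ ⊤ := ne_top_of_le_ne_top hAt (measure_mono Set.sdiff_subset)
    have h2 := congrArg ENNReal.toReal h1
    rw [ENNReal.toReal_add (hAfin _) hf, hvAr] at h2
    rw [← ENNReal.ofReal_toReal hf]
    apply ENNReal.ofReal_le_ofReal
    linarith
  refine ⟨L, hL, hAU.trans (ENNReal.toReal_mono (hAfin _) (measure_mono ?_)), ?_⟩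
  · rintro u ⟨hu, hu2⟩
    refine ⟨hu, ?_⟩
    rcases hu2 with h1 | h1
    · have := hV0 h1
      exact ⟨by linarith [this.1], this.2⟩
    · have := hV1 h1
      exact ⟨this.1.le, by linarith [this.2]⟩
  -- the circle part
  have : Fact (0 < L) := ⟨hL⟩
  let P : Set (AddCircle L) := {z | ((AddCircle.measurableEquivIoc L 0 z : Set.Ioc (0:ℝ) (0 + L)) : ℝ) ∈ V y0}
  have mP : MeasurableSet P :=
    (measurable_subtype_coe.comp (AddCircle.measurableEquivIoc L 0).measurable) (mV y0)
  have hPmem : ∀ x : ℝ, x ∈ Set.Ioc (0 : ℝ) (0 + L) → ((x : AddCircle L) ∈ P ↔ x ∈ V y0) := by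
    intro x hx
    have : AddCircle.measurableEquivIoc L 0 (x : AddCircle L) = ⟨x, hx⟩ :=
      AddCircle.equivIoc_coe_eq hx
    show ((AddCircle.measurableEquivIoc L 0 (x : AddCircle L) : Set.Ioc (0:ℝ) (0 + L)) : ℝ) ∈ V y0 ↔ _
    rw [this]
  have hPU : ∀ u ∈ U, ((u : ℝ) : AddCircle L) ∈ P := by
    rintro u (hu | hu)
    · exact (hPmem u (by simpa using hV0 hu)).mpr hu
    · have h1 : u + L ∈ V y0 := by
        have h2 : u + y1 ∈ B' := hu
        show u + L + y0 ∈ B'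
        rw [hLdef]
        convert h2 using 1
        ring
      have h2 := (hPmem (u + L) (by simpa using hV0 h1)).mpr h1
      simpa using h2
  have hpre : ((↑) : ℝ → AddCircle L) ⁻¹' P ∩ Set.Ioc (0 : ℝ) (0 + L) = V y0 := by
    ext x
    constructor
    · rintro ⟨h1, h2⟩
      exact (hPmem x h2).mp h1
    · intro hx
      have : x ∈ Set.Ioc (0 : ℝ) (0 + L) := by simpa using hV0 hx
      exact ⟨(hPmem x this).mpr hx, this⟩
  have hmp := AddCircle.measurePreserving_mk L 0
  have hvP : volume P = ENNReal.ofReal β := by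
    rw [AddCircle.add_projection_respects_measure L 0 mP, ← hvB', ← hvV y0, ← hpre]
  have hDm : Measurable (fun v : AddCircle L => volume {u : AddCircle L | u ∈ P ∧ u - v ∉ P}) :=
    measurable_measure_prodMk_left
      (s := {p : AddCircle L × AddCircle L | p.2 ∈ P ∧ p.2 - p.1 ∉ P})
      ((measurable_snd mP).inter ((measurable_snd.sub measurable_fst) mP.compl))
  have hDle : ∀ v : ℝ, volume {u : AddCircle L | u ∈ P ∧ u - (v : AddCircle L) ∉ P} ≤
      N (v + y0) + ENNReal.ofReal (10 * σ * b) := by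
    intro v
    have mS : MeasurableSet {u : AddCircle L | u ∈ P ∧ u - (v : AddCircle L) ∉ P} :=
      mP.inter ((measurable_id.sub_const _) mP.compl)
    rw [AddCircle.add_projection_respects_measure L 0 mS]
    have e := (measurePreserving_add_right (volume : Measure ℝ) y0).measure_preimage
      (s := {x : ℝ | x ∈ B ∧ x - (v + y0) ∉ A})
      (hB.inter ((measurable_id.sub_const _) hA.compl)).nullMeasurableSet
    have e2 := (measurePreserving_sub_right (volume : Measure ℝ) v).measure_preimage
      (hA.diff mU).nullMeasurableSet
    show _ ≤ volume {x : ℝ | x ∈ B ∧ x - (v + y0) ∉ A} + _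
    rw [← e]
    refine le_trans (le_trans (measure_mono ?_) (measure_union_le _ _))
      (add_le_add le_rfl (e2.trans_le hAU'))
    rintro x ⟨⟨hx1, hx2⟩, hx3⟩
    have hxV : x ∈ V y0 := (hPmem x hx3).mp hx1
    have hxU : x - v ∉ U := by
      intro hcon
      apply hx2
      have := hPU _ hcon
      simpa using this
    by_cases hxA : x - v ∈ A
    · right; exact ⟨hxA, hxU⟩
    · left
      refine ⟨hxV.1, ?_⟩
      simpa using hxA
  have hK : ∫⁻ v in P, volume {u : AddCircle L | u ∈ P ∧ u - v ∉ P} ≤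
      ENNReal.ofReal (11 * σ * b ^ 2) := by
    rw [← hmp.setLIntegral_comp_preimage mP hDm,
      Measure.restrict_restrict (hmp.measurable mP), hpre]
    calc _ ≤ ∫⁻ v in V y0, N (v + y0) + ENNReal.ofReal (10 * σ * b) :=
          lintegral_mono hDle
      _ = (∫⁻ v in V y0, N (v + y0)) + ENNReal.ofReal (10 * σ * b) * ENNReal.ofReal β := by
          rw [lintegral_add_right _ measurable_const, setLIntegral_const, hvV, hvB']
      _ ≤ ENNReal.ofReal (3 * σ ^ 2 * b ^ 2) + ENNReal.ofReal (10 * σ * b) * ENNReal.ofReal b := by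
          gcongr
          refine le_trans ?_ hN
          have e := (measurePreserving_add_right (volume : Measure ℝ) y0).setLIntegral_comp_preimage
            mB' hNm
          refine le_trans e.le (lintegral_mono_set Set.inter_subset_left)
      _ ≤ _ := by
          rw [← ENNReal.ofReal_mul (by positivity), ← ENNReal.ofReal_add (by positivity)
            (by positivity)]
          apply ENNReal.ofReal_le_ofReal
          have : 0 < σ * b ^ 2 := by positivity
          nlinarith
  have hβpos : 0 < β := by linarith
  have hβsq : b ^ 2 * (1 - 4 * σ) ≤ β ^ 2 := by
    have : (b - 2 * (σ * b)) ^ 2 ≤ β ^ 2 := by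
      apply pow_le_pow_left₀ _ hβl
      linarith
    nlinarith [sq_nonneg (σ * b)]
  have hmain := circle_lemma L P mP _ hK (by
      rw [hvP, ← ENNReal.ofReal_pow hβpos.le, show (16 : ENNReal) = ENNReal.ofReal 16 by simp,
        ← ENNReal.ofReal_mul (by norm_num)]
      apply ENNReal.ofReal_le_ofReal
      have : 0 < b ^ 2 := by positivity
      nlinarith) (by rw [hvP]; simpa using hβpos)
  rw [hvP, ← ENNReal.ofReal_pow hβpos.le, ← ENNReal.ofReal_pow hβpos.le,
    ← ENNReal.ofReal_mul (by positivity), show (4 : ENNReal) = ENNReal.ofReal 4 by simp,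
    ← ENNReal.ofReal_mul (by norm_num), ← ENNReal.ofReal_mul (by positivity),
    ← ENNReal.ofReal_add (by positivity) (by positivity),
    ENNReal.ofReal_le_ofReal_iff (by positivity)] at hmain
  have hb3 : β ^ 3 ≤ b ^ 3 := pow_le_pow_left₀ hβpos.le hβb 3
  have h7 : b ^ 2 * ((1 - 48 * σ) * L) ≤ b ^ 2 * b := by
    have := mul_le_mul_of_nonneg_right hβsq hL.le
    nlinarith
  exact le_of_mul_le_mul_left h7 (by positivity)

/-- Structure theorem for near-equality in the Riesz-Sobolev inequality
for ⟨1_A * 1_A, 1_A⟩ on the real line. -/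
theorem riesz_sobolev_near_equality (A : Set ℝ) (hA : MeasurableSet A)
    (hfin : volume A < ⊤) (ε : ℝ) (hε : 0 < ε) (hε' : ε < 2 ^ (-100 : ℤ))
    (hint : (1 - ε) * ((3 : ℝ) / 4) * (volume A).toReal ^ 2 ≤
      ∫ x : ℝ, ∫ y : ℝ,
        A.indicator 1 y * A.indicator 1 (x - y) * A.indicator 1 x) :
    ∃ r : ℝ, 0 ≤ r ∧
      (volume (Set.Icc (-r) r)).toReal
        ≤ (1 + 561 * ε ^ ((1 : ℝ) / 4)) * (volume A).toReal ∧
      (1 - 21 * ε ^ ((1 : ℝ) / 4)) * (volume A).toReal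
        ≤ (volume (A ∩ Set.Icc (-r) r)).toReal := by
  have hAt : volume A ≠ ⊤ := hfin.ne
  rcases eq_or_ne (volume A) 0 with h0 | h0
  · refine ⟨0, le_rfl, ?_, ?_⟩
    · simp [h0]
    · simp [h0]
  have hapos : 0 < (volume A).toReal := ENNReal.toReal_pos h0 hAt
  obtain ⟨b, hb⟩ : ∃ b, b = (volume A).toReal / 2 := ⟨_, rfl⟩
  have hab : (volume A).toReal = 2 * b := by linarith
  have hbpos : 0 < b := by linarith
  have hvA : volume A = ENNReal.ofReal (2 * b) := by rw [← hab, ENNReal.ofReal_toReal hAt]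
  set δ := ε ^ ((1 : ℝ) / 4) with hδ
  have hδpos : 0 < δ := Real.rpow_pos_of_pos hε _
  have hδ4 : δ ^ 4 = ε := by
    rw [hδ, ← Real.rpow_natCast, ← Real.rpow_mul hε.le]
    norm_num
  have hδs : δ < 1 / 2 ^ 25 := by
    apply lt_of_pow_lt_pow_left₀ 4 (by positivity)
    rw [hδ4]
    refine hε'.trans_eq ?_
    norm_num
  obtain ⟨σ, hσ⟩ : ∃ σ, σ = δ ^ 2 := ⟨_, rfl⟩
  have hσpos : 0 < σ := by rw [hσ]; positivity
  have hσε : σ ^ 2 = ε := by rw [hσ, ← hδ4]; ring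
  have hσδ : σ ≤ δ / 2 ^ 25 := by rw [hσ]; nlinarith
  have hσs : σ ≤ 1 / 1000 := by
    refine hσδ.trans ?_
    norm_num at hδs ⊢
    linarith
  have hAfin : ∀ S : Set ℝ, volume (A ∩ S) ≠ ⊤ := fun S =>
    ne_top_of_le_ne_top hAt (measure_mono Set.inter_subset_left)
  -- rewriting the integral
  have mset : ∀ x : ℝ, MeasurableSet {y : ℝ | y ∈ A ∧ x - y ∈ A} := fun x =>
    hA.inter ((measurable_id.const_sub x) hA)
  have mf : Measurable (fun x : ℝ => volume {y : ℝ | y ∈ A ∧ x - y ∈ A}) :=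
    measurable_measure_prodMk_left
      (s := {p : ℝ × ℝ | p.2 ∈ A ∧ p.1 - p.2 ∈ A})
      ((measurable_snd hA).inter ((measurable_fst.sub measurable_snd) hA))
  have hT : ∫ x : ℝ, ∫ y : ℝ, (A.indicator 1 y * A.indicator 1 (x - y) * A.indicator 1 x : ℝ) =
      (∫⁻ x in A, volume {y : ℝ | y ∈ A ∧ x - y ∈ A}).toReal := by
    rw [← integral_toReal mf.aemeasurable (Filter.Eventually.of_forall fun x => (hAfin {y | x - y ∈ A}).lt_top),
      ← integral_indicator hA]
    congr 1
    ext x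
    rw [integral_mul_const]
    have : ∀ y : ℝ, (A.indicator 1 y * A.indicator 1 (x - y) : ℝ) =
        {y : ℝ | y ∈ A ∧ x - y ∈ A}.indicator 1 y := by
      intro y
      by_cases h1 : y ∈ A <;> by_cases h2 : x - y ∈ A <;> simp [h1, h2]
    simp only [this]
    rw [integral_indicator_one (mset x)]
    by_cases hx : x ∈ A <;> simp [hx, Measure.real]
  rw [hT] at hint
  obtain ⟨m, hm⟩ := quantile_exists A hA hAt b hbpos (by linarith)
  have hm1 : volume (A ∩ Set.Iic m) = ENNReal.ofReal b := by
    rw [← hm, ENNReal.ofReal_toReal (hAfin _)]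
  have hm2 : volume (A ∩ Set.Ioi m) = ENNReal.ofReal b := by
    have := measure_inter_add_sdiff (μ := volume) A (measurableSet_Iic (a := m))
    rw [show A \ Set.Iic m = A ∩ Set.Ioi m by ext; simp] at this
    have h2 := congrArg ENNReal.toReal this
    rw [ENNReal.toReal_add (hAfin _) (hAfin _)] at h2
    rw [← ENNReal.ofReal_toReal (hAfin (Set.Ioi m))]
    congr 1
    linarith
  have hdef := deficit A hA m _ hm1 hm2
  set T := ∫⁻ x in A, volume {y : ℝ | y ∈ A ∧ x - y ∈ A} with hTdef
  set E := (∫⁻ x in A ∩ Set.Iic (2 * m), volume {y : ℝ | y ∈ A ∩ Set.Iic m ∧ x - y ∉ A}) +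
      (∫⁻ x in A ∩ Set.Ioi (2 * m), volume {y : ℝ | y ∈ A ∩ Set.Ioi m ∧ x - y ∉ A}) with hE
  rw [show (3 : ENNReal) = ENNReal.ofReal 3 by simp, ← ENNReal.ofReal_pow hbpos.le,
    ← ENNReal.ofReal_mul (by norm_num)] at hdef
  have hTEt : T + E ≠ ⊤ := ne_top_of_le_ne_top ENNReal.ofReal_ne_top hdef
  have hTt : T ≠ ⊤ := fun h => hTEt (by rw [h]; simp)
  have hEt : E ≠ ⊤ := fun h => hTEt (by rw [h]; simp)
  have hEle : E ≤ ENNReal.ofReal (3 * σ ^ 2 * b ^ 2) := by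
    have h1 := ENNReal.toReal_mono ENNReal.ofReal_ne_top hdef
    rw [ENNReal.toReal_add hTt hEt, ENNReal.toReal_ofReal (by positivity)] at h1
    rw [← ENNReal.ofReal_toReal hEt]
    apply ENNReal.ofReal_le_ofReal
    rw [hab] at hint
    rw [hσε]
    nlinarith
  have key : ∃ L : ℝ, 0 < L ∧ 2 * b - 10 * σ * b ≤ (volume (A ∩ Set.Icc (-L) L)).toReal ∧
      (1 - 48 * σ) * L ≤ b := by
    rcases le_total 0 m with hm0 | hm0
    · refine line_lemma A (A ∩ Set.Iic m) hA (hA.inter measurableSet_Iic) b σ hbpos hσpos hσs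
        hm1 hvA ?_
      rw [swap_pairs A _ hA (hA.inter measurableSet_Iic)]
      refine le_trans (lintegral_mono_set ?_) (le_self_add.trans hEle)
      rintro u ⟨hu, hu2⟩
      refine ⟨hu, ?_⟩
      simp only [Set.mem_Iic] at *
      linarith
    · refine line_lemma A (A ∩ Set.Ioi m) hA (hA.inter measurableSet_Ioi) b σ hbpos hσpos hσs
        hm2 hvA ?_
      rw [swap_pairs A _ hA (hA.inter measurableSet_Ioi)]
      refine le_trans (lintegral_mono_set ?_) (le_add_self.trans hEle)
      rintro u ⟨hu, hu2⟩
      refine ⟨hu, ?_⟩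
      simp only [Set.mem_Ioi] at *
      linarith
  obtain ⟨L, hL, h1, h2⟩ := key
  have h25 : σ ≤ δ / 1000 := by
    refine hσδ.trans ?_
    norm_num
    linarith
  refine ⟨L, hL.le, ?_, ?_⟩
  · rw [Real.volume_Icc, ENNReal.toReal_ofReal (by linarith), hab]
    have h3 : L ≤ 2 * b := by nlinarith
    have h4 : L ≤ b + 96 * σ * b := by nlinarith
    nlinarith
  · refine le_trans ?_ h1
    rw [hab]
    nlinarith
end

section
/- Let A, B be finite nonempty sets of integers and let s ≥ 0. Let Γ ⊆ A × B be such that for each a ∈ A there are at most s values b ∈ B with (a, b) ∉ Γ, and for each b ∈ B there are at most s values a ∈ A with (a, b) ∉ Γ. Then |A +_Γ B| ≥ |A| + |B| − 2s − 1. -/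
open Finset

/-- Trivial lower bound for a restricted sumset. -/
theorem restricted_sumset_lower_bound (A B : Finset ℤ) (hA : A.Nonempty) (hB : B.Nonempty)
    (s : ℝ) (hs : 0 ≤ s) (Γ : Finset (ℤ × ℤ)) (hΓsub : Γ ⊆ A ×ˢ B)
    (hreg1 : ∀ a ∈ A, ((B.filter fun b => (a, b) ∉ Γ).card : ℝ) ≤ s)
    (hreg1' : ∀ b ∈ B, ((A.filter fun a => (a, b) ∉ Γ).card : ℝ) ≤ s) :
    (A.card : ℝ) + B.card - 2 * s - 1 ≤ ((Γ.image fun p => p.1 + p.2).card : ℝ) := by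
  classical
  set a₀ := A.min' hA with ha₀
  set b₁ := B.max' hB with hb₁
  have ha : a₀ ∈ A := A.min'_mem hA
  have hb : b₁ ∈ B := B.max'_mem hB
  set X := (B.filter fun b => (a₀, b) ∈ Γ).image fun b => a₀ + b with hX
  set Y := (A.filter fun a => (a, b₁) ∈ Γ).image fun a => a + b₁ with hY
  have hXc : X.card = (B.filter fun b => (a₀, b) ∈ Γ).card :=
    Finset.card_image_of_injective _ (add_right_injective a₀)
  have hYc : Y.card = (A.filter fun a => (a, b₁) ∈ Γ).card :=
    Finset.card_image_of_injective _ (add_left_injective b₁)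
  have h1 := hreg1 a₀ ha
  have h2 := hreg1' b₁ hb
  have e1 := Finset.card_filter_add_card_filter_not (s := B) (fun b => (a₀, b) ∈ Γ)
  have e2 := Finset.card_filter_add_card_filter_not (s := A) (fun a => (a, b₁) ∈ Γ)
  have hsub : X ∪ Y ⊆ Γ.image fun p => p.1 + p.2 := by
    intro z hz
    rcases Finset.mem_union.1 hz with h | h
    · obtain ⟨b, hb', rfl⟩ := Finset.mem_image.1 h
      exact Finset.mem_image.2 ⟨(a₀, b), (Finset.mem_filter.1 hb').2, rfl⟩
    · obtain ⟨a, ha', rfl⟩ := Finset.mem_image.1 h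
      exact Finset.mem_image.2 ⟨(a, b₁), (Finset.mem_filter.1 ha').2, rfl⟩
  have hint : (X ∩ Y).card ≤ 1 := by
    have : X ∩ Y ⊆ {a₀ + b₁} := by
      intro z hz
      obtain ⟨hx, hy⟩ := Finset.mem_inter.1 hz
      obtain ⟨b, hb', hbz⟩ := Finset.mem_image.1 hx
      obtain ⟨a, ha', haz⟩ := Finset.mem_image.1 hy
      have l1 : b ≤ b₁ := B.le_max' b (Finset.mem_filter.1 hb').1
      have l2 : a₀ ≤ a := A.min'_le a (Finset.mem_filter.1 ha').1
      rw [Finset.mem_singleton]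
      linarith
    simpa using Finset.card_le_card this
  have hu := Finset.card_union_add_card_inter X Y
  have hle := Finset.card_le_card hsub
  have key : A.card + B.card ≤ (Γ.image fun p => p.1 + p.2).card + 1 +
      (B.filter fun b => (a₀, b) ∉ Γ).card + (A.filter fun a => (a, b₁) ∉ Γ).card := by
    omega
  have key' : (A.card : ℝ) + B.card ≤ ((Γ.image fun p => p.1 + p.2).card : ℝ) + 1 +
      ((B.filter fun b => (a₀, b) ∉ Γ).card : ℝ) +
      ((A.filter fun a => (a, b₁) ∉ Γ).card : ℝ) := by
    exact_mod_cast key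
  linarith
end

section
/- Let ℓ be a positive integer and let A, B ⊆ {0, 1, …, ℓ} with 0, ℓ ∈ A and 0 ∈ B. Let Γ ⊆ A × B be such that A +_Γ B is (K, s)-regular for some K ≥ 2 and s ≥ 0. Let Ã, B̃ ⊆ ℤ/ℓℤ be the images of A, B under reduction modulo ℓ, and let Γ̃ ⊆ Ã × B̃ be the image of Γ under coordinatewise reduction modulo ℓ. Then Ã +_{Γ̃} B̃ is (2K, s)-regular; that is: (1) for each ã ∈ Ã there are at most s values b̃ ∈ B̃ with (ã, b̃) ∉ Γ̃, and for each b̃ ∈ B̃ there are at most s values ã ∈ Ã with (ã, b̃) ∉ Γ̃; and (2) every x̃ ∈ ℤ/ℓℤ with r_{Ã+B̃}(x̃) ≥ 2K lies in à +_{Γ̃} B̃. -/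
open Finset

/-- Reduction modulo ℓ preserves regularity: if A +_Γ B is (K,s)-regular
then the reduced restricted sumset is (2K,s)-regular. -/
theorem reduction_mod_ell_regular (ℓ : ℕ) (hℓ : 0 < ℓ) (A B : Finset ℤ)
    (hAsub : A ⊆ Finset.Icc 0 (ℓ : ℤ)) (hBsub : B ⊆ Finset.Icc 0 (ℓ : ℤ))
    (h0A : (0 : ℤ) ∈ A) (hℓA : (ℓ : ℤ) ∈ A) (h0B : (0 : ℤ) ∈ B)
    (Γ : Finset (ℤ × ℤ)) (hΓsub : Γ ⊆ A ×ˢ B)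
    (K s : ℝ) (hK : 2 ≤ K) (hs : 0 ≤ s)
    (hreg1 : ∀ a ∈ A, ((B.filter fun b => (a, b) ∉ Γ).card : ℝ) ≤ s)
    (hreg1' : ∀ b ∈ B, ((A.filter fun a => (a, b) ∉ Γ).card : ℝ) ≤ s)
    (hreg2 : ∀ x : ℤ, K ≤ (((A ×ˢ B).filter fun p => p.1 + p.2 = x).card : ℝ) →
      x ∈ Γ.image fun p => p.1 + p.2) :
    (∀ a1 ∈ A.image (Int.cast : ℤ → ZMod ℓ),
      (((B.image (Int.cast : ℤ → ZMod ℓ)).filter fun b1 =>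
        (a1, b1) ∉ Γ.image fun p : ℤ × ℤ =>
          ((p.1 : ZMod ℓ), (p.2 : ZMod ℓ))).card : ℝ) ≤ s) ∧
    (∀ b1 ∈ B.image (Int.cast : ℤ → ZMod ℓ),
      (((A.image (Int.cast : ℤ → ZMod ℓ)).filter fun a1 =>
        (a1, b1) ∉ Γ.image fun p : ℤ × ℤ =>
          ((p.1 : ZMod ℓ), (p.2 : ZMod ℓ))).card : ℝ) ≤ s) ∧
    (∀ x1 : ZMod ℓ,
      2 * K ≤ ((((A.image (Int.cast : ℤ → ZMod ℓ)) ×ˢ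
          (B.image (Int.cast : ℤ → ZMod ℓ))).filter
          fun p => p.1 + p.2 = x1).card : ℝ) →
      x1 ∈ (Γ.image fun p : ℤ × ℤ =>
        ((p.1 : ZMod ℓ), (p.2 : ZMod ℓ))).image fun q => q.1 + q.2) := by
  classical
  refine ⟨?_, ?_, ?_⟩
  · intro a1 ha1
    obtain ⟨a, ha, rfl⟩ := Finset.mem_image.1 ha1
    refine le_trans ?_ (hreg1 a ha)
    refine Nat.cast_le.2 (le_trans (Finset.card_le_card ?_) (Finset.card_image_le
      (f := (Int.cast : ℤ → ZMod ℓ))))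
    intro b1 hb1
    obtain ⟨hb0, hn⟩ := Finset.mem_filter.1 hb1
    obtain ⟨b, hb, rfl⟩ := Finset.mem_image.1 hb0
    exact Finset.mem_image.2 ⟨b, Finset.mem_filter.2 ⟨hb, fun h =>
      hn (Finset.mem_image.2 ⟨(a, b), h, rfl⟩)⟩, rfl⟩
  · intro b1 hb1
    obtain ⟨b, hb, rfl⟩ := Finset.mem_image.1 hb1
    refine le_trans ?_ (hreg1' b hb)
    refine Nat.cast_le.2 (le_trans (Finset.card_le_card ?_) (Finset.card_image_le
      (f := (Int.cast : ℤ → ZMod ℓ))))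
    intro a1 ha1
    obtain ⟨ha0, hn⟩ := Finset.mem_filter.1 ha1
    obtain ⟨a, ha, rfl⟩ := Finset.mem_image.1 ha0
    exact Finset.mem_image.2 ⟨a, Finset.mem_filter.2 ⟨ha, fun h =>
      hn (Finset.mem_image.2 ⟨(a, b), h, rfl⟩)⟩, rfl⟩
  · intro x1 hx1
    have : NeZero ℓ := ⟨hℓ.ne'⟩
    obtain ⟨y, hy0, hyl, hyx⟩ : ∃ y : ℤ, 0 ≤ y ∧ y < ℓ ∧ (y : ZMod ℓ) = x1 :=
      ⟨(x1.val : ℤ), by positivity, by exact_mod_cast ZMod.val_lt x1, by simp⟩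
    have key : ∀ z : ℤ, (z : ZMod ℓ) = x1 →
        K ≤ (((A ×ˢ B).filter fun p => p.1 + p.2 = z).card : ℝ) →
        x1 ∈ (Γ.image fun p : ℤ × ℤ =>
          ((p.1 : ZMod ℓ), (p.2 : ZMod ℓ))).image fun q => q.1 + q.2 := by
      intro z hz hKz
      obtain ⟨p, hp, hpz⟩ := Finset.mem_image.1 (hreg2 z hKz)
      refine Finset.mem_image.2 ⟨_, Finset.mem_image.2 ⟨p, hp, rfl⟩, ?_⟩
      rw [← hz, ← hpz]
      push_cast
      rfl
    have hsub : (((A.image (Int.cast : ℤ → ZMod ℓ)) ×ˢ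
          (B.image (Int.cast : ℤ → ZMod ℓ))).filter fun p => p.1 + p.2 = x1) ⊆
        (((A ×ˢ B).filter fun p => p.1 + p.2 = y) ∪
          ((A ×ˢ B).filter fun p => p.1 + p.2 = y + ℓ)).image
          (fun p : ℤ × ℤ => ((p.1 : ZMod ℓ), (p.2 : ZMod ℓ))) := by
      rintro ⟨a1, b1⟩ h
      obtain ⟨hab, hsum⟩ := Finset.mem_filter.1 h
      obtain ⟨ha0, hb0⟩ := Finset.mem_product.1 hab
      obtain ⟨a, ha, hae⟩ := Finset.mem_image.1 ha0
      obtain ⟨b, hb, hbe⟩ := Finset.mem_image.1 hb0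
      simp only at hae hbe hsum
      subst hae hbe
      have hA := Finset.mem_Icc.1 (hAsub ha)
      have hB := Finset.mem_Icc.1 (hBsub hb)
      have hd : ((y : ℤ) : ZMod ℓ) = ((a + b : ℤ) : ZMod ℓ) := by
        push_cast; rw [hyx, hsum]
      obtain ⟨k, hk⟩ := (ZMod.intCast_eq_intCast_iff_dvd_sub _ _ _).1 hd
      have hl : (0 : ℤ) < ℓ := by exact_mod_cast hℓ
      have hk0 : 0 ≤ k := by
        by_contra hc
        have : k ≤ -1 := by omega
        nlinarith
      have hk2 : k ≤ 2 := by
        by_contra hc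
        have : 3 ≤ k := by omega
        nlinarith
      have hk' : k = 0 ∨ k = 1 ∨ k = 2 := by omega
      rcases hk' with rfl | rfl | rfl
      · exact Finset.mem_image.2 ⟨(a, b), Finset.mem_union_left _ (Finset.mem_filter.2
          ⟨Finset.mem_product.2 ⟨ha, hb⟩, by simp only; linarith⟩), rfl⟩
      · exact Finset.mem_image.2 ⟨(a, b), Finset.mem_union_right _ (Finset.mem_filter.2
          ⟨Finset.mem_product.2 ⟨ha, hb⟩, by simp only; linarith⟩), rfl⟩
      · have h1 : a = ℓ := by linarith
        have h2 : b = ℓ := by linarith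
        have h3 : y = 0 := by linarith
        refine Finset.mem_image.2 ⟨((ℓ : ℤ), 0), Finset.mem_union_right _ (Finset.mem_filter.2
          ⟨Finset.mem_product.2 ⟨hℓA, h0B⟩, by simp only; linarith⟩), ?_⟩
        simp [h1, h2]
    have hc := (Finset.card_le_card hsub).trans (Finset.card_image_le.trans
      (Finset.card_union_le _ _))
    have hc' := (Nat.cast_le (α := ℝ)).2 hc
    rw [Nat.cast_add] at hc'
    by_cases h1 : K ≤ (((A ×ˢ B).filter fun p => p.1 + p.2 = y).card : ℝ)
    · exact key y hyx h1
    · exact key (y + ℓ) (by push_cast; simp [hyx]) (by push Not at h1; linarith)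
end

section
/- Let G be an abelian group and let A, B ⊆ G be finite sets with n = |A| ≤ |B|, and let θ = (1+√5)/2. Let Γ ⊆ A × B be such that A +_Γ B is (K, s)-regular for some K, s ≥ 0, and assume |A +_Γ B| ≤ θn − K − 2s. Then for every c ∈ B − B one has r_{A−A}(c) ≥ (2 − θ)n + K, and for every d ∈ A − A one has r_{B−B}(d) ≥ 2|B| − θn + K. -/
open Finset Pointwise

lemma aux_reps {G : Type*} [AddCommGroup G] [DecidableEq G] (X S : Finset G) (u v : G) (s : ℝ)
    (hu : ((X.filter fun x => x + u ∉ S).card : ℝ) ≤ s)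
    (hv : ((X.filter fun x => x + v ∉ S).card : ℝ) ≤ s) :
    2 * (X.card : ℝ) - 2 * s - S.card
      ≤ (((X ×ˢ X).filter fun p => p.1 - p.2 = v - u).card : ℝ) := by
  have key : ∀ w : G, ((X.filter fun x => x + w ∈ S).image (· + w)).card
      + (X.filter fun x => x + w ∉ S).card = X.card := by
    intro w
    rw [card_image_of_injective _ (add_left_injective w)]
    exact card_filter_add_card_filter_not (s := X) (fun x => x + w ∈ S)
  have h1 := key u
  have h2 := key v
  set P := (X.filter fun x => x + u ∈ S).image (· + u) with hP
  set Q := (X.filter fun x => x + v ∈ S).image (· + v) with hQ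
  have h3 := card_union_add_card_inter P Q
  have h4 : (P ∪ Q).card ≤ S.card := by
    apply card_le_card
    intro y hy
    simp only [hP, hQ, mem_union, mem_image, mem_filter] at hy
    rcases hy with ⟨x, ⟨_, h⟩, rfl⟩ | ⟨x, ⟨_, h⟩, rfl⟩ <;> exact h
  have h5 : (P ∩ Q).card ≤ ((X ×ˢ X).filter fun p => p.1 - p.2 = v - u).card := by
    apply card_le_card_of_injOn (fun y => (y - u, y - v))
    · intro y hy
      simp only [hP, hQ, coe_inter, Set.mem_inter_iff, mem_coe, mem_image, mem_filter] at hy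
      obtain ⟨⟨x, ⟨hx, _⟩, hxy⟩, ⟨z, ⟨hz, _⟩, hzy⟩⟩ := hy
      simp only [mem_coe, mem_filter, mem_product]
      refine ⟨⟨?_, ?_⟩, by abel⟩
      · rw [← hxy]; simpa using hx
      · rw [← hzy]; simpa using hz
    · intro y _ z _ h
      simpa using (Prod.ext_iff.1 h).1
  have h1' : (P.card : ℝ) + ((X.filter fun x => x + u ∉ S).card : ℝ) = X.card := by
    exact_mod_cast h1
  have h2' : (Q.card : ℝ) + ((X.filter fun x => x + v ∉ S).card : ℝ) = X.card := by
    exact_mod_cast h2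
  have h3' : ((P ∪ Q).card : ℝ) + (P ∩ Q).card = P.card + Q.card := by exact_mod_cast h3
  have h4' : ((P ∪ Q).card : ℝ) ≤ S.card := by exact_mod_cast h4
  have h5' : ((P ∩ Q).card : ℝ) ≤ (((X ×ˢ X).filter fun p => p.1 - p.2 = v - u).card : ℝ) := by
    exact_mod_cast h5
  linarith

/-- If the restricted sumset is small, every difference from B - B has many
representations in A - A, and vice versa. -/
theorem many_representations {G : Type*} [AddCommGroup G] [DecidableEq G]
    (A B : Finset G) (n : ℕ) (hn : A.card = n) (hAB : A.card ≤ B.card)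
    (Γ : Finset (G × G)) (hΓsub : Γ ⊆ A ×ˢ B)
    (K s : ℝ) (hK : 0 ≤ K) (hs : 0 ≤ s)
    (hreg1 : ∀ a ∈ A, ((B.filter fun b => (a, b) ∉ Γ).card : ℝ) ≤ s)
    (hreg1' : ∀ b ∈ B, ((A.filter fun a => (a, b) ∉ Γ).card : ℝ) ≤ s)
    (hreg2 : ∀ x : G, K ≤ (((A ×ˢ B).filter fun p => p.1 + p.2 = x).card : ℝ) →
      x ∈ Γ.image fun p => p.1 + p.2)
    (hsmall : ((Γ.image fun p => p.1 + p.2).card : ℝ)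
      ≤ (Real.sqrt 5 + 1) / 2 * n - K - 2 * s) :
    (∀ c ∈ B - B,
      (2 - (Real.sqrt 5 + 1) / 2) * n + K
        ≤ (((A ×ˢ A).filter fun p => p.1 - p.2 = c).card : ℝ)) ∧
    (∀ d ∈ A - A,
      2 * (B.card : ℝ) - (Real.sqrt 5 + 1) / 2 * n + K
        ≤ (((B ×ˢ B).filter fun p => p.1 - p.2 = d).card : ℝ)) := by
  have hS : ∀ a b, (a, b) ∈ Γ → a + b ∈ Γ.image fun p => p.1 + p.2 :=
    fun a b h => mem_image.2 ⟨(a, b), h, rfl⟩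
  clear hreg2
  generalize (Γ.image fun p => p.1 + p.2) = S at hS hsmall
  have hA : ∀ b ∈ B, ((A.filter fun a => a + b ∉ S).card : ℝ) ≤ s := by
    intro b hb
    refine le_trans ?_ (hreg1' b hb)
    have : (A.filter fun a => a + b ∉ S).card
        ≤ (A.filter fun a => (a, b) ∉ Γ).card :=
      card_le_card (monotone_filter_right _ fun a _ h h' => h (hS a b h'))
    exact_mod_cast this
  have hB : ∀ a ∈ A, ((B.filter fun b => b + a ∉ S).card : ℝ) ≤ s := by
    intro a ha
    refine le_trans ?_ (hreg1 a ha)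
    have : (B.filter fun b => b + a ∉ S).card
        ≤ (B.filter fun b => (a, b) ∉ Γ).card :=
      card_le_card (monotone_filter_right _ fun b _ h h' =>
        h (add_comm a b ▸ hS a b h'))
    exact_mod_cast this
  constructor
  · intro c hc
    obtain ⟨v, hv, u, hu, rfl⟩ := mem_sub.1 hc
    have := aux_reps A S u v s (hA u hu) (hA v hv)
    rw [hn] at this
    linarith
  · intro d hd
    obtain ⟨v, hv, u, hu, rfl⟩ := mem_sub.1 hd
    have := aux_reps B S u v s (hB u hu) (hB v hv)
    linarith
end
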